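/- Assume the standing assumptions (B). Let u^ε ∈ C(Q̄) ∩ C^{2,1}(Q) be classical solutions of (QL) that are bounded on Q uniformly in ε. Suppose there exist sequences {μ_k}, {λ_k} ⊂ (0,∞) and {ε_k} ⊂ (0,1) and constants 0 < a₁ < a₂ and β₁, β₂ ∈ ℝ such that ε_k → 0 and, for all k, a₁ ≤ μ_k < λ_k ≤ a₂, u^{ε_k}(0, exp(μ_k/ε_k)) = β₁ and u^{ε_k}(0, exp(λ_k/ε_k)) = β₂. If β₁ ≠ β₂, then limsup_{k→∞} λ_k ≥ M(β₂). -/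

import Mathlib

open Set Filter Metric Topology
open scoped ENNReal

noncomputable section

/-- `n`-dimensional Euclidean space. -/
abbrev Eu (n : ℕ) := EuclideanSpace ℝ (Fin n)

variable {n : ℕ}

/-- Euclidean dot product. -/
def dotp (x y : Eu n) : ℝ := ∑ i, x i * y i

/-- The quadratic form `A p · p` of a matrix `A`. -/
def mquad (A : Matrix (Fin n) (Fin n) ℝ) (p : Eu n) : ℝ := ∑ i, ∑ j, A i j * p i * p j

/-- `A ∈ 𝕊ⁿ(θ)`: symmetric with `θ I ≤ A ≤ θ⁻¹ I`. -/
def memS (θ : ℝ) (A : Matrix (Fin n) (Fin n) ℝ) : Prop :=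
  A.IsSymm ∧ ∀ p : Eu n, θ * ‖p‖ ^ 2 ≤ mquad A p ∧ mquad A p ≤ θ⁻¹ * ‖p‖ ^ 2

/-- order of symmetric matrices (via quadratic forms). -/
def mle (A B : Matrix (Fin n) (Fin n) ℝ) : Prop := ∀ p : Eu n, mquad A p ≤ mquad B p

/-- trace of the product `A·H`. -/
def trMul (A H : Matrix (Fin n) (Fin n) ℝ) : ℝ := ∑ i, ∑ j, A i j * H j i

/-- the Pucci maximal operator associated with `𝕊ⁿ(θ)`. -/
def pucci (θ : ℝ) (X : Matrix (Fin n) (Fin n) ℝ) : ℝ :=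
  sSup ((fun A => trMul A X) '' {A | memS θ A})

/-- time derivative of `u(x,t)`. -/
def tD (u : Eu n → ℝ → ℝ) (x : Eu n) (t : ℝ) : ℝ := deriv (u x) t

/-- spatial gradient of `u(x,t)`. -/
def sG (u : Eu n → ℝ → ℝ) (x : Eu n) (t : ℝ) : Eu n := gradient (fun y => u y t) x

/-- spatial Hessian matrix of `u(x,t)`. -/
def sH (u : Eu n → ℝ → ℝ) (x : Eu n) (t : ℝ) : Matrix (Fin n) (Fin n) ℝ :=
  fun i j => fderiv ℝ (fun y => sG u y t i) x (EuclideanSpace.single j 1)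

/-- Hessian matrix of a static function. -/
def hessS (v : Eu n → ℝ) (x : Eu n) : Matrix (Fin n) (Fin n) ℝ :=
  fun i j => fderiv ℝ (fun y => gradient v y i) x (EuclideanSpace.single j 1)

/-- closed parabolic cylinder `Q̄_T = closure Ω × [0,T]` (with `T ∈ (0,∞]`). -/
def cylC (Ω : Set (Eu n)) (T : ℝ≥0∞) : Set (Eu n × ℝ) :=
  {p | p.1 ∈ closure Ω ∧ 0 ≤ p.2 ∧ ENNReal.ofReal p.2 ≤ T}

/-- open parabolic cylinder `Q_T = Ω × (0,T)`. -/
def cylO (Ω : Set (Eu n)) (T : ℝ≥0∞) : Set (Eu n × ℝ) :=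
  {p | p.1 ∈ Ω ∧ 0 < p.2 ∧ ENNReal.ofReal p.2 < T}

/-- `u ∈ C^{2,1}(Q_T)`. -/
def C21 (u : Eu n → ℝ → ℝ) (Ω : Set (Eu n)) (T : ℝ≥0∞) : Prop :=
  (∀ x ∈ Ω, ∀ t : ℝ, 0 < t → ENNReal.ofReal t < T →
     ContDiffAt ℝ 2 (fun y => u y t) x ∧ DifferentiableAt ℝ (u x) t) ∧
  ContinuousOn (fun p : Eu n × ℝ => tD u p.1 p.2) (cylO Ω T) ∧
  ContinuousOn (fun p : Eu n × ℝ => sH u p.1 p.2) (cylO Ω T)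

/-- `u ∈ C(Q̄_T) ∩ C^{2,1}(Q_T)`. -/
def Classical21 (u : Eu n → ℝ → ℝ) (Ω : Set (Eu n)) (T : ℝ≥0∞) : Prop :=
  ContinuousOn (fun p : Eu n × ℝ => u p.1 p.2) (cylC Ω T) ∧ C21 u Ω T

/-- a coefficient field in `C(Q̄_T; 𝕊ⁿ(θ))`. -/
def MatC (θ : ℝ) (A : Eu n → ℝ → Matrix (Fin n) (Fin n) ℝ) (Ω : Set (Eu n))
    (T : ℝ≥0∞) : Prop :=
  ContinuousOn (fun p : Eu n × ℝ => A p.1 p.2) (cylC Ω T) ∧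
  ∀ p ∈ cylC Ω T, memS θ (A p.1 p.2)

/-- `u` is a classical solution of `u_t = ε tr[A D²u] + b·Du` in `Q_T`. -/
def SolveL (ε : ℝ) (A : Eu n → ℝ → Matrix (Fin n) (Fin n) ℝ) (b : Eu n → Eu n)
    (u : Eu n → ℝ → ℝ) (Ω : Set (Eu n)) (T : ℝ≥0∞) : Prop :=
  ∀ x ∈ Ω, ∀ t : ℝ, 0 < t → ENNReal.ofReal t < T →
    tD u x t = ε * trMul (A x t) (sH u x t) + dotp (b x) (sG u x t)

/-- `u` is a classical subsolution of `(L)` in `Q_T`. -/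
def SubsolL (ε : ℝ) (A : Eu n → ℝ → Matrix (Fin n) (Fin n) ℝ) (b : Eu n → Eu n)
    (u : Eu n → ℝ → ℝ) (Ω : Set (Eu n)) (T : ℝ≥0∞) : Prop :=
  ∀ x ∈ Ω, ∀ t : ℝ, 0 < t → ENNReal.ofReal t < T →
    tD u x t ≤ ε * trMul (A x t) (sH u x t) + dotp (b x) (sG u x t)

/-- `u` is a classical supersolution of `(L)` in `Q_T`. -/
def SupersolL (ε : ℝ) (A : Eu n → ℝ → Matrix (Fin n) (Fin n) ℝ) (b : Eu n → Eu n)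
    (u : Eu n → ℝ → ℝ) (Ω : Set (Eu n)) (T : ℝ≥0∞) : Prop :=
  ∀ x ∈ Ω, ∀ t : ℝ, 0 < t → ENNReal.ofReal t < T →
    ε * trMul (A x t) (sH u x t) + dotp (b x) (sG u x t) ≤ tD u x t

/-- viscosity subsolution of `H(x,Du) = 0` on `A`. -/
def ViscSub (H : Eu n → Eu n → ℝ) (A : Set (Eu n)) (u : Eu n → ℝ) : Prop :=
  ∀ φ : Eu n → ℝ, ContDiff ℝ 1 φ → ∀ x ∈ A,
    IsLocalMaxOn (fun y => u y - φ y) A x → H x (gradient φ x) ≤ 0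

/-- viscosity supersolution of `H(x,Du) = 0` on `A`. -/
def ViscSup (H : Eu n → Eu n → ℝ) (A : Set (Eu n)) (u : Eu n → ℝ) : Prop :=
  ∀ φ : Eu n → ℝ, ContDiff ℝ 1 φ → ∀ x ∈ A,
    IsLocalMinOn (fun y => u y - φ y) A x → 0 ≤ H x (gradient φ x)

/-- the Hamiltonian `H_α(x,p) = α(x) p·p + b(x)·p`. -/
def Ham (α : Eu n → Matrix (Fin n) (Fin n) ℝ) (b : Eu n → Eu n) (x p : Eu n) : ℝ :=
  mquad (α x) p + dotp (b x) p

/-- the quasi-potential `V_α`: the pointwise supremum (= maximal element) of all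
Lipschitz viscosity subsolutions of `H_α(x,Du)=0` in `Ω` vanishing at the origin. -/
def Vq (α : Eu n → Matrix (Fin n) (Fin n) ℝ) (b : Eu n → Eu n) (Ω : Set (Eu n))
    (x : Eu n) : ℝ :=
  sSup {r | ∃ u : Eu n → ℝ, (∃ K : NNReal, LipschitzOnWith K u (closure Ω)) ∧
    u 0 = 0 ∧ ViscSub (Ham α b) Ω u ∧ r = u x}

/-- `M_α = min_{∂Ω} V_α`. -/
def Mq (α : Eu n → Matrix (Fin n) (Fin n) ℝ) (b : Eu n → Eu n) (Ω : Set (Eu n)) : ℝ :=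
  sInf (Vq α b Ω '' frontier Ω)

/-- `argmin (V_α | ∂Ω)`. -/
def argminV (α : Eu n → Matrix (Fin n) (Fin n) ℝ) (b : Eu n → Eu n)
    (Ω : Set (Eu n)) : Set (Eu n) :=
  {x ∈ frontier Ω | ∀ y ∈ frontier Ω, Vq α b Ω x ≤ Vq α b Ω y}

/-- `Σ_α^m = {x ∈ Ω̄ : V_α(x) ≤ m}`. -/
def SigmaM (α : Eu n → Matrix (Fin n) (Fin n) ℝ) (b : Eu n → Eu n) (Ω : Set (Eu n))
    (m : ℝ) : Set (Eu n) :=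
  {x ∈ closure Ω | Vq α b Ω x ≤ m}

/-- `Ω` is a bounded `C¹` domain with outward unit normal `ν`. -/
def IsBdC1With (Ω : Set (Eu n)) (ν : Eu n → Eu n) : Prop :=
  IsOpen Ω ∧ Bornology.IsBounded Ω ∧
  ∃ ρ : Eu n → ℝ, ContDiff ℝ 1 ρ ∧ Ω = {x | ρ x < 0} ∧
    ∀ x ∈ frontier Ω, gradient ρ x ≠ 0 ∧ ν x = ‖gradient ρ x‖⁻¹ • gradient ρ x

/-- `X` is the flow of `b`, and the origin is globally asymptotically stable. -/
def GAS (b : Eu n → Eu n) (X : ℝ → Eu n → Eu n) : Prop :=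
  (∀ x, X 0 x = x) ∧ (∀ x t, HasDerivAt (fun s => X s x) (b (X t x)) t) ∧
  (∀ x, Tendsto (fun t => X t x) atTop (nhds 0)) ∧
  (∀ ε > (0:ℝ), ∃ δ > (0:ℝ), ∀ x : Eu n, ‖x‖ < δ → ∀ t ≥ (0:ℝ), ‖X t x‖ < ε)

/-- `Ω_δ = {x ∈ Ω : dist(x,∂Ω) > δ}`. -/
def Omd (Ω : Set (Eu n)) (δ : ℝ) : Set (Eu n) := {x ∈ Ω | δ < infDist x (frontier Ω)}

/-- `Ω^Π_δ = {x ∈ Ω̄ : dist(x, ∂Ω \ Π) > δ}`. -/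
def OmPid (Ω Pset : Set (Eu n)) (δ : ℝ) : Set (Eu n) :=
  {x ∈ closure Ω | δ < infDist x (frontier Ω \ Pset)}

/-- the standing assumptions (B). -/
structure SettingB (n : ℕ) where
  Ω : Set (Eu n)
  ν : Eu n → Eu n
  g : Eu n → ℝ
  θ₀ : ℝ
  a : Eu n → ℝ → Matrix (Fin n) (Fin n) ℝ
  b : Eu n → Eu n
  b₀ : ℝ
  r₀ : ℝ
  θ₀_mem : θ₀ ∈ Set.Ioc (0 : ℝ) 1
  domain : IsBdC1With Ω ν
  zero_mem : (0 : Eu n) ∈ Ω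
  g_cont : ContinuousOn g (closure Ω)
  a_cont : ContinuousOn (fun p : Eu n × ℝ => a p.1 p.2) (closure Ω ×ˢ Set.univ)
  a_mem : ∀ x ∈ closure Ω, ∀ c : ℝ, memS θ₀ (a x c)
  b_lip : ∃ K : NNReal, LipschitzWith K b
  b_zero : b 0 = 0
  b_gas : ∃ X : ℝ → Eu n → Eu n, GAS b X
  b_inward : ∀ x ∈ frontier Ω, dotp (b x) (ν x) < 0
  b₀_pos : 0 < b₀
  r₀_pos : 0 < r₀
  ball_sub : closedBall (0 : Eu n) r₀ ⊆ Ω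
  b_coerc : ∀ x ∈ ball (0 : Eu n) r₀, dotp (b x) x ≤ -b₀ * ‖x‖ ^ 2

namespace SettingB

variable (S : SettingB n)

/-- the quasi-potential `V^c` associated with `(a(·,c), b)`. -/
def Vc (c : ℝ) : Eu n → ℝ := Vq (fun x => S.a x c) S.b S.Ω

/-- `M(c) = min_{∂Ω} V^c`. -/
def M (c : ℝ) : ℝ := sInf (S.Vc c '' frontier S.Ω)

/-- `G(c) = {g(x) : x ∈ argmin(V^c|∂Ω)}`. -/
def Gset (c : ℝ) : Set ℝ := S.g '' argminV (fun x => S.a x c) S.b S.Ω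

/-- `G⁺(c) = max G(c)`. -/
def Gp (c : ℝ) : ℝ := sSup (S.Gset c)

/-- `G⁻(c) = min G(c)`. -/
def Gm (c : ℝ) : ℝ := sInf (S.Gset c)

/-- `c₀ = g(0)`. -/
def c0 : ℝ := S.g 0

/-- `g_min = min_{Ω̄} g`. -/
def gmin : ℝ := sInf (S.g '' closure S.Ω)

/-- `g_max = max_{Ω̄} g`. -/
def gmax : ℝ := sSup (S.g '' closure S.Ω)

/-- the crossing value `c₁`. -/
def c1 : ℝ :=
  if S.c0 ≤ S.Gp S.c0 then sInf {c | S.c0 ≤ c ∧ S.Gm c ≤ c}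
  else sSup {c | c ≤ S.c0 ∧ c ≤ S.Gp c}

/-- the function `c̄ : (0,∞) → I_g`. -/
def cbar (l : ℝ) : ℝ :=
  if l < S.M S.c0 ∨ S.c1 = S.c0 then S.c0
  else if S.c0 < S.c1 then min S.c1 (sInf {c | c ∈ Set.Icc S.c0 S.c1 ∧ S.M c = l})
  else max S.c1 (sSup {c | c ∈ Set.Icc S.c1 S.c0 ∧ S.M c = l})

/-- assumption (FK13): `G⁺(c₀) = G⁻(c₀)`. -/
def FK13 : Prop := S.Gp S.c0 = S.Gm S.c0

/-- assumption (FK12). -/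
def FK12 : Prop :=
  ∀ δ₀ > (0:ℝ), ∃ δ ∈ Set.Ioc (0:ℝ) δ₀,
    (S.c1 ≤ S.c0 ∧ S.gmin < S.c1 → S.c1 - δ < S.Gm (S.c1 - δ)) ∧
    (S.c0 ≤ S.c1 ∧ S.c1 < S.gmax → S.Gp (S.c1 + δ) < S.c1 + δ)

/-- `u` is a classical (`C(Q̄) ∩ C^{2,1}(Q)`) solution of the quasi-linear equation (QL). -/
def SolvesQL (ε : ℝ) (u : Eu n → ℝ → ℝ) : Prop :=
  Classical21 u S.Ω ⊤ ∧ SolveL ε (fun x t => S.a x (u x t)) S.b u S.Ω ⊤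

/-- the boundary condition (BC): `u = g` on the parabolic boundary of `Q`. -/
def BC (u : Eu n → ℝ → ℝ) : Prop :=
  (∀ x ∈ closure S.Ω, u x 0 = S.g x) ∧ ∀ x ∈ frontier S.Ω, ∀ t > (0:ℝ), u x t = S.g x

end SettingB

section Part1

/-! ### Linear algebra -/

theorem dotp_eq_inner (x y : Eu n) : dotp x y = inner ℝ x y := by
  simp [dotp, PiLp.inner_apply, mul_comm]

theorem mquad_eq_dot (A : Matrix (Fin n) (Fin n) ℝ) (p : Eu n) :
    mquad A p = (p : Fin n → ℝ) ⬝ᵥ A.mulVec (p : Fin n → ℝ) := by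
  simp only [mquad, dotProduct, Matrix.mulVec, Finset.mul_sum]
  refine Finset.sum_congr rfl fun i _ => Finset.sum_congr rfl fun j _ => by ring

theorem posSemidef_of_mquad {A : Matrix (Fin n) (Fin n) ℝ} (hs : A.IsSymm)
    (h : ∀ p : Eu n, 0 ≤ mquad A p) : A.PosSemidef := by
  refine .of_dotProduct_mulVec_nonneg ?_ fun x => ?_
  · rw [Matrix.IsHermitian, Matrix.conjTranspose_eq_transpose_of_trivial]; exact hs
  · have := h (WithLp.toLp 2 x)
    rw [mquad_eq_dot] at this
    simpa using this

theorem exists_root {A : Matrix (Fin n) (Fin n) ℝ} (hs : A.IsSymm)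
    (h : ∀ p : Eu n, 0 ≤ mquad A p) :
    ∃ B : Matrix (Fin n) (Fin n) ℝ, A = B.transpose * B := by
  open scoped MatrixOrder in
  obtain ⟨B, hB⟩ := CStarAlgebra.nonneg_iff_eq_star_mul_self.mp (posSemidef_of_mquad hs h).nonneg
  refine ⟨B, ?_⟩
  rw [hB, Matrix.star_eq_conjTranspose, Matrix.conjTranspose_eq_transpose_of_trivial]

theorem trMul_eq_trace (A H : Matrix (Fin n) (Fin n) ℝ) : trMul A H = (A * H).trace := by
  simp [trMul, Matrix.trace, Matrix.mul_apply]

theorem trMul_root (B H : Matrix (Fin n) (Fin n) ℝ) :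
    trMul (B.transpose * B) H = ∑ k, mquad H (WithLp.toLp 2 (B k)) := by
  simp only [trMul, Matrix.mul_apply, Matrix.transpose_apply, mquad, Finset.sum_mul]
  have h1 : ∀ i : Fin n, ∑ j, ∑ k, B k i * B k j * H j i = ∑ k, ∑ j, B k i * B k j * H j i :=
    fun i => Finset.sum_comm
  simp only [h1]
  rw [Finset.sum_comm]
  refine Finset.sum_congr rfl fun k _ => ?_
  rw [Finset.sum_comm]
  refine Finset.sum_congr rfl fun i _ => Finset.sum_congr rfl fun j _ => by ring

theorem trMul_nonneg {A H : Matrix (Fin n) (Fin n) ℝ} (hs : A.IsSymm)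
    (h : ∀ p : Eu n, 0 ≤ mquad A p) (hH : ∀ p : Eu n, 0 ≤ mquad H p) : 0 ≤ trMul A H := by
  obtain ⟨B, rfl⟩ := exists_root hs h
  rw [trMul_root]
  exact Finset.sum_nonneg fun k _ => hH _

theorem trMul_comm (A H : Matrix (Fin n) (Fin n) ℝ) : trMul A H = trMul H A := by
  rw [trMul_eq_trace, trMul_eq_trace, Matrix.trace_mul_comm]

theorem mquad_sub (A H : Matrix (Fin n) (Fin n) ℝ) (p : Eu n) :
    mquad (A - H) p = mquad A p - mquad H p := by
  simp [mquad, sub_mul]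

theorem mquad_add (A H : Matrix (Fin n) (Fin n) ℝ) (p : Eu n) :
    mquad (A + H) p = mquad A p + mquad H p := by
  simp [mquad, add_mul, Finset.sum_add_distrib]

theorem mquad_smul (c : ℝ) (A : Matrix (Fin n) (Fin n) ℝ) (p : Eu n) :
    mquad (c • A) p = c * mquad A p := by
  simp [mquad, Finset.mul_sum, mul_assoc]

theorem mquad_one (p : Eu n) : mquad (1 : Matrix (Fin n) (Fin n) ℝ) p = ‖p‖ ^ 2 := by
  rw [EuclideanSpace.norm_sq_eq]
  simp [mquad, Matrix.one_apply, sq]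

theorem mquad_smul_vec (A : Matrix (Fin n) (Fin n) ℝ) (c : ℝ) (p : Eu n) :
    mquad A (c • p) = c ^ 2 * mquad A p := by
  simp only [mquad, Finset.mul_sum, PiLp.smul_apply, smul_eq_mul]
  refine Finset.sum_congr rfl fun i _ => Finset.sum_congr rfl fun j _ => by ring

theorem trMul_add (A H G : Matrix (Fin n) (Fin n) ℝ) : trMul A (H + G) = trMul A H + trMul A G := by
  simp [trMul_eq_trace, Matrix.mul_add]

theorem trMul_smul (c : ℝ) (A H : Matrix (Fin n) (Fin n) ℝ) : trMul A (c • H) = c * trMul A H := by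
  simp [trMul_eq_trace]

theorem trMul_sub (A H G : Matrix (Fin n) (Fin n) ℝ) : trMul A (H - G) = trMul A H - trMul A G := by
  simp [trMul_eq_trace, Matrix.mul_sub]

/-- monotonicity of the trace in the second argument -/
theorem trMul_mono {θ : ℝ} (hθ : 0 < θ) {A X Y : Matrix (Fin n) (Fin n) ℝ} (hA : memS θ A)
    (h : ∀ p : Eu n, mquad X p ≤ mquad Y p) : trMul A X ≤ trMul A Y := by
  have := trMul_nonneg (A := A) (H := Y - X) hA.1
    (fun p => le_trans (by positivity) (hA.2 p).1)
    (fun p => by rw [mquad_sub]; linarith [h p])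
  rw [trMul_sub] at this
  linarith

theorem trMul_one_le {θ : ℝ} {A : Matrix (Fin n) (Fin n) ℝ} (hA : memS θ A) :
    trMul A 1 ≤ n * θ⁻¹ := by
  have h1 : trMul A 1 = ∑ i, A i i := by simp [trMul_eq_trace, Matrix.trace]
  rw [h1]
  have : ∀ i, A i i ≤ θ⁻¹ := by
    intro i
    have := (hA.2 (EuclideanSpace.single i 1)).2
    simpa [mquad, PiLp.single_apply] using this
  calc ∑ i, A i i ≤ ∑ _i : Fin n, θ⁻¹ := Finset.sum_le_sum fun i _ => this i
    _ = n * θ⁻¹ := by simp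

/-- AM-GM for the determinant of a product of positive matrices -/
theorem det_mul_le {A Z : Matrix (Fin n) (Fin n) ℝ} (hn : 0 < n) (hA : A.IsSymm)
    (hA' : ∀ p : Eu n, 0 ≤ mquad A p) (hZ : Z.IsSymm) (hZ' : ∀ p : Eu n, 0 ≤ mquad Z p) :
    0 ≤ (A * Z).det ∧ (A * Z).det ≤ (trMul A Z / n) ^ n := by
  obtain ⟨B, rfl⟩ := exists_root hA hA'
  have hP : (B * Z * B.transpose).PosSemidef := by
    have := (posSemidef_of_mquad hZ hZ').mul_mul_conjTranspose_same B
    rwa [Matrix.conjTranspose_eq_transpose_of_trivial] at this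
  have h1 : (B.transpose * B * Z).det = (B * Z * B.transpose).det := by
    simp only [Matrix.det_mul]; ring
  have h2 : trMul (B.transpose * B) Z = (B * Z * B.transpose).trace := by
    rw [trMul_eq_trace, Matrix.mul_assoc, Matrix.trace_mul_comm]
  rw [h1, h2]
  refine ⟨hP.det_nonneg, ?_⟩
  have hH := hP.isHermitian
  rw [hH.det_eq_prod_eigenvalues, hH.trace_eq_sum_eigenvalues]
  have he : ∀ i, 0 ≤ hH.eigenvalues i := hP.eigenvalues_nonneg
  have := Real.geom_mean_le_arith_mean Finset.univ (fun _ : Fin n => (1:ℝ)) hH.eigenvalues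
    (by simp) (by simpa using hn) (fun i _ => he i)
  simp only [Real.rpow_one, Finset.sum_const, Finset.card_univ, Fintype.card_fin, nsmul_eq_mul,
    mul_one, one_mul] at this
  have hprod : 0 ≤ ∏ i, hH.eigenvalues i := Finset.prod_nonneg fun i _ => he i
  have h3 := pow_le_pow_left₀ (by positivity) this n
  rw [Real.rpow_inv_natCast_pow hprod hn.ne'] at h3
  simpa using h3

/-! ### Calculus -/

theorem gradient_apply' (φ : Eu n → ℝ) (x : Eu n) (i : Fin n) :
    gradient φ x i = fderiv ℝ φ x (EuclideanSpace.single i 1) := by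
  have h : inner ℝ (gradient φ x) (EuclideanSpace.single i (1:ℝ)) =
      fderiv ℝ φ x (EuclideanSpace.single i 1) := inner_gradient_left
  rw [← h, EuclideanSpace.inner_single_right]; simp

theorem dotp_gradient (φ : Eu n → ℝ) (x q : Eu n) : dotp q (gradient φ x) = fderiv ℝ φ x q := by
  rw [dotp_eq_inner, real_inner_comm, inner_gradient_left]

theorem hess_apply {φ : Eu n → ℝ} {x : Eu n} (h : ContDiffAt ℝ 2 φ x) (i j : Fin n) :
    hessS φ x i j = fderiv ℝ (fderiv ℝ φ) x (EuclideanSpace.single j 1)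
      (EuclideanSpace.single i 1) := by
  unfold hessS
  simp only [gradient_apply']
  have hd : DifferentiableAt ℝ (fderiv ℝ φ) x :=
    (h.fderiv_right (m := 1) (by norm_num)).differentiableAt (by norm_num)
  rw [fderiv_clm_apply hd (by fun_prop)]
  simp

theorem sum_single (p : Eu n) : p = ∑ i, p i • EuclideanSpace.single i (1:ℝ) := by
  ext j; simp [PiLp.single_apply, Pi.single_apply]

theorem mquad_hess {φ : Eu n → ℝ} {x : Eu n} (h : ContDiffAt ℝ 2 φ x) (p : Eu n) :
    mquad (hessS φ x) p = fderiv ℝ (fderiv ℝ φ) x p p := by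
  conv_rhs => rw [sum_single p]
  simp only [map_sum, ContinuousLinearMap.sum_apply, map_smul, ContinuousLinearMap.smul_apply,
    smul_eq_mul, mquad, hess_apply h, Finset.mul_sum]
  refine Finset.sum_congr rfl fun i _ => Finset.sum_congr rfl fun j _ => by ring

theorem hess_symm {φ : Eu n → ℝ} {x : Eu n} (h : ContDiffAt ℝ 2 φ x) : (hessS φ x).IsSymm := by
  ext i j
  rw [Matrix.transpose_apply, hess_apply h, hess_apply h]
  exact (h.isSymmSndFDerivAt (by simp)).eq _ _

/-- derivative of the matrix of second derivatives, as a derivative of the gradient -/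
theorem hasFDerivAt_gradient_apply {φ : Eu n → ℝ} {x : Eu n} (h : ContDiffAt ℝ 2 φ x) (i : Fin n)
    (p : Eu n) :
    fderiv ℝ (fun y => gradient φ y i) x p = ∑ j, hessS φ x i j * p j := by
  conv_lhs => rw [sum_single p]
  simp [hessS, mul_comm]

theorem second_deriv_line {φ : Eu n → ℝ} {x : Eu n} (h : ContDiffAt ℝ 2 φ x) (p : Eu n) :
    (∀ᶠ τ in 𝓝 (0:ℝ), HasDerivAt (fun τ : ℝ => φ (x + τ • p)) (fderiv ℝ φ (x + τ • p) p) τ) ∧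
    HasDerivAt (fun τ : ℝ => fderiv ℝ φ (x + τ • p) p) (mquad (hessS φ x) p) 0 := by
  have hl : ∀ τ : ℝ, HasDerivAt (fun τ : ℝ => x + τ • p) p τ := by
    intro τ
    simpa using ((hasDerivAt_id τ).smul_const p).const_add x
  have hc : Tendsto (fun τ : ℝ => x + τ • p) (𝓝 0) (𝓝 x) := by
    have := (hl 0).continuousAt.tendsto
    simpa using this
  constructor
  · have h1 : ∀ᶠ y in 𝓝 x, DifferentiableAt ℝ φ y := by
      have := h.eventually (by simp)
      filter_upwards [this] with y hy using hy.differentiableAt (by norm_num)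
    filter_upwards [hc.eventually h1] with τ hτ
    exact hτ.hasFDerivAt.comp_hasDerivAt τ (hl τ)
  · have hd : DifferentiableAt ℝ (fderiv ℝ φ) (x + (0:ℝ) • p) := by
      simpa using (h.fderiv_right (m := 1) (by norm_num)).differentiableAt (by norm_num)
    have h2 := (hd.hasFDerivAt.comp_hasDerivAt (0:ℝ) (hl 0))
    have h3 := h2.clm_apply (hasDerivAt_const (0:ℝ) p)
    rw [mquad_hess h]
    simpa using h3

theorem hess_nonpos_of_max {φ : Eu n → ℝ} {x : Eu n} (h : ContDiffAt ℝ 2 φ x)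
    (hm : IsLocalMax φ x) (p : Eu n) : mquad (hessS φ x) p ≤ 0 := by
  by_contra hcon
  push Not at hcon
  obtain ⟨h1, h2⟩ := second_deriv_line h p
  set g := fun τ : ℝ => φ (x + τ • p) with hg
  have hc : Tendsto (fun τ : ℝ => x + τ • p) (𝓝 0) (𝓝 x) := by
    have : Continuous (fun τ : ℝ => x + τ • p) := by fun_prop
    simpa using this.tendsto 0
  have hgmax : IsLocalMax g 0 := by
    have := hc.eventually hm
    filter_upwards [this] with τ hτ
    simpa [hg] using hτ
  have hder : deriv g =ᶠ[𝓝 0] fun τ => fderiv ℝ φ (x + τ • p) p := by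
    filter_upwards [h1] with τ hτ using hτ.deriv
  have hdd : deriv (deriv g) 0 = mquad (hessS φ x) p := by
    rw [hder.deriv_eq]; exact h2.deriv
  have hmin : IsLocalMin g 0 := isLocalMin_of_deriv_deriv_pos (by rw [hdd]; exact hcon)
    hgmax.deriv_eq_zero (h1.self_of_nhds.continuousAt)
  have hconst : g =ᶠ[𝓝 0] fun _ => g 0 := by
    filter_upwards [hgmax, hmin] with τ a b using le_antisymm a b
  have : deriv g =ᶠ[𝓝 0] fun _ => 0 := by
    have := hconst.deriv
    simpa using this
  have : deriv (deriv g) 0 = 0 := by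
    rw [this.deriv_eq]; simp
  linarith

theorem gradient_sub' {φ ψ : Eu n → ℝ} {x : Eu n} (hφ : DifferentiableAt ℝ φ x)
    (hψ : DifferentiableAt ℝ ψ x) (q : Eu n) :
    dotp q (gradient (fun y => φ y - ψ y) x) = dotp q (gradient φ x) - dotp q (gradient ψ x) := by
  simp only [dotp_gradient]
  rw [fderiv_fun_sub hφ hψ]; simp

/-- entries of the Hessian are determined by the second derivative -/
theorem hess_congr {φ : Eu n → ℝ} {x : Eu n} (h : ContDiffAt ℝ 2 φ x)
    {X : Matrix (Fin n) (Fin n) ℝ} (hX : ∀ p q : Eu n,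
      fderiv ℝ (fderiv ℝ φ) x q p = ∑ i, ∑ j, X i j * p i * q j) : hessS φ x = X := by
  ext i j
  rw [hess_apply h, hX]
  simp [PiLp.single_apply]

theorem evd {φ : Eu n → ℝ} {x : Eu n} (h : ContDiffAt ℝ 2 φ x) :
    ∀ᶠ y in 𝓝 x, DifferentiableAt ℝ φ y := by
  filter_upwards [h.eventually (by simp)] with y hy using hy.differentiableAt (by norm_num)

theorem dfd {φ : Eu n → ℝ} {x : Eu n} (h : ContDiffAt ℝ 2 φ x) :
    DifferentiableAt ℝ (fderiv ℝ φ) x :=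
  (h.fderiv_right (m := 1) (by norm_num)).differentiableAt (by norm_num)

theorem hess_add {φ ψ : Eu n → ℝ} {x : Eu n} (hφ : ContDiffAt ℝ 2 φ x)
    (hψ : ContDiffAt ℝ 2 ψ x) :
    hessS (fun y => φ y + ψ y) x = hessS φ x + hessS ψ x := by
  ext i j
  rw [hess_apply (hφ.add hψ), Matrix.add_apply, hess_apply hφ, hess_apply hψ]
  have : fderiv ℝ (fun y => φ y + ψ y) =ᶠ[𝓝 x] fun y => fderiv ℝ φ y + fderiv ℝ ψ y := by
    filter_upwards [evd hφ, evd hψ] with y h1 h2 using fderiv_fun_add h1 h2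
  rw [this.fderiv_eq, fderiv_fun_add (dfd hφ) (dfd hψ)]
  simp

theorem hess_const_mul {φ : Eu n → ℝ} {x : Eu n} (c : ℝ) (hφ : ContDiffAt ℝ 2 φ x) :
    hessS (fun y => c * φ y) x = c • hessS φ x := by
  ext i j
  rw [hess_apply (contDiffAt_const.mul hφ), Matrix.smul_apply, hess_apply hφ]
  have : fderiv ℝ (fun y => c * φ y) =ᶠ[𝓝 x] fun y => c • fderiv ℝ φ y := by
    filter_upwards [evd hφ] with y h1 using fderiv_const_mul h1 c
  rw [this.fderiv_eq, fderiv_fun_const_smul (dfd hφ)]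
  simp

theorem hess_const (c : ℝ) (x : Eu n) : hessS (fun _ : Eu n => c) x = 0 := by
  ext i j
  rw [hess_apply contDiffAt_const]
  have : fderiv ℝ (fun _ : Eu n => c) = fun _ => 0 := by ext; simp
  rw [this]; simp

theorem hess_comp {E E' : ℝ → ℝ} {E'' : ℝ} {g : Eu n → ℝ} {x : Eu n} (hg : ContDiffAt ℝ 2 g x)
    (hE : ContDiffAt ℝ 2 E (g x)) (h1 : ∀ᶠ s in 𝓝 (g x), HasDerivAt E (E' s) s)
    (h2 : HasDerivAt E' E'' (g x)) :
    hessS (fun y => E (g y)) x = (Matrix.of fun i j => E'' * (gradient g x i * gradient g x j)) +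
      E' (g x) • hessS g x := by
  ext i j
  have hc : ContDiffAt ℝ 2 (fun y => E (g y)) x := hE.comp x hg
  rw [hess_apply hc, Matrix.add_apply, Matrix.smul_apply, hess_apply hg, Matrix.of_apply]
  have : fderiv ℝ (fun y => E (g y)) =ᶠ[𝓝 x] fun y => E' (g y) • fderiv ℝ g y := by
    filter_upwards [evd hg, hg.continuousAt.eventually h1] with y a b
    have := (b.comp_hasFDerivAt y a.hasFDerivAt).fderiv
    simpa [Function.comp_def] using this
  have hgd : DifferentiableAt ℝ g x := (evd hg).self_of_nhds
  have h3 : HasFDerivAt (fun y => E' (g y)) (E'' • fderiv ℝ g x) x :=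
    h2.comp_hasFDerivAt x hgd.hasFDerivAt
  have h4 := (h3.fun_smul (dfd hg).hasFDerivAt).fderiv
  rw [this.fderiv_eq, h4]
  simp [gradient_apply']
  ring

/-- the second order operator -/
def Lop (ε : ℝ) (A : Matrix (Fin n) (Fin n) ℝ) (q : Eu n) (φ : Eu n → ℝ) (x : Eu n) : ℝ :=
  ε * trMul A (hessS φ x) + dotp q (gradient φ x)

theorem Lop_add {ε : ℝ} {A : Matrix (Fin n) (Fin n) ℝ} {q : Eu n} {φ ψ : Eu n → ℝ} {x : Eu n}
    (hφ : ContDiffAt ℝ 2 φ x) (hψ : ContDiffAt ℝ 2 ψ x) :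
    Lop ε A q (fun y => φ y + ψ y) x = Lop ε A q φ x + Lop ε A q ψ x := by
  unfold Lop
  rw [hess_add hφ hψ, trMul_add]
  simp only [dotp_gradient]
  rw [fderiv_fun_add (evd hφ).self_of_nhds (evd hψ).self_of_nhds]
  simp; ring

theorem Lop_const_mul {ε : ℝ} {A : Matrix (Fin n) (Fin n) ℝ} {q : Eu n} {φ : Eu n → ℝ}
    {x : Eu n} (c : ℝ) (hφ : ContDiffAt ℝ 2 φ x) :
    Lop ε A q (fun y => c * φ y) x = c * Lop ε A q φ x := by
  unfold Lop
  rw [hess_const_mul c hφ, trMul_smul]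
  simp only [dotp_gradient]
  rw [fderiv_const_mul (evd hφ).self_of_nhds]
  simp; ring

theorem Lop_const {ε : ℝ} {A : Matrix (Fin n) (Fin n) ℝ} {q : Eu n} {x : Eu n} (c : ℝ) :
    Lop ε A q (fun _ => c) x = 0 := by
  unfold Lop
  rw [hess_const]
  simp only [dotp_gradient]
  simp [trMul]

theorem trMul_rank1 (A : Matrix (Fin n) (Fin n) ℝ) (c : ℝ) (p : Eu n) :
    trMul A (Matrix.of fun i j => c * (p i * p j)) = c * mquad A p := by
  simp only [trMul, mquad, Finset.mul_sum, Matrix.of_apply]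
  refine Finset.sum_congr rfl fun i _ => Finset.sum_congr rfl fun j _ => by ring

theorem Lop_comp {ε : ℝ} {A : Matrix (Fin n) (Fin n) ℝ} {q : Eu n}
    {E E' : ℝ → ℝ} {E'' : ℝ} {g : Eu n → ℝ} {x : Eu n} (hg : ContDiffAt ℝ 2 g x)
    (hE : ContDiffAt ℝ 2 E (g x)) (h1 : ∀ᶠ s in 𝓝 (g x), HasDerivAt E (E' s) s)
    (h2 : HasDerivAt E' E'' (g x)) :
    Lop ε A q (fun y => E (g y)) x = E' (g x) * Lop ε A q g x + ε * E'' * mquad A (gradient g x) := by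
  unfold Lop
  rw [hess_comp hg hE h1 h2, trMul_add, trMul_smul, trMul_rank1]
  have hgd : DifferentiableAt ℝ g x := (evd hg).self_of_nhds
  simp only [dotp_gradient]
  have := (h1.self_of_nhds.comp_hasFDerivAt x hgd.hasFDerivAt).fderiv
  simp only [Function.comp_def] at this
  rw [this]
  simp; ring

theorem contDiff_sqd (p : Eu n) : ContDiff ℝ 2 (fun y : Eu n => ‖y - p‖ ^ 2) :=
  (contDiff_id.sub contDiff_const).norm_sq ℝ

theorem fderiv_sqd (p x q : Eu n) : fderiv ℝ (fun y : Eu n => ‖y - p‖ ^ 2) x q = 2 * dotp q (x - p) := by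
  have := ((hasFDerivAt_id x).sub_const p).norm_sq
  simp only [id] at this
  rw [this.fderiv, dotp_eq_inner, real_inner_comm]
  simp [inner_sub_left]

theorem gradient_sqd (p x : Eu n) : gradient (fun y : Eu n => ‖y - p‖ ^ 2) x = (2:ℝ) • (x - p) := by
  ext i
  rw [gradient_apply', fderiv_sqd]
  simp [dotp, PiLp.single_apply]

theorem hess_sqd (p x : Eu n) : hessS (fun y : Eu n => ‖y - p‖ ^ 2) x = (2:ℝ) • 1 := by
  ext i j
  unfold hessS
  simp only [gradient_sqd]
  have h : HasFDerivAt (fun y : Eu n => ((2:ℝ) • (y - p)) i)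
      ((2:ℝ) • (EuclideanSpace.proj i : Eu n →L[ℝ] ℝ)) x := by
    have h0 : HasFDerivAt (fun y : Eu n => (EuclideanSpace.proj i : Eu n →L[ℝ] ℝ) y - p i)
      (EuclideanSpace.proj i : Eu n →L[ℝ] ℝ) x :=
      ((EuclideanSpace.proj i : Eu n →L[ℝ] ℝ).hasFDerivAt (x := x)).sub_const (p i)
    have h1 := h0.const_mul 2
    have he : (fun y : Eu n => ((2:ℝ) • (y - p)) i) =
        fun y : Eu n => 2 * ((EuclideanSpace.proj i : Eu n →L[ℝ] ℝ) y - p i) := by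
      ext y; simp
    rw [he]; exact h1
  rw [h.fderiv]
  simp [PiLp.single_apply, Matrix.one_apply]

theorem Lop_sqd {ε : ℝ} {A : Matrix (Fin n) (Fin n) ℝ} {q : Eu n} (p x : Eu n) :
    Lop ε A q (fun y : Eu n => ‖y - p‖ ^ 2) x = 2 * ε * trMul A 1 + 2 * dotp q (x - p) := by
  unfold Lop
  rw [hess_sqd, trMul_smul, dotp_gradient, fderiv_sqd]; ring

theorem hess_sub {φ ψ : Eu n → ℝ} {x : Eu n} (hφ : ContDiffAt ℝ 2 φ x)
    (hψ : ContDiffAt ℝ 2 ψ x) :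
    hessS (fun y => φ y - ψ y) x = hessS φ x - hessS ψ x := by
  have h1 := hess_add hφ (contDiffAt_const (c := (-1:ℝ)).mul hψ)
  have h2 := hess_const_mul (-1) hψ
  have : (fun y => φ y - ψ y) = fun y => φ y + (-1) * ψ y := by ext; ring
  rw [this, h1, h2]; simp [sub_eq_add_neg]

/-- touching from above by a `C²` function -/
theorem Lop_touch {θ ε : ℝ} (hθ : 0 < θ) (hε : 0 < ε) {A : Matrix (Fin n) (Fin n) ℝ} (hA : memS θ A)
    {q : Eu n} {φ ψ : Eu n → ℝ} {x : Eu n} (hφ : ContDiffAt ℝ 2 φ x) (hψ : ContDiffAt ℝ 2 ψ x)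
    (hm : IsLocalMax (fun y => φ y - ψ y) x) : Lop ε A q φ x ≤ Lop ε A q ψ x := by
  have h0 : fderiv ℝ (fun y => φ y - ψ y) x = 0 := hm.fderiv_eq_zero
  rw [fderiv_fun_sub (evd hφ).self_of_nhds (evd hψ).self_of_nhds] at h0
  have h1 : fderiv ℝ φ x = fderiv ℝ ψ x := sub_eq_zero.mp h0
  have h2 : ∀ p, mquad (hessS φ x) p ≤ mquad (hessS ψ x) p := by
    intro p
    have := hess_nonpos_of_max (hφ.sub hψ) hm p
    rw [hess_sub hφ hψ, mquad_sub] at this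
    linarith
  have h3 := trMul_mono hθ hA h2
  unfold Lop
  simp only [dotp_gradient, h1]
  have := mul_le_mul_of_nonneg_left h3 hε.le
  linarith

end Part1

section Part2

/-! ### Linear solutions and comparison -/

structure LS (Ω : Set (Eu n)) (b : Eu n → Eu n) (θ ε C : ℝ)
    (A : Eu n → ℝ → Matrix (Fin n) (Fin n) ℝ) (u : Eu n → ℝ → ℝ) : Prop where
  cont : ContinuousOn (fun p : Eu n × ℝ => u p.1 p.2) (Ω ×ˢ Ioi 0)
  c2 : ∀ x ∈ Ω, ∀ t > (0:ℝ), ContDiffAt ℝ 2 (fun y => u y t) x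
  dt : ∀ x ∈ Ω, ∀ t > (0:ℝ), HasDerivAt (u x) (tD u x t) t
  tcont : ContinuousOn (fun p : Eu n × ℝ => tD u p.1 p.2) (Ω ×ˢ Ioi 0)
  eq : ∀ x ∈ Ω, ∀ t > (0:ℝ), tD u x t = Lop ε (A x t) (b x) (fun y => u y t) x
  mem : ∀ x ∈ Ω, ∀ t > (0:ℝ), memS θ (A x t)
  bd : ∀ x ∈ Ω, ∀ t > (0:ℝ), |u x t| ≤ C

theorem LS.neg {Ω : Set (Eu n)} {b : Eu n → Eu n} {θ ε C : ℝ}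
    {A : Eu n → ℝ → Matrix (Fin n) (Fin n) ℝ} {u : Eu n → ℝ → ℝ} (h : LS Ω b θ ε C A u) :
    LS Ω b θ ε C A (fun x t => - u x t) := by
  have htd : ∀ x t, tD (fun x t => - u x t) x t = - tD u x t := by
    intro x t; simp [tD, deriv.fun_neg]
  refine ⟨h.cont.neg, fun x hx t ht => (h.c2 x hx t ht).neg, fun x hx t ht => ?_, ?_, ?_, h.mem, ?_⟩
  · rw [htd]; exact (h.dt x hx t ht).neg
  · simp only [htd]; exact h.tcont.neg
  · intro x hx t ht
    rw [htd, h.eq x hx t ht]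
    have := Lop_const_mul (ε := ε) (A := A x t) (q := b x) (-1) (h.c2 x hx t ht)
    simp only [neg_mul, one_mul] at this
    rw [this]
  · intro x hx t ht; rw [abs_neg]; exact h.bd x hx t ht

theorem deriv_nonpos_of_left {g : ℝ → ℝ} {g' t t0 : ℝ} (ht : t0 < t) (h : HasDerivAt g g' t)
    (hp : ∀ s ∈ Ico t0 t, 0 ≤ g s) (h0 : g t = 0) : g' ≤ 0 := by
  have h1 : Tendsto (slope g t) (𝓝[<] t) (𝓝 g') :=
    (hasDerivWithinAt_iff_tendsto_slope' (by simp)).1 h.hasDerivWithinAt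
  refine le_of_tendsto h1 ?_
  filter_upwards [Ico_mem_nhdsLT ht] with s hs
  rw [slope_def_field, h0]
  exact div_nonpos_of_nonneg_of_nonpos (by linarith [hp s hs]) (by linarith [hs.2])

theorem CMP {Ω : Set (Eu n)} {b : Eu n → Eu n} {θ ε C : ℝ}
    {A : Eu n → ℝ → Matrix (Fin n) (Fin n) ℝ} {u : Eu n → ℝ → ℝ} (h : LS Ω b θ ε C A u)
    (hθ : 0 < θ) (hε : 0 < ε) {K U : Set (Eu n)} (hK : IsCompact K) (hKΩ : K ⊆ Ω) (hU : IsOpen U)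
    (hUK : U ⊆ K) {t0 t1 : ℝ} (ht0 : 0 < t0) (Φ : Eu n → ℝ → ℝ)
    (hΦ : ContinuousOn (fun p : Eu n × ℝ => Φ p.1 p.2) (K ×ˢ Icc t0 t1))
    (hin : ∀ x ∈ U, ∀ t ∈ Ioc t0 t1, u x t < Φ x t ∨
      (ContDiffAt ℝ 2 (fun y => Φ y t) x ∧ ∃ Φt, HasDerivAt (Φ x) Φt t ∧
        Lop ε (A x t) (b x) (fun y => Φ y t) x < Φt))
    (h0 : ∀ x ∈ K, u x t0 < Φ x t0)
    (hlat : ∀ x ∈ K \ U, ∀ t ∈ Icc t0 t1, u x t < Φ x t) :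
    ∀ x ∈ K, ∀ t ∈ Icc t0 t1, u x t < Φ x t := by
  by_contra hcon
  push Not at hcon
  obtain ⟨x0, hx0, s0, hs0, hle⟩ := hcon
  have hsub : K ×ˢ Icc t0 t1 ⊆ Ω ×ˢ Ioi 0 :=
    prod_mono hKΩ (fun t ht => lt_of_lt_of_le ht0 ht.1)
  have hcu := h.cont.mono hsub
  have hcomp : IsCompact (K ×ˢ Icc t0 t1) := hK.prod isCompact_Icc
  have hdc : ContinuousOn (fun p : Eu n × ℝ => u p.1 p.2 - Φ p.1 p.2) (K ×ˢ Icc t0 t1) := hcu.sub hΦ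
  set Z := (K ×ˢ Icc t0 t1) ∩ (fun p : Eu n × ℝ => u p.1 p.2 - Φ p.1 p.2) ⁻¹' Ici 0 with hZ
  have hZc : IsCompact Z :=
    hcomp.of_isClosed_subset (hdc.preimage_isClosed_of_isClosed hcomp.isClosed isClosed_Ici)
      inter_subset_left
  have hZn : Z.Nonempty := ⟨(x0, s0), ⟨hx0, hs0⟩, by simpa using hle⟩
  obtain ⟨⟨x, t⟩, hpZ, hmin⟩ := hZc.exists_isMinOn hZn continuous_snd.continuousOn
  obtain ⟨⟨hxK, htI⟩, hge⟩ := hpZ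
  simp only [mem_preimage, mem_Ici, sub_nonneg] at hxK htI hge
  have hxK : x ∈ K := hxK
  have htI : t ∈ Icc t0 t1 := htI
  have hxΩ := hKΩ hxK
  have htp : 0 < t := lt_of_lt_of_le ht0 htI.1
  have htt : t0 < t := by
    rcases lt_or_eq_of_le htI.1 with h' | h'
    · exact h'
    · subst h'; exact absurd (h0 x hxK) (not_lt.2 hge)
  have hxU : x ∈ U := by
    by_contra hx
    exact absurd (hlat x ⟨hxK, hx⟩ t htI) (not_lt.2 hge)
  have hbefore : ∀ y ∈ K, ∀ s ∈ Ico t0 t, u y s < Φ y s := by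
    intro y hy s hs
    by_contra hc
    have : ((y, s) : Eu n × ℝ) ∈ Z :=
      ⟨⟨hy, hs.1, hs.2.le.trans htI.2⟩, by simpa using not_lt.1 hc⟩
    have := hmin this
    simp only [mem_setOf_eq] at this
    linarith [hs.2]
  have hat : ∀ y ∈ K, u y t ≤ Φ y t := by
    intro y hy
    have hcy : ContinuousOn (fun s => u y s - Φ y s) (Icc t0 t1) :=
      hdc.comp (f := fun s : ℝ => ((y, s) : Eu n × ℝ)) (by fun_prop) (fun s hs => ⟨hy, hs⟩)
    have h1 : Tendsto (fun s => u y s - Φ y s) (𝓝[Ico t0 t] t) (𝓝 (u y t - Φ y t)) :=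
      (hcy t htI).mono_left (nhdsWithin_mono _ (fun s hs => ⟨hs.1, hs.2.le.trans htI.2⟩))
    have : (𝓝[Ico t0 t] t).NeBot := by
      rw [nhdsWithin_Ico_eq_nhdsLT htt]; infer_instance
    have := le_of_tendsto h1 (by
      filter_upwards [self_mem_nhdsWithin] with s hs
      exact (sub_neg.2 (hbefore y hy s hs)).le)
    linarith
  rcases hin x hxU t ⟨htt, htI.2⟩ with h' | ⟨hc2, Φt, hder, hlt⟩
  · linarith
  have heq : u x t = Φ x t := le_antisymm (hat x hxK) hge
  have hm : IsLocalMax (fun y => u y t - Φ y t) x := by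
    filter_upwards [hU.mem_nhds hxU] with y hy
    have := hat y (hUK hy)
    linarith
  have hL := Lop_touch hθ hε (h.mem x hxΩ t htp) (q := b x) (h.c2 x hxΩ t htp) hc2 hm
  have hd : HasDerivAt (fun s => Φ x s - u x s) (Φt - tD u x t) t := hder.sub (h.dt x hxΩ t htp)
  have := deriv_nonpos_of_left htt hd
    (fun s hs => by have := hbefore x hxK s hs; linarith) (by simp [heq])
  rw [h.eq x hxΩ t htp] at this
  linarith

end Part2

section Part3

/-! ### Ball level barriers -/

theorem Lop_exp {ε : ℝ} {A : Matrix (Fin n) (Fin n) ℝ} {q : Eu n} {g : Eu n → ℝ} {x : Eu n}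
    (c k w : ℝ) (hg : ContDiffAt ℝ 2 g x) :
    ContDiffAt ℝ 2 (fun y => c * Real.exp (k * (g y - w))) x ∧
    Lop ε A q (fun y => c * Real.exp (k * (g y - w))) x =
      c * Real.exp (k * (g x - w)) * (k * Lop ε A q g x + ε * k ^ 2 * mquad A (gradient g x)) := by
  have hE : ContDiff ℝ 2 (fun s : ℝ => c * Real.exp (k * (s - w))) := by fun_prop
  have hd : ∀ s : ℝ, HasDerivAt (fun s : ℝ => Real.exp (k * (s - w)))
      (Real.exp (k * (s - w)) * k) s := by
    intro s
    have h1 : HasDerivAt (fun s : ℝ => k * (s - w)) k s := by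
      simpa using ((hasDerivAt_id s).sub_const w).const_mul k
    exact h1.exp
  have h1 : ∀ s : ℝ, HasDerivAt (fun s : ℝ => c * Real.exp (k * (s - w)))
      (c * (Real.exp (k * (s - w)) * k)) s := fun s => (hd s).const_mul c
  have h2 : ∀ s : ℝ, HasDerivAt (fun s : ℝ => c * (Real.exp (k * (s - w)) * k))
      (c * (Real.exp (k * (s - w)) * k * k)) s := fun s => ((hd s).mul_const k).const_mul c
  refine ⟨hE.contDiffAt.comp x hg, ?_⟩
  have := Lop_comp (ε := ε) (A := A) (q := q) hg hE.contDiffAt (Eventually.of_forall h1) (h2 (g x))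
  rw [this]; ring

structure BD (Ω : Set (Eu n)) (b : Eu n → Eu n) (θ ε C r b₀ Lb : ℝ) : Prop where
  hθ : 0 < θ
  hε : 0 < ε
  hC : 0 < C
  hr : 0 < r
  hb₀ : 0 < b₀
  hLb : 0 ≤ Lb
  sub : closedBall (0 : Eu n) r ⊆ Ω
  coer : ∀ x ∈ closedBall (0 : Eu n) r, dotp (b x) x ≤ -b₀ * ‖x‖ ^ 2
  lip : ∀ x, ‖b x‖ ≤ Lb * ‖x‖

def zeta (κ C r ε : ℝ) (x : Eu n) : ℝ := 4 * C * Real.exp (κ / ε * (‖x - 0‖ ^ 2 - r ^ 2))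

def Reps (Λ κ b₀ C r ε : ℝ) : ℝ :=
  8 * C * κ * Λ * Real.exp (2 * κ * Λ / b₀) * Real.exp (-(κ * r ^ 2 / ε))

variable {Ω : Set (Eu n)} {b : Eu n → Eu n} {θ ε C r b₀ Lb : ℝ}

theorem zeta_pos (κ : ℝ) (hC : 0 < C) (x : Eu n) : 0 < zeta κ C r ε x := by
  unfold zeta; positivity

theorem zeta_cont (κ : ℝ) : Continuous (zeta (n := n) κ C r ε) := by
  unfold zeta; fun_prop

theorem zeta_bdry (κ : ℝ) {x : Eu n} (hx : ‖x‖ = r) : zeta κ C r ε x = 4 * C := by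
  simp [zeta, hx]

theorem zeta_Lop (h : BD Ω b θ ε C r b₀ Lb) {A : Matrix (Fin n) (Fin n) ℝ} (hA : memS θ A)
    {x : Eu n} (hx : x ∈ closedBall (0 : Eu n) r) :
    ContDiffAt ℝ 2 (zeta (b₀ * θ / 4) C r ε) x ∧
    Lop ε A (b x) (zeta (b₀ * θ / 4) C r ε) x ≤ Reps (n * θ⁻¹) (b₀ * θ / 4) b₀ C r ε := by
  obtain ⟨hθ, hε, hC, hr, hb, -, -, hco, -⟩ := h
  set κ := b₀ * θ / 4 with hκ
  have hκp : 0 < κ := by positivity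
  set Λ := (n : ℝ) * θ⁻¹ with hΛ
  have hΛp : 0 ≤ Λ := by positivity
  obtain ⟨h1, h2⟩ := Lop_exp (ε := ε) (A := A) (q := b x) (4 * C) (κ / ε) (r ^ 2)
    (contDiff_sqd (0 : Eu n)).contDiffAt (x := x)
  refine ⟨h1, ?_⟩
  change Lop ε A (b x) (fun y : Eu n => 4 * C * Real.exp (κ / ε * (‖y - 0‖ ^ 2 - r ^ 2))) x ≤ _
  rw [h2, Lop_sqd, gradient_sqd, mquad_smul_vec, sub_zero]
  set y := ‖x‖ ^ 2 with hy
  have hyp : 0 ≤ y := by positivity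
  have hb1 := hco x hx
  have hA2 := (hA.2 x).2
  have htr := trMul_one_le hA
  have key : κ / ε * (2 * ε * trMul A 1 + 2 * dotp (b x) x) + ε * (κ / ε) ^ 2 * (2 ^ 2 * mquad A x)
      ≤ κ / ε * (2 * ε * Λ - b₀ * y) := by
    have e1 : ε * (κ / ε) ^ 2 * (2 ^ 2 * mquad A x) = κ / ε * (4 * κ * mquad A x) := by
      field_simp; ring
    rw [e1, ← mul_add]
    refine mul_le_mul_of_nonneg_left ?_ (by positivity)
    have e2 : 4 * κ * mquad A x ≤ b₀ * y := by
      calc 4 * κ * mquad A x ≤ 4 * κ * (θ⁻¹ * y) := by gcongr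
        _ = b₀ * y := by rw [hκ]; field_simp
    have : 2 * ε * trMul A 1 ≤ 2 * ε * Λ := by gcongr
    nlinarith
  refine le_trans (mul_le_mul_of_nonneg_left key (by positivity)) ?_
  have hR0 : 0 ≤ Reps Λ κ b₀ C r ε := by unfold Reps; positivity
  by_cases hc : 2 * ε * Λ ≤ b₀ * y
  · refine le_trans ?_ hR0
    refine mul_nonpos_of_nonneg_of_nonpos (by positivity) (mul_nonpos_of_nonneg_of_nonpos (by positivity) (by linarith))
  · push Not at hc
    have hy2 : y ≤ 2 * ε * Λ / b₀ := by rw [le_div_iff₀ hb]; linarith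
    have hexp : Real.exp (κ / ε * (y - r ^ 2)) ≤
        Real.exp (2 * κ * Λ / b₀) * Real.exp (-(κ * r ^ 2 / ε)) := by
      rw [← Real.exp_add]
      apply Real.exp_le_exp.2
      calc κ / ε * (y - r ^ 2) ≤ κ / ε * (2 * ε * Λ / b₀ - r ^ 2) := by gcongr
        _ = _ := by field_simp; ring
    calc 4 * C * Real.exp (κ / ε * (y - r ^ 2)) * (κ / ε * (2 * ε * Λ - b₀ * y))
        ≤ 4 * C * (Real.exp (2 * κ * Λ / b₀) * Real.exp (-(κ * r ^ 2 / ε))) * (κ / ε * (2 * ε * Λ)) := by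
          gcongr
          have : 0 ≤ b₀ * y := by positivity
          linarith
      _ = Reps Λ κ b₀ C r ε := by unfold Reps; field_simp; ring

def Up (κ C r ε : ℝ) (u : Eu n → ℝ → ℝ) (M t : ℝ) : Prop :=
  ∀ x ∈ closedBall (0 : Eu n) r, u x t ≤ M + zeta κ C r ε x

theorem Up.mono {κ : ℝ} {u : Eu n → ℝ → ℝ} {M M' t : ℝ} (h : Up κ C r ε u M t) (hM : M ≤ M') :
    Up κ C r ε u M' t := fun x hx => (h x hx).trans (by linarith)

theorem Reps_nonneg (h : BD Ω b θ ε C r b₀ Lb) :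
    0 ≤ Reps (n * θ⁻¹) (b₀ * θ / 4) b₀ C r ε := by
  obtain ⟨hθ, hε, hC, hr, hb, -, -, hco, -⟩ := h
  unfold Reps; positivity

/-- strict form of the propagation of upper bounds -/
theorem Up_strict (h : BD Ω b θ ε C r b₀ Lb) {A : Eu n → ℝ → Matrix (Fin n) (Fin n) ℝ}
    {u : Eu n → ℝ → ℝ} (hu : LS Ω b θ ε C A u) {M t0 : ℝ} (hM : -(2 * C) ≤ M) (ht0 : 0 < t0)
    (hup : Up (b₀ * θ / 4) C r ε u M t0) {η : ℝ} (hη : 0 < η) :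
    ∀ x ∈ closedBall (0 : Eu n) r, ∀ t ≥ t0,
      u x t < M + zeta (b₀ * θ / 4) C r ε x + η +
        (Reps (n * θ⁻¹) (b₀ * θ / 4) b₀ C r ε + η) * (t - t0) := by
  intro x hx t ht
  set κ := b₀ * θ / 4 with hκ
  set R := Reps (n * θ⁻¹) κ b₀ C r ε with hR
  have hR0 : 0 ≤ R := Reps_nonneg h
  refine CMP hu h.hθ h.hε (K := closedBall 0 r) (U := ball 0 r) (isCompact_closedBall _ _) h.sub
    isOpen_ball ball_subset_closedBall ht0 (t1 := t)
    (fun x t => M + zeta κ C r ε x + η + (R + η) * (t - t0)) ?_ ?_ ?_ ?_ x hx t ⟨ht, le_rfl⟩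
  · have := zeta_cont (n := n) (C := C) (r := r) (ε := ε) κ
    exact Continuous.continuousOn (by fun_prop)
  · intro y hy s hs
    right
    obtain ⟨hz1, hz2⟩ := zeta_Lop h (hu.mem y (h.sub (ball_subset_closedBall hy)) s (ht0.trans hs.1))
      (ball_subset_closedBall hy)
    have e : (fun y : Eu n => M + zeta κ C r ε y + η + (R + η) * (s - t0)) =
      fun y : Eu n => zeta κ C r ε y + (M + η + (R + η) * (s - t0)) := by ext; ring
    simp only [e]
    refine ⟨hz1.add contDiffAt_const, R + η, ?_, ?_⟩
    · simpa using (((hasDerivAt_id s).sub_const t0).const_mul (R + η)).const_add (M + zeta κ C r ε y + η)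
    · rw [Lop_add hz1 contDiffAt_const, Lop_const]
      linarith
  · intro y hy
    have := hup y hy
    simp only [sub_self, mul_zero, add_zero]
    linarith
  · intro y hy s hs
    have hn : ‖y‖ = r := by
      have h1 := hy.1; have h2 := hy.2
      simp at h1 h2
      linarith
    have h1 := zeta_bdry (C := C) (ε := ε) κ hn
    have h2 := (abs_le.1 (hu.bd y (h.sub hy.1) s (ht0.trans_le hs.1))).2
    have h3 : 0 ≤ (R + η) * (s - t0) := mul_nonneg (by linarith) (by linarith [hs.1])
    simp only [h1]
    linarith [h.hC]

theorem le_of_eta {a c k : ℝ} (h : ∀ η > (0:ℝ), a ≤ c + k * η) : a ≤ c := by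
  have h1 : Tendsto (fun η : ℝ => c + k * η) (𝓝[>] 0) (𝓝 (c + k * 0)) := by
    have : Continuous fun η : ℝ => c + k * η := by fun_prop
    exact (this.tendsto 0).mono_left nhdsWithin_le_nhds
  have := ge_of_tendsto h1 (by filter_upwards [self_mem_nhdsWithin] with η hη using h η hη)
  simpa using this

theorem Up_prop (h : BD Ω b θ ε C r b₀ Lb) {A : Eu n → ℝ → Matrix (Fin n) (Fin n) ℝ}
    {u : Eu n → ℝ → ℝ} (hu : LS Ω b θ ε C A u) {M t0 t : ℝ} (hM : -(2 * C) ≤ M) (ht0 : 0 < t0)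
    (hup : Up (b₀ * θ / 4) C r ε u M t0) (ht : t0 ≤ t) :
    Up (b₀ * θ / 4) C r ε u (M + Reps (n * θ⁻¹) (b₀ * θ / 4) b₀ C r ε * (t - t0)) t := by
  intro x hx
  apply le_of_eta (k := 1 + (t - t0))
  intro η hη
  have := Up_strict h hu hM ht0 hup hη x hx t ht
  nlinarith

end Part3

section Part4

theorem bump_deriv {Q ε s : ℝ} (hq : 0 < Q - s / ε) :
    ContDiffAt ℝ 2 (fun s : ℝ => (max (Q - s / ε) 0) ^ 2) s ∧
    (∀ᶠ s' in 𝓝 s, HasDerivAt (fun s : ℝ => (max (Q - s / ε) 0) ^ 2) (-2 / ε * (Q - s' / ε)) s') ∧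
    HasDerivAt (fun s' : ℝ => -2 / ε * (Q - s' / ε)) (2 / ε ^ 2) s := by
  have hc : Continuous (fun s : ℝ => Q - s / ε) := by fun_prop
  have hev : ∀ᶠ s' in 𝓝 s, 0 < Q - s' / ε := hc.continuousAt.eventually (lt_mem_nhds hq)
  have heq : (fun s : ℝ => (max (Q - s / ε) 0) ^ 2) =ᶠ[𝓝 s] fun s : ℝ => (Q - s / ε) ^ 2 := by
    filter_upwards [hev] with s' hs'
    rw [max_eq_left hs'.le]
  have hd : ∀ s' : ℝ, HasDerivAt (fun s : ℝ => Q - s / ε) (-(1 / ε)) s' := fun s' => by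
    simpa using ((hasDerivAt_id s').div_const ε).const_sub Q
  refine ⟨?_, ?_, ?_⟩
  · refine ContDiffAt.congr_of_eventuallyEq ?_ heq
    fun_prop
  · filter_upwards [heq.eventuallyEq_nhds] with s' hs'
    refine HasDerivAt.congr_of_eventuallyEq ?_ hs'
    have := (hd s').fun_pow 2
    refine this.congr_deriv ?_
    push_cast; ring
  · have := (hd s).const_mul (-2 / ε)
    refine this.congr_deriv ?_
    ring

theorem aux_sq (s p : ℝ) : (s + p) * s ≤ 2 * s ^ 2 + p ^ 2 := by
  nlinarith [sq_nonneg (s - p), sq_nonneg s, sq_nonneg p]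

theorem dotp_le (x y : Eu n) : |dotp x y| ≤ ‖x‖ * ‖y‖ := by
  rw [dotp_eq_inner]; exact abs_real_inner_le_norm x y

set_option maxHeartbeats 1000000 in
theorem drop1 (h : BD Ω b θ ε C r b₀ Lb) {A : Eu n → ℝ → Matrix (Fin n) (Fin n) ℝ}
    {u : Eu n → ℝ → ℝ} (hu : LS Ω b θ ε C A u) {M t0 : ℝ} (hM : -(2 * C) ≤ M) (ht0 : 0 < t0)
    (hup : Up (b₀ * θ / 4) C r ε u M t0) {ρ δ γ l : ℝ} {p : Eu n} (hp : ‖p‖ ^ 2 ≤ ε)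
    (hρ : 0 < ρ) (hδ : 0 < δ) (hγ : 0 ≤ γ)
    (hlow : ∀ x ∈ closedBall (0 : Eu n) r, ‖x - p‖ ^ 2 / ε ≤ ρ ^ 2 → u x t0 ≤ M - δ)
    (hsm : ∀ x : Eu n, ‖x‖ = r → ρ ^ 2 + γ ≤ ‖x - p‖ ^ 2 / ε)
    (hl : ∀ q : ℝ, 0 ≤ l * q ^ 2 - (2 * γ + 4 * (n * θ⁻¹) + 4 * Lb * (1 + 2 * (ρ ^ 2 + γ)) + 8 * θ) * q
      + 8 * θ * ρ ^ 2) :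
    ∀ x ∈ closedBall (0 : Eu n) r, ‖x - p‖ ^ 2 / ε ≤ ρ ^ 2 + γ - 1 →
      u x (t0 + 1) ≤ M + zeta (b₀ * θ / 4) C r ε x + Reps (n * θ⁻¹) (b₀ * θ / 4) b₀ C r ε
        - δ / ρ ^ 4 * Real.exp (-l) := by
  intro x hx hxz
  apply le_of_eta (k := 2)
  intro η hη
  have hstr := Up_strict h hu hM ht0 hup hη
  set κ := b₀ * θ / 4 with hκ
  set R := Reps (n * θ⁻¹) κ b₀ C r ε with hR
  have hR0 : 0 ≤ R := Reps_nonneg h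
  have hε := h.hε
  have hθ := h.hθ
  set c := δ / ρ ^ 4 with hc
  have hcp : 0 < c := by positivity
  have hmain := CMP hu h.hθ h.hε (K := closedBall 0 r) (U := ball 0 r) (isCompact_closedBall _ _) h.sub
    isOpen_ball ball_subset_closedBall ht0 (t1 := t0 + 1)
    (fun x t => M + zeta κ C r ε x + η + (R + η) * (t - t0) +
      -(c * Real.exp (-l * (t - t0))) * (max (ρ ^ 2 + γ * (t - t0) - ‖x - p‖ ^ 2 / ε) 0) ^ 2)
    ?_ ?_ ?_ ?_ x hx (t0 + 1) ⟨by linarith, le_rfl⟩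
  · refine hmain.le.trans ?_
    have : 1 ≤ max (ρ ^ 2 + γ * (t0 + 1 - t0) - ‖x - p‖ ^ 2 / ε) 0 :=
      le_max_of_le_left (by linarith)
    have h2 : 1 ≤ (max (ρ ^ 2 + γ * (t0 + 1 - t0) - ‖x - p‖ ^ 2 / ε) 0) ^ 2 := one_le_pow₀ this
    have h3 : 0 < c * Real.exp (-l) := by positivity
    have h4 : t0 + 1 - t0 = 1 := by ring
    rw [h4] at h2 ⊢
    simp only [mul_one] at h2 ⊢
    nlinarith
  · have := zeta_cont (n := n) (C := C) (r := r) (ε := ε) κ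
    exact Continuous.continuousOn (by fun_prop)
  · intro y hy s hs
    have hyc := ball_subset_closedBall hy
    by_cases hq : 0 < ρ ^ 2 + γ * (s - t0) - ‖y - p‖ ^ 2 / ε
    swap
    · left
      have := hstr y hyc s hs.1.le
      rw [max_eq_right (not_lt.1 hq)]
      simpa using this
    right
    have hA := hu.mem y (h.sub hyc) s (ht0.trans hs.1)
    obtain ⟨hz1, hz2⟩ := zeta_Lop h hA hyc
    obtain ⟨hb1, hb2, hb3⟩ := bump_deriv hq
    set Q := ρ ^ 2 + γ * (s - t0) with hQ
    have hsq := (contDiff_sqd p).contDiffAt (x := y)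
    have hB : ContDiffAt ℝ 2 (fun y => (max (Q - ‖y - p‖ ^ 2 / ε) 0) ^ 2) y :=
      ContDiffAt.comp (g := fun s : ℝ => (max (Q - s / ε) 0) ^ 2) y hb1 hsq
    have hLB := Lop_comp (ε := ε) (A := A y s) (q := b y) hsq hb1 hb2 hb3
    have e : (fun y : Eu n => M + zeta κ C r ε y + η + (R + η) * (s - t0) +
      -(c * Real.exp (-l * (s - t0))) * (max (Q - ‖y - p‖ ^ 2 / ε) 0) ^ 2) =
      fun y : Eu n => zeta κ C r ε y + (-(c * Real.exp (-l * (s - t0))) * (max (Q - ‖y - p‖ ^ 2 / ε) 0) ^ 2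
        + (M + η + (R + η) * (s - t0))) := by ext; ring
    simp only [e]
    have hB' := (contDiffAt_const (c := -(c * Real.exp (-l * (s - t0))))).mul hB
    refine ⟨hz1.add (hB'.add contDiffAt_const), ?_⟩
    set q := Q - ‖y - p‖ ^ 2 / ε with hqd
    refine ⟨(R + η) + -(c * (Real.exp (-l * (s - t0)) * (-l)) * q ^ 2 +
      c * Real.exp (-l * (s - t0)) * (2 * q * γ)), ?_, ?_⟩
    · have hcont : Continuous (fun s => ρ ^ 2 + γ * (s - t0) - ‖y - p‖ ^ 2 / ε) := by fun_prop
      have hev : ∀ᶠ s' in 𝓝 s, 0 < ρ ^ 2 + γ * (s' - t0) - ‖y - p‖ ^ 2 / ε :=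
        hcont.continuousAt.eventually (lt_mem_nhds hq)
      have hl' : HasDerivAt (fun s : ℝ => s - t0) 1 s := (hasDerivAt_id s).sub_const t0
      have h1 : HasDerivAt (fun s => Real.exp (-l * (s - t0))) (Real.exp (-l * (s - t0)) * (-l)) s := by
        simpa using (hl'.const_mul (-l)).exp
      have h2 : HasDerivAt (fun s => (ρ ^ 2 + γ * (s - t0) - ‖y - p‖ ^ 2 / ε) ^ 2) (2 * q * γ) s := by
        have := (((hl'.const_mul γ).const_add (ρ ^ 2)).sub_const (‖y - p‖ ^ 2 / ε)).fun_pow 2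
        refine this.congr_deriv ?_
        simp only [hqd, hQ]; push_cast; ring
      have h3 := (h1.const_mul c).mul h2
      have h4 := ((hl'.const_mul (R + η)).const_add (M + zeta κ C r ε y + η)).sub h3
      refine (h4.congr_of_eventuallyEq ?_).congr_deriv ?_
      · filter_upwards [hev] with s' hs'
        simp only [Pi.sub_apply, Pi.mul_apply]
        rw [max_eq_left hs'.le]; ring
      · simp only [hqd, hQ]; ring
    · rw [Lop_add hz1 (hB'.add contDiffAt_const), Lop_add hB' contDiffAt_const, Lop_const,
        Lop_const_mul _ hB, hLB, Lop_sqd, gradient_sqd, mquad_smul_vec]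
      have hA1 := (hA.2 (y - p)).1
      have htr := trMul_one_le hA
      set z := ‖y - p‖ ^ 2 / ε with hz
      have hzε : ‖y - p‖ ^ 2 = z * ε := by rw [hz]; field_simp
      have hz0 : 0 ≤ z := by positivity
      have hs1 : s - t0 ≤ 1 := by linarith [hs.2]
      have hs0 : 0 ≤ s - t0 := by linarith [hs.1]
      have hQ1 : Q ≤ ρ ^ 2 + γ := by rw [hQ]; nlinarith
      have hQ0 : ρ ^ 2 ≤ Q := by rw [hQ]; nlinarith
      have hzG : z ≤ ρ ^ 2 + γ := by linarith
      have hdrift : dotp (b y) (y - p) ≤ Lb * (1 + 2 * (ρ ^ 2 + γ)) * ε := by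
        have h1 := (le_abs_self _).trans (dotp_le (b y) (y - p))
        have h2 := h.lip y
        have h3 : ‖y‖ ≤ ‖y - p‖ + ‖p‖ := by
          have := norm_add_le (y - p) p
          simpa using this
        have hLb := h.hLb
        have h4 : ‖b y‖ ≤ Lb * (‖y - p‖ + ‖p‖) := h2.trans (by gcongr)
        have h5 : (‖y - p‖ + ‖p‖) * ‖y - p‖ ≤ 2 * ‖y - p‖ ^ 2 + ‖p‖ ^ 2 := aux_sq _ _
        calc dotp (b y) (y - p) ≤ Lb * (‖y - p‖ + ‖p‖) * ‖y - p‖ := h1.trans (by gcongr)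
          _ = Lb * ((‖y - p‖ + ‖p‖) * ‖y - p‖) := by ring
          _ ≤ Lb * (2 * ‖y - p‖ ^ 2 + ‖p‖ ^ 2) := by gcongr
          _ ≤ Lb * (2 * ((ρ ^ 2 + γ) * ε) + ε) := by
              rw [hzε]; gcongr
          _ = _ := by ring
      have hkey : 2 * γ * q - l * q ^ 2 ≤ -2 / ε * q * (2 * ε * trMul (A y s) 1 + 2 * dotp (b y) (y - p))
          + ε * (2 / ε ^ 2) * (2 ^ 2 * mquad (A y s) (y - p)) := by
        have e1 : ε * (2 / ε ^ 2) * (2 ^ 2 * mquad (A y s) (y - p)) = 8 * (mquad (A y s) (y - p) / ε) := by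
          field_simp; ring
        have e2 : θ * z ≤ mquad (A y s) (y - p) / ε := by
          rw [le_div_iff₀ hε, mul_assoc, ← hzε]; exact hA1
        have e3 : -2 / ε * q * (2 * ε * trMul (A y s) 1 + 2 * dotp (b y) (y - p)) =
          -(4 * q * (trMul (A y s) 1 + dotp (b y) (y - p) / ε)) := by field_simp; ring
        have e4 : dotp (b y) (y - p) / ε ≤ Lb * (1 + 2 * (ρ ^ 2 + γ)) := by
          rw [div_le_iff₀ hε]; exact hdrift
        have e5 : q * (trMul (A y s) 1 + dotp (b y) (y - p) / ε) ≤ q * (n * θ⁻¹ + Lb * (1 + 2 * (ρ ^ 2 + γ))) :=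
          mul_le_mul_of_nonneg_left (by linarith) hq.le
        have e6 : θ * (ρ ^ 2 - q) ≤ θ * z := mul_le_mul_of_nonneg_left (by linarith) hθ.le
        rw [e1, e3]
        have := hl q
        linarith
      have hce : 0 < c * Real.exp (-l * (s - t0)) := by positivity
      have := mul_le_mul_of_nonneg_left hkey hce.le
      linarith
  · intro y hy
    simp only [sub_self, mul_zero, add_zero, Real.exp_zero, mul_one]
    by_cases hq : ‖y - p‖ ^ 2 / ε ≤ ρ ^ 2
    · have h1 := hlow y hy hq
      have hz := zeta_pos (r := r) (ε := ε) κ h.hC y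
      rw [max_eq_left (by linarith)]
      have h0 : 0 ≤ ‖y - p‖ ^ 2 / ε := by positivity
      have h2 : (ρ ^ 2 - ‖y - p‖ ^ 2 / ε) ^ 2 ≤ (ρ ^ 2) ^ 2 :=
        pow_le_pow_left₀ (by linarith) (by linarith) 2
      have h3 : c * (ρ ^ 2 - ‖y - p‖ ^ 2 / ε) ^ 2 ≤ c * (ρ ^ 2) ^ 2 := by gcongr
      have h4 : c * (ρ ^ 2) ^ 2 = δ := by rw [hc]; field_simp
      linarith
    · push Not at hq
      have := hup y hy
      rw [max_eq_right (by linarith)]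
      simp
      linarith
  · intro y hy s hs
    have hn : ‖y‖ = r := by
      have h1 := hy.1; have h2 := hy.2
      simp at h1 h2
      linarith
    have h1 := hstr y hy.1 s hs.1
    have h2 := hsm y hn
    have h3 : γ * (s - t0) ≤ γ := by nlinarith [hs.1, hs.2]
    have e : ρ ^ 2 + γ * (s - t0) - ‖y - p‖ ^ 2 / ε ≤ 0 := by linarith
    simp only [max_eq_right e]
    simpa using h1

theorem drop2 (h : BD Ω b θ ε C r b₀ Lb) {A : Eu n → ℝ → Matrix (Fin n) (Fin n) ℝ}
    {u : Eu n → ℝ → ℝ} (hu : LS Ω b θ ε C A u) {M t0 T : ℝ} (hM : -(2 * C) ≤ M) (ht0 : 0 < t0)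
    (hT : 0 ≤ T) (hup : Up (b₀ * θ / 4) C r ε u M t0) {c : ℝ} (hc : 0 < c) (hcC : c ≤ C)
    (hlow : ∀ x ∈ closedBall (0 : Eu n) r, ‖x‖ ^ 2 / ε ≤ 2 * (n * θ⁻¹ / b₀ + 1) →
      u x t0 ≤ M + zeta (b₀ * θ / 4) C r ε x - c)
    (hTε : Real.exp (-(2 * b₀ * T)) * r ^ 2 ≤ ε) :
    Up (b₀ * θ / 4) C r ε u (M - c / 2 + Reps (n * θ⁻¹) (b₀ * θ / 4) b₀ C r ε * T) (t0 + T) := by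
  intro x hx
  apply le_of_eta (k := 1 + T)
  intro η hη
  set κ := b₀ * θ / 4 with hκ
  set R := Reps (n * θ⁻¹) κ b₀ C r ε with hR
  have hR0 : 0 ≤ R := Reps_nonneg h
  have hε := h.hε
  have hθ := h.hθ
  have hb₀ := h.hb₀
  set σ := (n : ℝ) * θ⁻¹ / b₀ with hσ
  have hσ0 : 0 ≤ σ := by positivity
  have hmain := CMP hu h.hθ h.hε (K := closedBall 0 r) (U := ball 0 r) (isCompact_closedBall _ _) h.sub
    isOpen_ball ball_subset_closedBall ht0 (t1 := t0 + T)
    (fun x t => zeta κ C r ε x + (c / (2 * (σ + 1)) * Real.exp (-(2 * b₀) * (t - t0)) / ε * ‖x - 0‖ ^ 2 +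
      (M - c + c / (2 * (σ + 1)) * (σ * (1 - Real.exp (-(2 * b₀) * (t - t0)))) + η + (R + η) * (t - t0))))
    ?_ ?_ ?_ ?_ x hx (t0 + T) ⟨by linarith, le_rfl⟩
  · refine hmain.le.trans ?_
    have e0 : t0 + T - t0 = T := by ring
    have e1 : -(2 * b₀) * T = -(2 * b₀ * T) := by ring
    rw [e0, e1, sub_zero]
    set e := Real.exp (-(2 * b₀ * T)) with he
    have hep : 0 < e := Real.exp_pos _
    have hx2 : ‖x‖ ^ 2 ≤ r ^ 2 := by
      have : ‖x‖ ≤ r := by simpa using hx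
      gcongr
    have h1 : e / ε * ‖x‖ ^ 2 ≤ 1 := by
      rw [div_mul_eq_mul_div, div_le_one hε]
      calc e * ‖x‖ ^ 2 ≤ e * r ^ 2 := by gcongr
        _ ≤ ε := hTε
    have h2 : c / (2 * (σ + 1)) * (e / ε * ‖x‖ ^ 2 + σ * (1 - e)) ≤ c / (2 * (σ + 1)) * (1 + σ) := by
      have : σ * (1 - e) ≤ σ := by nlinarith
      gcongr
    have h3 : c / (2 * (σ + 1)) * (1 + σ) = c / 2 := by field_simp; ring
    have h4 : c / (2 * (σ + 1)) * e / ε * ‖x‖ ^ 2 = c / (2 * (σ + 1)) * (e / ε * ‖x‖ ^ 2) := by ring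
    rw [h4]
    nlinarith
  · have := zeta_cont (n := n) (C := C) (r := r) (ε := ε) κ
    exact Continuous.continuousOn (by fun_prop)
  · intro y hy s hs
    have hyc := ball_subset_closedBall hy
    right
    have hA := hu.mem y (h.sub hyc) s (ht0.trans hs.1)
    obtain ⟨hz1, hz2⟩ := zeta_Lop h hA hyc
    have hsq := (contDiff_sqd (0 : Eu n)).contDiffAt (x := y)
    have hB' := (contDiffAt_const (c := c / (2 * (σ + 1)) * Real.exp (-(2 * b₀) * (s - t0)) / ε)).mul hsq
    refine ⟨hz1.add (hB'.add contDiffAt_const), ?_⟩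
    set e := Real.exp (-(2 * b₀) * (s - t0)) with he
    have hep : 0 < e := Real.exp_pos _
    have hl' : HasDerivAt (fun s : ℝ => s - t0) 1 s := (hasDerivAt_id s).sub_const t0
    have h1 : HasDerivAt (fun s => Real.exp (-(2 * b₀) * (s - t0))) (e * (-(2 * b₀))) s := by
      simpa only [mul_one] using (hl'.const_mul (-(2 * b₀))).exp
    refine ⟨c / (2 * (σ + 1)) * (e * (-(2 * b₀))) / ε * ‖y - 0‖ ^ 2 +
      (c / (2 * (σ + 1)) * (σ * (- (e * (-(2 * b₀))))) + (R + η)), ?_, ?_⟩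
    · have h2 := ((h1.const_mul (c / (2 * (σ + 1)))).div_const ε).mul_const (‖y - 0‖ ^ 2)
      have h3 := (((h1.const_sub 1).const_mul σ).const_mul (c / (2 * (σ + 1)))).const_add (M - c)
      have h4 := ((h3.add_const η).add (hl'.const_mul (R + η)))
      have h5 := (h2.add h4).const_add (zeta κ C r ε y)
      simpa using h5
    · rw [Lop_add hz1 (hB'.add contDiffAt_const), Lop_add hB' contDiffAt_const, Lop_const,
        Lop_const_mul _ hsq, Lop_sqd]
      simp only [sub_zero]
      have hb1 := h.coer y hyc
      have htr := trMul_one_le hA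
      have e1 : c / (2 * (σ + 1)) * e / ε * (2 * ε * trMul (A y s) 1 + 2 * dotp (b y) y) ≤
        c / (2 * (σ + 1)) * e / ε * (2 * ε * (n * θ⁻¹) + 2 * (-b₀ * ‖y‖ ^ 2)) := by
        gcongr
      have e2 : c / (2 * (σ + 1)) * e / ε * (2 * ε * (n * θ⁻¹) + 2 * (-b₀ * ‖y‖ ^ 2)) =
        c / (2 * (σ + 1)) * (e * (-(2 * b₀))) / ε * ‖y‖ ^ 2 +
          c / (2 * (σ + 1)) * (σ * (- (e * (-(2 * b₀))))) := by
        have : (n : ℝ) * θ⁻¹ = σ * b₀ := by rw [hσ]; field_simp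
        rw [this]; field_simp; ring
      linarith
  · intro y hy
    simp only [sub_self, mul_zero, add_zero, Real.exp_zero, mul_one, sub_zero]
    have e1 : c / (2 * (σ + 1)) / ε * ‖y‖ ^ 2 = c * ((‖y‖ ^ 2 / ε) / (2 * (σ + 1))) := by ring
    rw [e1]
    by_cases hq : ‖y‖ ^ 2 / ε ≤ 2 * (σ + 1)
    · have h1 := hlow y hy hq
      have : 0 ≤ c * ((‖y‖ ^ 2 / ε) / (2 * (σ + 1))) := by positivity
      linarith
    · push Not at hq
      have h1 := hup y hy
      have h2 : 1 ≤ (‖y‖ ^ 2 / ε) / (2 * (σ + 1)) := by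
        rw [le_div_iff₀ (by positivity)]; linarith
      nlinarith
  · intro y hy s hs
    have hn : ‖y‖ = r := by
      have h1 := hy.1; have h2 := hy.2
      simp at h1 h2
      linarith
    have h1 := zeta_bdry (C := C) (ε := ε) κ hn
    have h2 := (abs_le.1 (hu.bd y (h.sub hy.1) s (ht0.trans_le hs.1))).2
    have hs0 : 0 ≤ s - t0 := by linarith [hs.1]
    have h3 : 0 ≤ (R + η) * (s - t0) := mul_nonneg (by linarith) hs0
    have h4 : Real.exp (-(2 * b₀) * (s - t0)) ≤ 1 := by
      apply Real.exp_le_one_iff.2; nlinarith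
    have h5 : 0 ≤ c / (2 * (σ + 1)) * Real.exp (-(2 * b₀) * (s - t0)) / ε * ‖y - 0‖ ^ 2 := by positivity
    have h6 : 0 ≤ c / (2 * (σ + 1)) * (σ * (1 - Real.exp (-(2 * b₀) * (s - t0)))) :=
      mul_nonneg (by positivity) (mul_nonneg hσ0 (by linarith))
    simp only [h1]
    linarith [h.hC]

end Part4

section Part5

def gam (n : ℕ) (θ b₀ : ℝ) : ℝ := 4 * (n * θ⁻¹ / b₀ + 1) + 3

def C2c (n : ℕ) (θ b₀ Lb ρ : ℝ) : ℝ :=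
  2 * gam n θ b₀ + 4 * (n * θ⁻¹) + 4 * Lb * (1 + 2 * (ρ ^ 2 + gam n θ b₀)) + 8 * θ

def lamc (n : ℕ) (θ b₀ Lb ρ : ℝ) : ℝ := C2c n θ b₀ Lb ρ ^ 2 / (32 * θ * ρ ^ 2)

def c3 (n : ℕ) (θ b₀ Lb ρ : ℝ) : ℝ := min 1 (Real.exp (-lamc n θ b₀ Lb ρ) / ρ ^ 4)

theorem c3_pos (n : ℕ) {θ b₀ Lb ρ : ℝ} (hρ : 0 < ρ) : 0 < c3 n θ b₀ Lb ρ := by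
  unfold c3; exact lt_min one_pos (by positivity)

theorem norm_sq_le2 (x p : Eu n) : ‖x‖ ^ 2 ≤ 2 * ‖x - p‖ ^ 2 + 2 * ‖p‖ ^ 2 := by
  have h3 : ‖x‖ ≤ ‖x - p‖ + ‖p‖ := by
    have := norm_add_le (x - p) p
    simpa using this
  nlinarith [sq_nonneg (‖x - p‖ - ‖p‖), norm_nonneg x, norm_nonneg (x - p), norm_nonneg p]

theorem drop (h : BD Ω b θ ε C r b₀ Lb) {A : Eu n → ℝ → Matrix (Fin n) (Fin n) ℝ}
    {u : Eu n → ℝ → ℝ} (hu : LS Ω b θ ε C A u) {M t0 T : ℝ} (hM : -(2 * C) ≤ M) (ht0 : 0 < t0)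
    (hT : 0 ≤ T) (hup : Up (b₀ * θ / 4) C r ε u M t0) {ρ δ : ℝ} {p : Eu n} (hp : ‖p‖ ^ 2 ≤ ε)
    (hρ : 0 < ρ) (hδ : 0 < δ) (hδC : δ ≤ C)
    (hlow : ∀ x ∈ closedBall (0 : Eu n) r, ‖x - p‖ ^ 2 ≤ ρ ^ 2 * ε → u x t0 ≤ M - δ)
    (hsm : 2 * (ρ ^ 2 + gam n θ b₀ + 1) * ε ≤ r ^ 2)
    (hTε : Real.exp (-(2 * b₀ * T)) * r ^ 2 ≤ ε) :
    Up (b₀ * θ / 4) C r ε u (M - c3 n θ b₀ Lb ρ * δ / 2 +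
      Reps (n * θ⁻¹) (b₀ * θ / 4) b₀ C r ε * (1 + T)) (t0 + 1 + T) := by
  have hε := h.hε
  have hθ := h.hθ
  have hb₀ := h.hb₀
  have hLb := h.hLb
  have hR0 := Reps_nonneg h
  have hg0 : 0 ≤ gam n θ b₀ := by unfold gam; positivity
  have h1 := drop1 h hu hM ht0 hup (ρ := ρ) (δ := δ) (γ := gam n θ b₀) (l := lamc n θ b₀ Lb ρ) hp hρ hδ
    hg0
    (fun x hx hxz => hlow x hx (by rwa [div_le_iff₀ hε] at hxz))
    (by
      intro x hx
      rw [le_div_iff₀ hε]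
      have := norm_sq_le2 x p
      rw [hx] at this
      nlinarith)
    (by
      intro q
      change 0 ≤ lamc n θ b₀ Lb ρ * q ^ 2 - C2c n θ b₀ Lb ρ * q + 8 * θ * ρ ^ 2
      unfold lamc
      set c := C2c n θ b₀ Lb ρ
      have : c ^ 2 / (32 * θ * ρ ^ 2) * q ^ 2 - c * q + 8 * θ * ρ ^ 2 =
        (c * q - 16 * θ * ρ ^ 2) ^ 2 / (32 * θ * ρ ^ 2) := by
        field_simp; ring
      rw [this]; positivity)
  have hup1 := Up_prop h hu hM ht0 hup (t := t0 + 1) (by linarith)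
  have e0 : t0 + 1 - t0 = 1 := by ring
  rw [e0, mul_one] at hup1
  set R := Reps (n * θ⁻¹) (b₀ * θ / 4) b₀ C r ε with hR
  have hc3 := c3_pos n (θ := θ) (b₀ := b₀) (Lb := Lb) hρ
  have h2 := drop2 h hu (M := M + R) (by linarith) (by linarith : 0 < t0 + 1) hT hup1
    (c := c3 n θ b₀ Lb ρ * δ) (by positivity)
    (by
      have : c3 n θ b₀ Lb ρ ≤ 1 := min_le_left _ _
      nlinarith)
    (by
      intro x hx hxz
      have h3 := h1 x hx (by
        rw [div_le_iff₀ hε] at hxz ⊢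
        have hh := norm_sq_le2 (x - p) (-p)
        simp only [sub_neg_eq_add, sub_add_cancel, norm_neg] at hh
        unfold gam
        nlinarith [mul_pos (pow_pos hρ 2) hε])
      have h4 : c3 n θ b₀ Lb ρ * δ ≤ δ / ρ ^ 4 * Real.exp (-lamc n θ b₀ Lb ρ) := by
        have : c3 n θ b₀ Lb ρ ≤ Real.exp (-lamc n θ b₀ Lb ρ) / ρ ^ 4 := min_le_right _ _
        calc c3 n θ b₀ Lb ρ * δ ≤ Real.exp (-lamc n θ b₀ Lb ρ) / ρ ^ 4 * δ := by gcongr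
          _ = _ := by ring
      linarith)
    hTε
  refine h2.mono ?_
  linarith

end Part5

section Part6

/-! ### Area inequality and quadratic forms -/

open MeasureTheory in
theorem area_ineq {A V : Set (Eu n)} {f : Eu n → Eu n} {f' : Eu n → Eu n →L[ℝ] Eu n}
    (hA : IsCompact A) (hV : IsCompact V) (hf' : ∀ x ∈ A, HasFDerivAt f (f' x) x)
    (hsurj : V ⊆ f '' A) {G : Eu n → ℝ} (hG : Continuous G) {c : ℝ} (hc : 0 ≤ c)
    (hdet : ∀ x ∈ A, |(f' x).det| ≤ c * Real.exp (G (f x))) :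
    ∫ y in V, (1 - G y) ≤ c * (volume.real A) := by
  classical
  have hAm : MeasurableSet A := hA.isClosed.measurableSet
  have hVm : MeasurableSet V := hV.isClosed.measurableSet
  have hfc : ContinuousOn f A := fun x hx => (hf' x hx).continuousAt.continuousWithinAt
  set F : Eu n → Eu n := A.piecewise f (fun _ => 0) with hF
  have hFm : Measurable F := hfc.measurable_piecewise continuousOn_const hAm
  have hFe : ∀ x ∈ A, F x = f x := fun x hx => by simp [hF, hx]
  set g : Eu n → ℝ≥0∞ := fun y => ENNReal.ofReal (c * Real.exp (G y)) with hg
  have hgm : Measurable g := by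
    have : Continuous fun y => c * Real.exp (G y) := by fun_prop
    exact this.measurable.ennreal_ofReal
  set ν : Measure (Eu n) := (volume.restrict A).map F with hν
  have hle : volume.restrict V ≤ ν.withDensity g := by
    refine Measure.le_iff.2 fun B hB => ?_
    rw [Measure.restrict_apply hB, withDensity_apply _ hB, hν, setLIntegral_map hB hgm hFm,
      Measure.restrict_restrict (hFm hB)]
    have hset : F ⁻¹' B ∩ A ⊆ A := inter_subset_right
    have hms : MeasurableSet (F ⁻¹' B ∩ A) := (hFm hB).inter hAm
    calc volume (B ∩ V) ≤ volume (f '' (F ⁻¹' B ∩ A)) := by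
          apply measure_mono
          rintro y ⟨hyB, hyV⟩
          obtain ⟨x, hx, rfl⟩ := hsurj hyV
          exact ⟨x, ⟨by simpa [hFe x hx] using hyB, hx⟩, rfl⟩
      _ ≤ ∫⁻ x in F ⁻¹' B ∩ A, ENNReal.ofReal |(f' x).det| :=
          addHaar_image_le_lintegral_abs_det_fderiv volume hms
            (fun x hx => (hf' x hx.2).hasFDerivWithinAt)
      _ ≤ ∫⁻ x in F ⁻¹' B ∩ A, g (F x) := by
          refine setLIntegral_mono' hms fun x hx => ?_
          rw [hFe x hx.2]
          exact ENNReal.ofReal_le_ofReal (hdet x hx.2)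
  have hem : Measurable fun y => ENNReal.ofReal (Real.exp (-G y)) := by
    have : Continuous fun y => Real.exp (-G y) := by fun_prop
    exact this.measurable.ennreal_ofReal
  have h1 : ∫⁻ y in V, ENNReal.ofReal (Real.exp (-G y)) ≤ ENNReal.ofReal c * volume A := by
    calc ∫⁻ y in V, ENNReal.ofReal (Real.exp (-G y))
        ≤ ∫⁻ y, ENNReal.ofReal (Real.exp (-G y)) ∂(ν.withDensity g) := lintegral_mono' hle le_rfl
      _ = ∫⁻ y, ENNReal.ofReal c ∂ν := by
          rw [lintegral_withDensity_eq_lintegral_mul _ hgm hem]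
          refine lintegral_congr fun y => ?_
          simp only [Pi.mul_apply, hg]
          rw [← ENNReal.ofReal_mul (by positivity), mul_assoc, ← Real.exp_add]
          simp
      _ = ENNReal.ofReal c * volume A := by
          rw [lintegral_const, hν, Measure.map_apply hFm MeasurableSet.univ]
          simp
  have hIntg : IntegrableOn (fun y => Real.exp (-G y)) V :=
    (by fun_prop : Continuous fun y => Real.exp (-G y)).continuousOn.integrableOn_compact hV
  have hIntg2 : IntegrableOn (fun y => 1 - G y) V :=
    (by fun_prop : Continuous fun y => 1 - G y).continuousOn.integrableOn_compact hV
  calc ∫ y in V, (1 - G y) ≤ ∫ y in V, Real.exp (-G y) := by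
        refine integral_mono hIntg2 hIntg fun y => ?_
        have := Real.add_one_le_exp (-G y)
        simp only; linarith
    _ = (∫⁻ y in V, ENNReal.ofReal (Real.exp (-G y))).toReal := by
        rw [integral_eq_lintegral_of_nonneg_ae (Eventually.of_forall fun y => (Real.exp_pos _).le)
          hIntg.aestronglyMeasurable]
    _ ≤ (ENNReal.ofReal c * volume A).toReal :=
        ENNReal.toReal_mono (ENNReal.mul_ne_top ENNReal.ofReal_ne_top hA.measure_lt_top.ne) h1
    _ = c * volume.real A := by
        rw [ENNReal.toReal_mul, ENNReal.toReal_ofReal hc]; rfl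

/-- matrix as a continuous linear map -/
def mv (A : Matrix (Fin n) (Fin n) ℝ) : Eu n →L[ℝ] Eu n := Matrix.toEuclideanCLM (𝕜 := ℝ) A

theorem mv_apply (A : Matrix (Fin n) (Fin n) ℝ) (x : Eu n) (i : Fin n) :
    mv A x i = ∑ j, A i j * x j := rfl

theorem mv_mul (A B : Matrix (Fin n) (Fin n) ℝ) (x : Eu n) : mv (A * B) x = mv A (mv B x) := by
  unfold mv; rw [map_mul]; rfl

theorem mv_one (x : Eu n) : mv (1 : Matrix (Fin n) (Fin n) ℝ) x = x := by
  unfold mv; rw [map_one]; rfl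

theorem mv_det (A : Matrix (Fin n) (Fin n) ℝ) : (mv A).det = A.det := by
  unfold mv ContinuousLinearMap.det
  rw [Matrix.coe_toEuclideanCLM_eq_toEuclideanLin, Matrix.toEuclideanLin_eq_toLin, LinearMap.det_toLin]

theorem mquad_eq_inner (A : Matrix (Fin n) (Fin n) ℝ) (x : Eu n) : mquad A x = inner ℝ x (mv A x) := by
  unfold mv
  rw [Matrix.inner_toEuclideanCLM, mquad_eq_dot]

theorem inner_mv_symm {A : Matrix (Fin n) (Fin n) ℝ} (hA : A.IsSymm) (x y : Eu n) :
    inner ℝ x (mv A y) = inner ℝ (mv A x) y := by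
  rw [real_inner_comm y]
  unfold mv
  rw [Matrix.inner_toEuclideanCLM, Matrix.inner_toEuclideanCLM, Matrix.dotProduct_mulVec,
    ← Matrix.mulVec_transpose, hA.eq, dotProduct_comm]

theorem cauchy_mquad {A : Matrix (Fin n) (Fin n) ℝ} (hA : A.IsSymm) (hp : ∀ p : Eu n, 0 ≤ mquad A p)
    (x y : Eu n) : (inner ℝ x (mv A y)) ^ 2 ≤ mquad A x * mquad A y := by
  have h : ∀ t : ℝ, 0 ≤ mquad A y * (t * t) + (2 * inner ℝ x (mv A y)) * t + mquad A x := by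
    intro t
    have := hp (x + t • y)
    rw [mquad_eq_inner] at this
    simp only [map_add, map_smul, inner_add_left, inner_add_right, inner_smul_left, inner_smul_right,
      ← mquad_eq_inner, RCLike.conj_to_real] at this
    have e : inner ℝ y (mv A x) = inner ℝ x (mv A y) := by
      rw [inner_mv_symm hA, real_inner_comm]
    rw [e] at this
    linarith
  have := discrim_le_zero h
  unfold discrim at this
  nlinarith

theorem mv_norm_le {θ : ℝ} (hθ : 0 < θ) {A : Matrix (Fin n) (Fin n) ℝ} (hA : memS θ A) (x : Eu n) :
    ‖mv A x‖ ≤ θ⁻¹ * ‖x‖ := by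
  have hpos : ∀ p : Eu n, 0 ≤ mquad A p := fun p => le_trans (by positivity) (hA.2 p).1
  have h1 := cauchy_mquad hA.1 hpos (mv A x) x
  rw [real_inner_self_eq_norm_sq] at h1
  have h2 := (hA.2 (mv A x)).2
  have h3 := (hA.2 x).2
  have h4 : mquad A (mv A x) * mquad A x ≤ (θ⁻¹ * ‖mv A x‖ ^ 2) * (θ⁻¹ * ‖x‖ ^ 2) :=
    mul_le_mul h2 h3 (hpos _) (by positivity)
  by_contra hc
  push Not at hc
  have h0 : 0 < ‖mv A x‖ := lt_of_le_of_lt (by positivity) hc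
  have h5 : ‖mv A x‖ ^ 2 * ‖mv A x‖ ^ 2 ≤ ‖mv A x‖ ^ 2 * (θ⁻¹ * ‖x‖) ^ 2 := by nlinarith
  have h6 := le_of_mul_le_mul_left h5 (by positivity)
  have h7 : (θ⁻¹ * ‖x‖) ^ 2 < ‖mv A x‖ ^ 2 := by gcongr
  linarith

theorem exists_inv {θ : ℝ} (hθ : 0 < θ) {A : Matrix (Fin n) (Fin n) ℝ} (hA : memS θ A) :
    ∃ P, memS θ P ∧ A * P = 1 := by
  have hpos : ∀ p : Eu n, 0 ≤ mquad A p := fun p => le_trans (by positivity) (hA.2 p).1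
  have hinj : Function.Injective A.mulVec := by
    intro x y hxy
    have h1 : mquad A (WithLp.toLp 2 (x - y)) = 0 := by
      rw [mquad_eq_dot]
      simp [Matrix.mulVec_sub, hxy]
    have h2 := (hA.2 (WithLp.toLp 2 (x - y))).1
    rw [h1] at h2
    have h3 : ‖(WithLp.toLp 2 (x - y) : Eu n)‖ ^ 2 ≤ 0 := by
      by_contra hc; push Not at hc; nlinarith
    have h4 : (WithLp.toLp 2 (x - y) : Eu n) = 0 := by
      have : ‖(WithLp.toLp 2 (x - y) : Eu n)‖ = 0 := by nlinarith [norm_nonneg (WithLp.toLp 2 (x - y) : Eu n)]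
      exact norm_eq_zero.1 this
    have h5 : x - y = 0 := (WithLp.toLp_eq_zero 2).1 h4
    exact sub_eq_zero.1 h5
  have hu : IsUnit A := Matrix.mulVec_injective_iff_isUnit.1 hinj
  have hdet : IsUnit A.det := (Matrix.isUnit_iff_isUnit_det A).1 hu
  have hAP : A * A⁻¹ = 1 := Matrix.mul_nonsing_inv A hdet
  have hsym : (A⁻¹).IsSymm := by
    rw [Matrix.IsSymm, Matrix.transpose_nonsing_inv, hA.1.eq]
  refine ⟨A⁻¹, ⟨hsym, fun p => ?_⟩, hAP⟩
  set q := mv A⁻¹ p with hq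
  have hp : mv A q = p := by rw [hq, ← mv_mul, hAP, mv_one]
  have hm : mquad A⁻¹ p = mquad A q := by
    rw [mquad_eq_inner, mquad_eq_inner, hp, ← hq, real_inner_comm]
  rw [hm]
  have hnq : θ * ‖q‖ ^ 2 ≤ mquad A q := (hA.2 q).1
  have hmle : mquad A q ≤ ‖q‖ * ‖p‖ := by
    rw [mquad_eq_inner, hp]; exact real_inner_le_norm q p
  constructor
  · have h1 := cauchy_mquad hA.1 hpos p q
    rw [hp, real_inner_self_eq_norm_sq] at h1
    have h2 := (hA.2 p).2
    rcases eq_or_lt_of_le (norm_nonneg p) with h0 | h0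
    · rw [← h0]; simpa using hpos q
    have h3 : (‖p‖ ^ 2) ^ 2 ≤ (θ⁻¹ * ‖p‖ ^ 2) * mquad A q :=
      h1.trans (mul_le_mul_of_nonneg_right h2 (hpos q))
    have h4 : ‖p‖ ^ 2 * ‖p‖ ^ 2 ≤ ‖p‖ ^ 2 * (θ⁻¹ * mquad A q) := by nlinarith
    have h5 := le_of_mul_le_mul_left h4 (by positivity)
    have h6 := mul_le_mul_of_nonneg_left h5 hθ.le
    rwa [← mul_assoc, mul_inv_cancel₀ hθ.ne', one_mul] at h6
  · have h1 : θ * ‖q‖ ≤ ‖p‖ := by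
      by_contra hc
      push Not at hc
      have : 0 < ‖q‖ := by
        rcases eq_or_lt_of_le (norm_nonneg q) with h0 | h0
        · rw [← h0] at hc; simp at hc; exact absurd hc (not_lt.2 (norm_nonneg p))
        · exact h0
      nlinarith
    have h2 : ‖q‖ ≤ θ⁻¹ * ‖p‖ := by
      rw [inv_mul_eq_div, le_div_iff₀ hθ]; linarith
    calc mquad A q ≤ ‖q‖ * ‖p‖ := hmle
      _ ≤ θ⁻¹ * ‖p‖ * ‖p‖ := by gcongr
      _ = _ := by ring

theorem hasFDerivAt_gradient {φ : Eu n → ℝ} {x : Eu n} (h : ContDiffAt ℝ 2 φ x) :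
    HasFDerivAt (gradient φ) (mv (hessS φ x)) x := by
  rw [← hasFDerivWithinAt_univ, hasFDerivWithinAt_euclidean]
  intro i
  rw [hasFDerivWithinAt_univ]
  have h1 : DifferentiableAt ℝ (fun y => gradient φ y i) x := by
    simp only [gradient_apply']
    exact (dfd h).clm_apply (by fun_prop)
  have h2 := h1.hasFDerivAt
  refine h2.congr_fderiv ?_
  ext p
  rw [hasFDerivAt_gradient_apply h]
  rfl

theorem quad_C2 (P : Matrix (Fin n) (Fin n) ℝ) (c : ℝ) (y : Eu n) :
    ContDiff ℝ 2 (fun z => c * mquad P (z - y)) := by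
  simp only [mquad_eq_inner]
  exact contDiff_const.mul ((contDiff_id.sub contDiff_const).inner ℝ
    ((mv P).contDiff.comp (contDiff_id.sub contDiff_const)))

theorem quad_gradient {P : Matrix (Fin n) (Fin n) ℝ} (hP : P.IsSymm) (c : ℝ) (y x : Eu n) :
    gradient (fun z => c * mquad P (z - y)) x = (2 * c) • mv P (x - y) := by
  apply HasGradientAt.gradient
  rw [hasGradientAt_iff_hasFDerivAt]
  have h1 : HasFDerivAt (fun z : Eu n => z - y) (ContinuousLinearMap.id ℝ (Eu n)) x :=
    (hasFDerivAt_id x).sub_const y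
  have h2 := (h1.inner ℝ ((mv P).hasFDerivAt.comp x h1)).const_mul c
  simp only [mquad_eq_inner]
  refine h2.congr_fderiv ?_
  ext p
  have e1 := inner_mv_symm hP p x
  have e2 := inner_mv_symm hP p y
  have e3 := inner_mv_symm hP x p
  have e4 := inner_mv_symm hP y p
  have e5 := real_inner_comm p (mv P x)
  have e6 := real_inner_comm p (mv P y)
  have e7 := real_inner_comm (mv P p) x
  have e8 := real_inner_comm (mv P p) y
  simp [inner_sub_left, inner_sub_right, inner_smul_left]
  linear_combination c * e3 - c * e4 - c * e5 + c * e6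

theorem quad_hess {P : Matrix (Fin n) (Fin n) ℝ} (hP : P.IsSymm) (c : ℝ) (y x : Eu n) :
    hessS (fun z => c * mquad P (z - y)) x = (2 * c) • P := by
  ext i j
  unfold hessS
  have e : (fun z => gradient (fun z => c * mquad P (z - y)) z i) =
      fun z => (EuclideanSpace.proj i : Eu n →L[ℝ] ℝ) ((2 * c) • mv P (z - y)) := by
    ext z; rw [quad_gradient hP]; rfl
  rw [e]
  have h1 : HasFDerivAt (fun z : Eu n => z - y) (ContinuousLinearMap.id ℝ (Eu n)) x :=
    (hasFDerivAt_id x).sub_const y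
  have h2 := ((EuclideanSpace.proj i : Eu n →L[ℝ] ℝ).hasFDerivAt.comp x
    (((mv P).hasFDerivAt.comp x h1).const_smul (2 * c)))
  have h3 := h2.fderiv
  simp only [Function.comp_def] at h3
  erw [h3]
  simp [mv_apply, Pi.single_apply]

end Part6

section Part7

/-! ### Sliding paraboloids -/

theorem touch {n : ℕ} (hn : 0 < n) {θ ε η η2 K wt s : ℝ} (hθ : 0 < θ) (hε : 0 < ε) (hK : 0 < K)
    (hη1 : η < 1) {w : Eu n → ℝ} {x y q : Eu n}
    {α0 P A : Matrix (Fin n) (Fin n) ℝ} (hw : ContDiffAt ℝ 2 w x)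
    (hmin : IsLocalMin (fun z => w z + K / 2 * mquad P (z - y)) x) (hα : memS θ α0) (hP : memS θ P)
    (hαP : α0 * P = 1) (hA : memS θ A) (hlo : ∀ p : Eu n, (1 - η) * mquad α0 p ≤ mquad A p)
    (hhi : ∀ p : Eu n, mquad A p ≤ (1 + η) * mquad α0 p) (hwt : wt = Lop ε A q w x)
    (hq : ‖q‖ * ‖x - y‖ ≤ θ * η2 * ε) (hs : wt / (ε * K) + η2 + n * η ≤ s) :
    x + K⁻¹ • mv α0 (gradient w x) = y ∧
    HasFDerivAt (fun z => z + K⁻¹ • mv α0 (gradient w z))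
      (mv (K⁻¹ • (α0 * (hessS w x + K • P)))) x ∧
    |(mv (K⁻¹ • (α0 * (hessS w x + K • P)))).det| ≤ ((1 - η)⁻¹) ^ n * Real.exp s := by
  set Z := hessS w x + K • P with hZ
  have hqc := (quad_C2 P (K / 2) y).contDiffAt (x := x)
  have e2 : 2 * (K / 2) = K := by ring
  have hgq := quad_gradient hP.1 (K / 2) y x
  have hhq := quad_hess hP.1 (K / 2) y x
  rw [e2] at hgq hhq
  have hg : gradient w x = -(K • mv P (x - y)) := by
    have h0 := hmin.fderiv_eq_zero
    rw [fderiv_fun_add (hw.differentiableAt (by norm_num)) (hqc.differentiableAt (by norm_num))] at h0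
    rw [eq_neg_iff_add_eq_zero, ← hgq]
    unfold gradient
    rw [← map_add, h0, map_zero]
  have hαPv : ∀ v : Eu n, mv α0 (mv P v) = v := fun v => by rw [← mv_mul, hαP, mv_one]
  have hZs : Z.IsSymm := by
    rw [hZ, Matrix.IsSymm, Matrix.transpose_add, Matrix.transpose_smul, (hess_symm hw).eq, hP.1.eq]
  have hZp : ∀ p : Eu n, 0 ≤ mquad Z p := by
    intro p
    have hm : IsLocalMax (fun z => -1 * (w z + K / 2 * mquad P (z - y))) x := by
      have := hmin.neg
      simpa only [neg_mul, one_mul] using this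
    have := hess_nonpos_of_max (contDiffAt_const.mul (hw.add hqc)) hm p
    rw [hess_const_mul _ (hw.add hqc), hess_add hw hqc, hhq, mquad_smul] at this
    linarith
  have hαp : ∀ p : Eu n, 0 ≤ mquad α0 p := fun p => le_trans (by positivity) (hα.2 p).1
  have hAp : ∀ p : Eu n, 0 ≤ mquad A p := fun p => le_trans (by positivity) (hA.2 p).1
  have hnn : (0:ℝ) < n := by exact_mod_cast hn
  refine ⟨?_, ?_, ?_⟩
  · rw [hg, map_neg, map_smul, hαPv, smul_neg, smul_smul, inv_mul_cancel₀ hK.ne', one_smul]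
    abel
  · have h1 := (hasFDerivAt_id x).add (((mv α0).hasFDerivAt.comp x (hasFDerivAt_gradient hw)).const_smul K⁻¹)
    refine h1.congr_fderiv ?_
    ext1 p
    rw [hZ, Matrix.mul_add, Matrix.mul_smul, hαP, smul_add, smul_smul, inv_mul_cancel₀ hK.ne', one_smul]
    have e : ∀ (X Y : Matrix (Fin n) (Fin n) ℝ), mv (X + Y) = mv X + mv Y := fun X Y => by
      unfold mv; rw [map_add]
    have e' : ∀ (c : ℝ) (X : Matrix (Fin n) (Fin n) ℝ), mv (c • X) = c • mv X := fun c X => by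
      unfold mv; rw [map_smul]
    rw [e, e']
    simp only [ContinuousLinearMap.add_apply, ContinuousLinearMap.smul_apply, mv_mul, mv_one]
    rw [add_comm]; rfl
  · rw [mv_det]
    have e : (K⁻¹ • (α0 * Z)) = α0 * (K⁻¹ • Z) := by rw [Matrix.mul_smul]
    have hKi : 0 < K⁻¹ := by positivity
    obtain ⟨d1, d2⟩ := det_mul_le (A := α0) (Z := K⁻¹ • Z) hn hα.1 hαp
      (by rw [Matrix.IsSymm, Matrix.transpose_smul, hZs.eq])
      (fun p => by rw [mquad_smul]; exact mul_nonneg hKi.le (hZp p))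
    rw [e, abs_of_nonneg d1]
    refine d2.trans ?_
    rw [trMul_smul]
    -- trace estimates
    have t1 : (1 - η) * trMul α0 Z ≤ trMul A Z := by
      have := trMul_nonneg (A := Z) (H := A - (1 - η) • α0) hZs hZp
        (fun p => by rw [mquad_sub, mquad_smul]; linarith [hlo p])
      rw [trMul_sub, trMul_smul, trMul_comm Z A, trMul_comm Z α0] at this
      linarith
    have t2 : trMul A P ≤ (1 + η) * n := by
      have := trMul_nonneg (A := P) (H := (1 + η) • α0 - A) hP.1
        (fun p => le_trans (by positivity) (hP.2 p).1)
        (fun p => by rw [mquad_sub, mquad_smul]; linarith [hhi p])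
      rw [trMul_sub, trMul_smul, trMul_comm P A, trMul_comm P α0, trMul_eq_trace α0, hαP] at this
      simp at this
      linarith
    have t3 : -(K * η2 * ε) ≤ dotp q (gradient w x) := by
      rw [hg, dotp_eq_inner, inner_neg_right, inner_smul_right]
      have a1 := real_inner_le_norm q (mv P (x - y))
      have a2 := mv_norm_le hθ hP (x - y)
      have a3 : ‖q‖ * ‖mv P (x - y)‖ ≤ ‖q‖ * (θ⁻¹ * ‖x - y‖) := by gcongr
      have a4 : ‖q‖ * (θ⁻¹ * ‖x - y‖) ≤ η2 * ε := by
        have := mul_le_mul_of_nonneg_left hq (inv_pos.2 hθ).le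
        have e : θ⁻¹ * (θ * η2 * ε) = η2 * ε := by field_simp
        rw [e] at this
        linarith
      have a5 : K * inner ℝ q (mv P (x - y)) ≤ K * (η2 * ε) :=
        mul_le_mul_of_nonneg_left (a1.trans (a3.trans a4)) hK.le
      linarith
    have t4 : trMul A Z = trMul A (hessS w x) + K * trMul A P := by
      rw [hZ, trMul_add, trMul_smul]
    have t5 : wt = ε * trMul A (hessS w x) + dotp q (gradient w x) := hwt
    have t6 : 0 ≤ trMul A Z := trMul_nonneg hA.1 hAp hZp
    have t7 : ε * trMul A Z ≤ ε * K * (n + s) := by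
      have h1 : wt / (ε * K) ≤ s - η2 - n * η := by linarith
      rw [div_le_iff₀ (by positivity)] at h1
      have h2 : K * trMul A P ≤ K * ((1 + η) * n) := mul_le_mul_of_nonneg_left t2 hK.le
      have h3 := mul_le_mul_of_nonneg_left h2 hε.le
      rw [t4]
      nlinarith
    have t8 : trMul A Z ≤ K * (n + s) := by
      have : ε * trMul A Z ≤ ε * (K * (n + s)) := by linarith
      exact le_of_mul_le_mul_left this hε
    have t9 : K⁻¹ * trMul A Z / n ≤ 1 + s / n := by
      rw [div_le_iff₀ hnn, inv_mul_le_iff₀ hK]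
      have : (1 + s / n) * n = n + s := by field_simp
      rw [this]; exact t8
    have h1η : 0 < 1 - η := by linarith
    have t10 : K⁻¹ * trMul α0 Z / n ≤ (1 - η)⁻¹ * (K⁻¹ * trMul A Z / n) := by
      have : trMul α0 Z ≤ (1 - η)⁻¹ * trMul A Z := by
        rw [inv_mul_eq_div, le_div_iff₀ h1η]; linarith
      calc K⁻¹ * trMul α0 Z / n ≤ K⁻¹ * ((1 - η)⁻¹ * trMul A Z) / n := by gcongr
        _ = _ := by ring
    have t11 : 0 ≤ K⁻¹ * trMul A Z / n := by positivity
    have t0 : 0 ≤ trMul α0 Z := trMul_nonneg hα.1 hαp hZp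
    calc (K⁻¹ * trMul α0 Z / n) ^ n ≤ ((1 - η)⁻¹ * (K⁻¹ * trMul A Z / n)) ^ n := by gcongr
      _ = (1 - η)⁻¹ ^ n * (K⁻¹ * trMul A Z / n) ^ n := by rw [mul_pow]
      _ ≤ (1 - η)⁻¹ ^ n * (Real.exp (s / n)) ^ n := by
          gcongr
          have := Real.add_one_le_exp (s / n)
          linarith
      _ = _ := by
          rw [← Real.exp_nat_mul]; congr 2; field_simp

theorem inf_conv {P : Matrix (Fin n) (Fin n) ℝ} {B : Set (Eu n)} (hB : IsCompact B) (hne : B.Nonempty)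
    {v : Eu n → ℝ} (hv : ContinuousOn v B) (c : ℝ) :
    ∃ m : Eu n → ℝ, Continuous m ∧ (∀ y, ∃ x ∈ B, m y = v x + c * mquad P (x - y)) ∧
      ∀ y, ∀ x ∈ B, m y ≤ v x + c * mquad P (x - y) := by
  haveI : CompactSpace B := isCompact_iff_compactSpace.1 hB
  haveI : Nonempty B := hne.to_subtype
  have hq : Continuous (mquad P) := by
    have : (mquad P) = fun x : Eu n => inner ℝ x (mv P x) := by ext x; exact mquad_eq_inner P x
    rw [this]; fun_prop
  have hv' : Continuous (fun x : B => v x) := continuousOn_iff_continuous_restrict.1 hv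
  set F : Eu n → B → ℝ := fun y x => v x + c * mquad P (x - y) with hF
  have hFc : Continuous ↿F := by
    have : ↿F = fun p : Eu n × B => v p.2 + c * mquad P (p.2 - p.1) := rfl
    rw [this]
    exact (hv'.comp continuous_snd).add (continuous_const.mul (hq.comp
      ((continuous_subtype_val.comp continuous_snd).sub continuous_fst)))
  refine ⟨fun y => sInf (F y '' univ), IsCompact.continuous_sInf isCompact_univ hFc, ?_, ?_⟩
  · intro y
    have hFy : Continuous (F y) := hFc.comp (Continuous.prodMk_right y)
    obtain ⟨x, -, hx⟩ := isCompact_univ.exists_sInf_image_eq univ_nonempty hFy.continuousOn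
    exact ⟨x, x.2, hx⟩
  · intro y x hx
    have hFy : Continuous (F y) := hFc.comp (Continuous.prodMk_right y)
    exact csInf_le (isCompact_univ.image hFy).bddBelow ⟨⟨x, hx⟩, mem_univ _, rfl⟩

end Part7

section Part8

open MeasureTheory in
set_option maxHeartbeats 1000000 in
/-- sliding at one time -/
theorem slide_step {n : ℕ} (hn : 0 < n) {Ω : Set (Eu n)} {b : Eu n → Eu n} {θ ε C r b₀ Lb : ℝ}
    (h : BD Ω b θ ε C r b₀ Lb) {A : Eu n → ℝ → Matrix (Fin n) (Fin n) ℝ}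
    {w : Eu n → ℝ → ℝ} {C' : ℝ} (hw : LS Ω b θ ε C' A w) {l δ ρ η η2 η3 K t τ : ℝ} (hl : 0 < l)
    (hl2 : l ^ 2 = ε) (hlr : 2 * l ≤ r) (hδ : 0 < δ) (hρ : 0 < ρ) (hρ1 : 2 * ρ / θ < 1)
    (hη : 0 ≤ η) (hη1 : η < 1) (hη2 : η2 = 2 * Lb * (2 * ρ / θ) / θ)
    (hK : K = 2 * δ * θ / (ρ ^ 2 * ε)) (hθ1 : θ ≤ 1) (ht : 0 < t) (hτ : 0 < τ)
    {α0 P : Matrix (Fin n) (Fin n) ℝ} (hα : memS θ α0) (hP : memS θ P) (hαP : α0 * P = 1)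
    (hsand : ∀ x ∈ closedBall (0 : Eu n) (2 * l), w x t ≤ 2 * δ →
      (∀ p : Eu n, (1 - η) * mquad α0 p ≤ mquad (A x t) p) ∧
      (∀ p : Eu n, mquad (A x t) p ≤ (1 + η) * mquad α0 p))
    (hpos : ∀ x ∈ closedBall (0 : Eu n) (2 * l), 0 ≤ w x t)
    (hmean : ∀ x ∈ closedBall (0 : Eu n) (2 * l),
      tD w x t ≤ (w x t - w x (t - τ)) / τ + η3 * (ε * K))
    {m m' : Eu n → ℝ} (hmc : Continuous m) (hmc' : Continuous m')
    (hm1 : ∀ y, ∃ x ∈ closedBall (0 : Eu n) (2 * l), m y = w x t + K / 2 * mquad P (x - y))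
    (hm2 : ∀ y, ∀ x ∈ closedBall (0 : Eu n) (2 * l), m y ≤ w x t + K / 2 * mquad P (x - y))
    (hm2' : ∀ y, ∀ x ∈ closedBall (0 : Eu n) (2 * l), m' y ≤ w x (t - τ) + K / 2 * mquad P (x - y))
    (hclose : ∀ y ∈ closedBall (0 : Eu n) l, ∃ x, ‖x - y‖ ≤ ρ * l ∧ w x t ≤ δ) :
    (∀ y ∈ closedBall (0 : Eu n) l, m y ≤ 2 * δ) ∧
    ∫ y in closedBall (0 : Eu n) l, (1 - ((m y - m' y) / (τ * (ε * K)) + η3 + η2 + n * η)) ≤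
      ((1 - η)⁻¹) ^ n * volume.real {x ∈ closedBall (0 : Eu n) ((1 + 2 * ρ / θ) * l) | w x t ≤ 2 * δ} := by
  have hθ := h.hθ
  have hε := h.hε
  have hKp : 0 < K := by rw [hK]; positivity
  have hρθ : ρ ≤ 1 := by
    rw [div_lt_one hθ] at hρ1; linarith
  set B := closedBall (0 : Eu n) (2 * l) with hB
  have hBΩ : B ⊆ Ω := (closedBall_subset_closedBall hlr).trans h.sub
  have hKρ : K / 2 * (θ⁻¹ * (ρ * l) ^ 2) = δ := by
    rw [hK, mul_pow, hl2]; field_simp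
  have hm3 : ∀ y ∈ closedBall (0 : Eu n) l, m y ≤ 2 * δ := by
    intro y hy
    obtain ⟨x, hx, hxw⟩ := hclose y hy
    have hxB : x ∈ B := by
      rw [hB, mem_closedBall_zero_iff]
      rw [mem_closedBall_zero_iff] at hy
      have : ‖x‖ ≤ ‖x - y‖ + ‖y‖ := by simpa using norm_add_le (x - y) y
      nlinarith
    refine (hm2 y x hxB).trans ?_
    have h1 := (hP.2 (x - y)).2
    have h2 : θ⁻¹ * ‖x - y‖ ^ 2 ≤ θ⁻¹ * (ρ * l) ^ 2 := by gcongr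
    have h3 := mul_le_mul_of_nonneg_left (h1.trans h2) (by positivity : 0 ≤ K / 2)
    linarith
  refine ⟨hm3, ?_⟩
  -- contact set
  set V := closedBall (0 : Eu n) l with hV
  set T : Set (Eu n × Eu n) := {p ∈ B ×ˢ V | w p.1 t + K / 2 * mquad P (p.1 - p.2) ≤ m p.2} with hT
  have hBc : IsCompact B := isCompact_closedBall _ _
  have hVc : IsCompact V := isCompact_closedBall _ _
  have hq : Continuous (mquad P) := by
    have : (mquad P) = fun x : Eu n => inner ℝ x (mv P x) := by ext x; exact mquad_eq_inner P x
    rw [this]; fun_prop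
  have hwc : ContinuousOn (fun x => w x t) B := fun x hx =>
    (hw.c2 x (hBΩ hx) t ht).continuousAt.continuousWithinAt
  have hTc : IsCompact T := by
    have hcl : IsClosed (B ×ˢ V) := (hBc.prod hVc).isClosed
    have h1 : ContinuousOn (fun p : Eu n × Eu n => m p.2 - (w p.1 t + K / 2 * mquad P (p.1 - p.2)))
        (B ×ˢ V) := by
      refine ((hmc.comp continuous_snd).continuousOn).sub (ContinuousOn.add ?_ ?_)
      · exact hwc.comp continuous_fst.continuousOn (fun p hp => hp.1)
      · exact (continuous_const.mul (hq.comp (continuous_fst.sub continuous_snd))).continuousOn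
    have h2 := h1.preimage_isClosed_of_isClosed hcl (isClosed_Ici (a := (0:ℝ)))
    refine (hBc.prod hVc).of_isClosed_subset (t := T) ?_ (fun p hp => hp.1)
    convert h2 using 1
    ext p
    simp [hT]
  have hAc : IsCompact (Prod.fst '' T) := hTc.image continuous_fst
  -- properties of contact points
  have hcon : ∀ x y, (x, y) ∈ T → w x t ≤ 2 * δ ∧ ‖x - y‖ ≤ 2 * ρ / θ * l ∧
      ‖x‖ ≤ (1 + 2 * ρ / θ) * l ∧ ‖x‖ < 2 * l := by
    intro x y hxy
    have hxB : x ∈ B := hxy.1.1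
    have hyV : y ∈ V := hxy.1.2
    have h1 : w x t + K / 2 * mquad P (x - y) ≤ 2 * δ := hxy.2.trans (hm3 y hyV)
    have h2 := (hP.2 (x - y)).1
    have h3 : 0 ≤ mquad P (x - y) := le_trans (by positivity) h2
    have h4 := hpos x hxB
    have h5 : 0 ≤ K / 2 * mquad P (x - y) := by positivity
    have h6 : K / 2 * (θ * ‖x - y‖ ^ 2) ≤ 2 * δ :=
      (mul_le_mul_of_nonneg_left h2 (by positivity)).trans (by linarith)
    have h7 : ‖x - y‖ ^ 2 ≤ (2 * ρ / θ * l) ^ 2 := by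
      have e : K / 2 * (θ * ‖x - y‖ ^ 2) = δ * θ ^ 2 / (ρ ^ 2 * ε) * ‖x - y‖ ^ 2 := by
        rw [hK]; ring
      rw [e, div_mul_eq_mul_div, div_le_iff₀ (by positivity)] at h6
      have h8 : δ * (θ ^ 2 * ‖x - y‖ ^ 2) ≤ δ * (2 * (ρ ^ 2 * ε)) := by linarith
      have h9 := le_of_mul_le_mul_left h8 hδ
      rw [mul_pow, hl2, div_pow, div_mul_eq_mul_div, le_div_iff₀ (by positivity)]
      nlinarith [mul_pos (pow_pos hρ 2) hε]
    have h8 : ‖x - y‖ ≤ 2 * ρ / θ * l := by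
      exact abs_le_of_sq_le_sq' h7 (by positivity) |>.2
    rw [hV, mem_closedBall_zero_iff] at hyV
    have : ‖x‖ ≤ ‖x - y‖ + ‖y‖ := by simpa using norm_add_le (x - y) y
    refine ⟨by linarith, h8, by linarith, ?_⟩
    have : 2 * ρ / θ * l < 1 * l := by gcongr
    linarith
  have hsub : Prod.fst '' T ⊆ {x ∈ closedBall (0 : Eu n) ((1 + 2 * ρ / θ) * l) | w x t ≤ 2 * δ} := by
    rintro x ⟨⟨x', y⟩, hxy, rfl⟩
    obtain ⟨h1, h2, h3, h4⟩ := hcon x' y hxy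
    exact ⟨by rwa [mem_closedBall_zero_iff], h1⟩
  have hG : Continuous fun y => (m y - m' y) / (τ * (ε * K)) + η3 + η2 + n * η := by fun_prop
  have hkey : ∀ x y, (x, y) ∈ T → x + K⁻¹ • mv α0 (gradient (fun z => w z t) x) = y ∧
    HasFDerivAt (fun z => z + K⁻¹ • mv α0 (gradient (fun z => w z t) z))
      (mv (K⁻¹ • (α0 * (hessS (fun z => w z t) x + K • P)))) x ∧
    |(mv (K⁻¹ • (α0 * (hessS (fun z => w z t) x + K • P)))).det| ≤
      ((1 - η)⁻¹) ^ n * Real.exp ((m y - m' y) / (τ * (ε * K)) + η3 + η2 + n * η) := by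
    intro x y hxy
    have hxB : x ∈ B := hxy.1.1
    obtain ⟨h1, h2, h3, h4⟩ := hcon x y hxy
    have hmem : B ∈ 𝓝 x := by
      refine mem_of_superset (isOpen_ball.mem_nhds ?_) ball_subset_closedBall
      rwa [mem_ball_zero_iff]
    have hmin : IsLocalMin (fun z => w z t + K / 2 * mquad P (z - y)) x := by
      filter_upwards [hmem] with z hz
      exact hxy.2.trans (hm2 y z hz)
    obtain ⟨s1, s2⟩ := hsand x hxB h1
    refine touch hn hθ hε hKp hη1 (hw.c2 x (hBΩ hxB) t ht) hmin hα hP hαP (hw.mem x (hBΩ hxB) t ht) s1 s2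
      (hw.eq x (hBΩ hxB) t ht) (η2 := η2) ?_ ?_
    · have hbx := h.lip x
      calc ‖b x‖ * ‖x - y‖ ≤ (Lb * (2 * l)) * (2 * ρ / θ * l) := by
            have := h.hLb
            have h5 : ‖b x‖ ≤ Lb * (2 * l) := hbx.trans (by gcongr)
            gcongr
        _ = θ * η2 * ε := by rw [hη2, ← hl2]; field_simp
    · have h5 := hmean x hxB
      have h6 := hm2' y x hxB
      have h7 : w x t - w x (t - τ) ≤ m y - m' y := by
        have : w x t + K / 2 * mquad P (x - y) ≤ m y := hxy.2
        linarith
      have h8 : tD w x t ≤ (m y - m' y) / τ + η3 * (ε * K) :=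
        h5.trans (by gcongr)
      have h9 : tD w x t / (ε * K) ≤ (m y - m' y) / (τ * (ε * K)) + η3 := by
        rw [div_le_iff₀ (by positivity)]
        refine h8.trans (le_of_eq ?_)
        field_simp
      linarith
  have harea := area_ineq (A := Prod.fst '' T) (V := V) hAc hVc
    (f := fun z => z + K⁻¹ • mv α0 (gradient (fun z => w z t) z))
    (f' := fun x => mv (K⁻¹ • (α0 * (hessS (fun z => w z t) x + K • P))))
    (by rintro x ⟨⟨x', y⟩, hxy, rfl⟩; exact (hkey x' y hxy).2.1)
    (by
      intro y hy
      obtain ⟨x, hx, he⟩ := hm1 y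
      have hxy : (x, y) ∈ T := ⟨⟨hx, hy⟩, he.ge⟩
      exact ⟨x, ⟨(x, y), hxy, rfl⟩, (hkey x y hxy).1⟩)
    hG (c := ((1 - η)⁻¹) ^ n) (by have : 0 < 1 - η := by linarith
                                  positivity)
    (by
      rintro x ⟨⟨x', y⟩, hxy, rfl⟩
      have := hkey x' y hxy
      simp only at this ⊢
      rw [this.1]; exact this.2.2)
  refine harea.trans ?_
  have : 0 < 1 - η := by linarith
  gcongr
  exact measure_ne_top_of_subset (fun x hx => hx.1) (isCompact_closedBall (0 : Eu n) ((1 + 2 * ρ / θ) * l)).measure_lt_top.ne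

end Part8

section Part9

/-- uniform backward difference quotients -/
theorem back_diff {Ω : Set (Eu n)} {b : Eu n → Eu n} {θ ε C' : ℝ}
    {A : Eu n → ℝ → Matrix (Fin n) (Fin n) ℝ} {w : Eu n → ℝ → ℝ} (hw : LS Ω b θ ε C' A w)
    {B : Set (Eu n)} (hB : IsCompact B) (hBΩ : B ⊆ Ω) {t0 e : ℝ} (ht0 : 0 < t0) (he : 0 < e) :
    ∃ d > 0, ∀ τ, 0 < τ → τ < d → ∀ t, t0 + τ ≤ t → t ≤ t0 + 1 → ∀ x ∈ B,
      tD w x t ≤ (w x t - w x (t - τ)) / τ + e := by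
  have hsub : B ×ˢ Icc t0 (t0 + 1) ⊆ Ω ×ˢ Ioi 0 :=
    prod_mono hBΩ (fun t ht => lt_of_lt_of_le ht0 ht.1)
  have huc := (hB.prod isCompact_Icc).uniformContinuousOn_of_continuous (hw.tcont.mono hsub)
  rw [Metric.uniformContinuousOn_iff] at huc
  obtain ⟨d, hd, hdd⟩ := huc e he
  refine ⟨d, hd, fun τ hτ hτd t ht1 ht2 x hx => ?_⟩
  have hlt : t - τ < t := by linarith
  obtain ⟨s, hs, hse⟩ := exists_hasDerivAt_eq_slope (w x) (fun s => tD w x s) hlt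
    (fun s hs => (hw.dt x (hBΩ hx) s (by linarith [hs.1])).continuousAt.continuousWithinAt)
    (fun s hs => hw.dt x (hBΩ hx) s (by linarith [hs.1]))
  have h1 := hdd (x, t) ⟨hx, by constructor <;> linarith⟩ (x, s)
    ⟨hx, by constructor <;> linarith [hs.1, hs.2]⟩ (by
      rw [Prod.dist_eq, dist_self, Real.dist_eq, abs_of_pos (by linarith [hs.2])]
      exact max_lt hd (by linarith [hs.1]))
  rw [Real.dist_eq, abs_lt] at h1
  have e1 : t - (t - τ) = τ := by ring
  rw [e1] at hse
  simp only at h1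
  rw [← hse]; linarith [h1.2]

open MeasureTheory in
set_option maxHeartbeats 1000000 in
theorem slide_main {n : ℕ} (hn : 0 < n) {Ω : Set (Eu n)} {b : Eu n → Eu n} {θ ε C r b₀ Lb : ℝ}
    (h : BD Ω b θ ε C r b₀ Lb) {A : Eu n → ℝ → Matrix (Fin n) (Fin n) ℝ}
    {w : Eu n → ℝ → ℝ} {C' : ℝ} (hw : LS Ω b θ ε C' A w) {l δ ρ η η2 η3 t0 : ℝ} (hl : 0 < l)
    (hl2 : l ^ 2 = ε) (hlr : 2 * l ≤ r) (hδ : 0 < δ) (hρ : 0 < ρ) (hρ1 : 2 * ρ / θ < 1)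
    (hη : 0 ≤ η) (hη1 : η < 1) (hη2 : η2 = 2 * Lb * (2 * ρ / θ) / θ) (hη3 : 0 < η3)
    (hθ1 : θ ≤ 1) (ht0 : 0 < t0)
    {α0 : Matrix (Fin n) (Fin n) ℝ} (hα : memS θ α0)
    (hsand : ∀ t ∈ Icc t0 (t0 + 1), ∀ x ∈ closedBall (0 : Eu n) (2 * l), w x t ≤ 2 * δ →
      (∀ p : Eu n, (1 - η) * mquad α0 p ≤ mquad (A x t) p) ∧
      (∀ p : Eu n, mquad (A x t) p ≤ (1 + η) * mquad α0 p))
    (hpos : ∀ t ∈ Icc t0 (t0 + 1), ∀ x ∈ closedBall (0 : Eu n) (2 * l), 0 ≤ w x t)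
    (hclose : ∀ t ∈ Icc t0 (t0 + 1), ∀ y ∈ closedBall (0 : Eu n) l, ∃ x, ‖x - y‖ ≤ ρ * l ∧ w x t ≤ δ) :
    ∃ N0 : ℕ, ∀ N ≥ N0, 0 < N → 
      N * ((1 - η) ^ n * volume.real (closedBall (0 : Eu n) l) * (1 - (η3 + η2 + n * η) - ρ ^ 2 / θ)) ≤
      ∑ j ∈ Finset.range N, volume.real
        {x ∈ closedBall (0 : Eu n) ((1 + 2 * ρ / θ) * l) | w x (t0 + (j + 1 : ℕ) * (1 / N : ℝ)) ≤ 2 * δ} := by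
  have hθ := h.hθ
  have hε := h.hε
  obtain ⟨K, hK⟩ : ∃ K, K = 2 * δ * θ / (ρ ^ 2 * ε) := ⟨_, rfl⟩
  have hKp : 0 < K := by rw [hK]; positivity
  obtain ⟨P, hP, hαP⟩ := exists_inv hθ hα
  have hBΩ : closedBall (0 : Eu n) (2 * l) ⊆ Ω := (closedBall_subset_closedBall hlr).trans h.sub
  have hm : ∀ t : ℝ, ∃ m : Eu n → ℝ, 0 < t → (Continuous m ∧
      (∀ y, ∃ x ∈ closedBall (0 : Eu n) (2 * l), m y = w x t + K / 2 * mquad P (x - y)) ∧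
      ∀ y, ∀ x ∈ closedBall (0 : Eu n) (2 * l), m y ≤ w x t + K / 2 * mquad P (x - y)) := by
    intro t
    by_cases ht : 0 < t
    · obtain ⟨m, hm⟩ := inf_conv (P := P) (B := closedBall (0 : Eu n) (2 * l)) (isCompact_closedBall _ _)
        ⟨0, by simp [hl.le]⟩ (v := fun x => w x t)
        (fun x hx => (hw.c2 x (hBΩ hx) t ht).continuousAt.continuousWithinAt) (K / 2)
      exact ⟨m, fun _ => hm⟩
    · exact ⟨fun _ => 0, fun h => absurd h ht⟩
  choose m hm using hm
  obtain ⟨d, hd, hback⟩ := back_diff hw (isCompact_closedBall (0 : Eu n) (2 * l)) hBΩ ht0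
    (e := η3 * (ε * K)) (by positivity)
  obtain ⟨N0, hN0⟩ := exists_nat_gt (1 / d)
  refine ⟨N0, fun N hN hNp => ?_⟩
  have hNp' : (0:ℝ) < N := by exact_mod_cast hNp
  set τ : ℝ := 1 / N with hτ
  have hτp : 0 < τ := by positivity
  have hτN : N * τ = 1 := by rw [hτ]; field_simp
  have hτd : τ < d := by
    rw [hτ, div_lt_iff₀ hNp']
    rw [div_lt_iff₀ hd] at hN0
    have : (N0 : ℝ) ≤ N := by exact_mod_cast hN
    nlinarith
  set V := closedBall (0 : Eu n) l with hV
  have hVc : IsCompact V := isCompact_closedBall _ _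
  have htime : ∀ j < N, t0 + τ ≤ t0 + ((j + 1 : ℕ) : ℝ) * τ ∧ t0 + ((j + 1 : ℕ) : ℝ) * τ ≤ t0 + 1 := by
    intro j hj
    have h1 : ((j + 1 : ℕ) : ℝ) ≤ N := by exact_mod_cast hj
    have h2 : (1 : ℝ) ≤ ((j + 1 : ℕ) : ℝ) := by exact_mod_cast Nat.succ_le_succ (Nat.zero_le j)
    constructor <;> nlinarith
  have hstep : ∀ j ∈ Finset.range N, 
      (∀ y ∈ V, m (t0 + ((j + 1 : ℕ) : ℝ) * τ) y ≤ 2 * δ) ∧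
      ∫ y in V, (1 - ((m (t0 + ((j + 1 : ℕ) : ℝ) * τ) y - m (t0 + (j : ℝ) * τ) y) / (τ * (ε * K)) + η3 + η2 + n * η)) ≤
      ((1 - η)⁻¹) ^ n * volume.real
        {x ∈ closedBall (0 : Eu n) ((1 + 2 * ρ / θ) * l) | w x (t0 + ((j + 1 : ℕ) : ℝ) * τ) ≤ 2 * δ} := by
    intro j hj
    obtain ⟨h1, h2⟩ := htime j (Finset.mem_range.1 hj)
    have htm : t0 + ((j + 1 : ℕ) : ℝ) * τ ∈ Icc t0 (t0 + 1) := ⟨by linarith, h2⟩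
    have hjt : 0 < t0 + (j : ℝ) * τ := by positivity
    have e1 : t0 + ((j + 1 : ℕ) : ℝ) * τ - τ = t0 + (j : ℝ) * τ := by push_cast; ring
    obtain ⟨a1, a2, a3⟩ := hm _ (by linarith : 0 < t0 + ((j + 1 : ℕ) : ℝ) * τ)
    obtain ⟨c1, c2, c3⟩ := hm _ hjt
    exact slide_step hn h hw hl hl2 hlr hδ hρ hρ1 hη hη1 hη2 hK hθ1 (by linarith) hτp hα hP hαP
      (hsand _ htm) (hpos _ htm) (fun x hx => hback τ hτp hτd _ h1 h2 x hx) a1 c1 a2 a3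
      (by rw [e1]; exact c3) (hclose _ htm)
  have hcj : ∀ j : ℕ, Continuous (m (t0 + (j : ℝ) * τ)) := fun j => (hm _ (by positivity)).1
  have hIj : ∀ j : ℕ, IntegrableOn (m (t0 + (j : ℝ) * τ)) V := fun j =>
    (hcj j).continuousOn.integrableOn_compact hVc
  have hVreal : ∫ y in V, (1 : ℝ) = volume.real V := by simp
  have hIntg : ∀ j : ℕ, ∫ y in V, (1 - ((m (t0 + ((j + 1 : ℕ) : ℝ) * τ) y - m (t0 + (j : ℝ) * τ) y) / (τ * (ε * K)) + η3 + η2 + n * η))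
      = (1 - (η3 + η2 + n * η)) * volume.real V -
        (τ * (ε * K))⁻¹ * (∫ y in V, m (t0 + ((j + 1 : ℕ) : ℝ) * τ) y) +
        (τ * (ε * K))⁻¹ * ∫ y in V, m (t0 + (j : ℝ) * τ) y := by
    intro j
    have i1 : IntegrableOn (fun _ : Eu n => (1 - (η3 + η2 + n * η))) V :=
      continuous_const.continuousOn.integrableOn_compact hVc
    have i2 := (hIj (j + 1)).const_mul (τ * (ε * K))⁻¹
    have i3 := (hIj j).const_mul (τ * (ε * K))⁻¹
    rw [← integral_const_mul, ← integral_const_mul]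
    have e0 : (1 - (η3 + η2 + n * η)) * volume.real V = ∫ y in V, (1 - (η3 + η2 + n * η)) := by
      rw [setIntegral_const, smul_eq_mul, mul_comm]
    have i12 : Integrable (fun y => (1 - (η3 + η2 + n * η)) - (τ * (ε * K))⁻¹ * m (t0 + ((j + 1 : ℕ) : ℝ) * τ) y)
      (volume.restrict V) := i1.sub i2
    rw [e0, ← integral_sub i1 i2, ← integral_add i12 i3]
    refine integral_congr_ae (Eventually.of_forall fun y => ?_)
    simp only
    ring
  have hsum : ∑ j ∈ Finset.range N, ∫ y in V, (1 - ((m (t0 + ((j + 1 : ℕ) : ℝ) * τ) y - m (t0 + (j : ℝ) * τ) y) / (τ * (ε * K)) + η3 + η2 + n * η))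
      = N * ((1 - (η3 + η2 + n * η)) * volume.real V) - (τ * (ε * K))⁻¹ * ((∫ y in V, m (t0 + (N : ℝ) * τ) y)
        - ∫ y in V, m (t0 + ((0 : ℕ) : ℝ) * τ) y) := by
    have := Finset.sum_range_sub (fun j : ℕ => ∫ y in V, m (t0 + (j : ℝ) * τ) y) N
    rw [← this, Finset.mul_sum]
    simp only [hIntg]
    rw [show (N : ℝ) * ((1 - (η3 + η2 + n * η)) * volume.real V) =
      ∑ j ∈ Finset.range N, ((1 - (η3 + η2 + n * η)) * volume.real V) by simp]
    rw [← Finset.sum_sub_distrib]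
    refine Finset.sum_congr rfl fun j _ => by ring
  have hN1 : ∃ j, N = j + 1 := ⟨N - 1, by omega⟩
  have hmN : ∫ y in V, m (t0 + (N : ℝ) * τ) y ≤ 2 * δ * volume.real V := by
    obtain ⟨j, rfl⟩ := hN1
    have := (hstep j (by simp)).1
    have h1 : ∫ y in V, m (t0 + ((j + 1 : ℕ) : ℝ) * τ) y ≤ ∫ y in V, 2 * δ :=
      setIntegral_mono_on (hIj (j + 1)) (continuous_const.continuousOn.integrableOn_compact hVc)
        hVc.isClosed.measurableSet this
    rw [setIntegral_const, smul_eq_mul] at h1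
    linarith
  have hm0 : 0 ≤ ∫ y in V, m (t0 + ((0 : ℕ) : ℝ) * τ) y := by
    refine setIntegral_nonneg hVc.isClosed.measurableSet fun y hy => ?_
    have : t0 + ((0 : ℕ) : ℝ) * τ = t0 := by simp
    rw [this]
    obtain ⟨x, hx, he⟩ := (hm t0 ht0).2.1 y
    rw [he]
    have h1 := hpos t0 ⟨le_rfl, by linarith⟩ x hx
    have h2 : 0 ≤ mquad P (x - y) := le_trans (by positivity) (hP.2 (x - y)).1
    positivity
  have hle := Finset.sum_le_sum fun j hj => (hstep j hj).2
  rw [hsum, ← Finset.mul_sum] at hle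
  set Sg := ∑ j ∈ Finset.range N, volume.real
        {x ∈ closedBall (0 : Eu n) ((1 + 2 * ρ / θ) * l) | w x (t0 + ((j + 1 : ℕ) : ℝ) * τ) ≤ 2 * δ} with hSg
  have h1η : 0 < 1 - η := by linarith
  have hfin : N * (volume.real V * (1 - (η3 + η2 + n * η) - ρ ^ 2 / θ)) ≤ (1 - η)⁻¹ ^ n * Sg := by
    refine le_trans ?_ hle
    have e1 : (τ * (ε * K))⁻¹ * (2 * δ * volume.real V) = N * (volume.real V * (ρ ^ 2 / θ)) := by
      rw [hK, hτ]; field_simp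
    have e2 : (τ * (ε * K))⁻¹ * ((∫ y in V, m (t0 + (N : ℝ) * τ) y)
        - ∫ y in V, m (t0 + ((0 : ℕ) : ℝ) * τ) y) ≤ (τ * (ε * K))⁻¹ * (2 * δ * volume.real V) := by
      refine mul_le_mul_of_nonneg_left (by linarith) (by positivity)
    rw [e1] at e2
    linarith
  have := mul_le_mul_of_nonneg_left hfin (by positivity : 0 ≤ (1 - η) ^ n)
  have e3 : (1 - η) ^ n * ((1 - η)⁻¹ ^ n * Sg) = Sg := by
    rw [← mul_assoc, ← mul_pow, mul_inv_cancel₀ h1η.ne', one_pow, one_mul]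
  rw [e3] at this
  refine le_trans (le_of_eq ?_) this
  ring

end Part9

section Part10

theorem LS.addconst {Ω : Set (Eu n)} {b : Eu n → Eu n} {θ ε C : ℝ}
    {A : Eu n → ℝ → Matrix (Fin n) (Fin n) ℝ} {u : Eu n → ℝ → ℝ} (h : LS Ω b θ ε C A u) (c : ℝ) :
    LS Ω b θ ε (|c| + C) A (fun x t => c + u x t) := by
  have htd : ∀ x t, tD (fun x t => c + u x t) x t = tD u x t := by
    intro x t; simp [tD]
  refine ⟨continuousOn_const.add h.cont, fun x hx t ht => contDiffAt_const.add (h.c2 x hx t ht),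
    fun x hx t ht => ?_, ?_, ?_, h.mem, ?_⟩
  · rw [htd]; exact (h.dt x hx t ht).const_add c
  · simp only [htd]; exact h.tcont
  · intro x hx t ht
    rw [htd, h.eq x hx t ht]
    rw [Lop_add contDiffAt_const (h.c2 x hx t ht)]
    rw [Lop_const, zero_add]
  · intro x hx t ht
    exact (abs_add_le _ _).trans (by linarith [h.bd x hx t ht])

structure Par (n : ℕ) (θ Lb ρ η η3 : ℝ) : Prop where
  hρ : 0 < ρ
  hρ1 : 2 * ρ / θ < 1
  hη : 0 < η
  hη1 : η < 1
  hη3 : 0 < η3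
  key : (1 + 2 * ρ / θ) ^ n <
    2 * ((1 - η) ^ n * (1 - (η3 + 2 * Lb * (2 * ρ / θ) / θ + n * η) - ρ ^ 2 / θ))

theorem par_exists (n : ℕ) {θ : ℝ} (hθ : 0 < θ) (Lb : ℝ) : ∃ ρ η η3, Par n θ Lb ρ η η3 := by
  have h1 : ∀ᶠ s : ℝ in 𝓝 0, (1 + 2 * s / θ) ^ n <
      2 * ((1 - s) ^ n * (1 - (s + 2 * Lb * (2 * s / θ) / θ + n * s) - s ^ 2 / θ)) := by
    apply Tendsto.eventually_lt (y := (1:ℝ)) (z := 2)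
    · have : Continuous fun s : ℝ => (1 + 2 * s / θ) ^ n := by fun_prop
      simpa using this.tendsto 0
    · have : Continuous fun s : ℝ =>
        2 * ((1 - s) ^ n * (1 - (s + 2 * Lb * (2 * s / θ) / θ + n * s) - s ^ 2 / θ)) := by fun_prop
      simpa using this.tendsto 0
    · norm_num
  have h2 : ∀ᶠ s : ℝ in 𝓝 0, 2 * s / θ < 1 := by
    have : Continuous fun s : ℝ => 2 * s / θ := by fun_prop
    have := this.tendsto 0
    simp only [mul_zero, zero_div] at this
    exact this.eventually_lt_const one_pos
  have h3 : ∀ᶠ s : ℝ in 𝓝 0, s < 1 := gt_mem_nhds one_pos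
  obtain ⟨s, hs, hs0⟩ := (((h1.and (h2.and h3)).filter_mono nhdsWithin_le_nhds).and
    (self_mem_nhdsWithin (a := (0:ℝ)) (s := Ioi 0))).exists
  exact ⟨s, s, s, hs0, hs.2.1, hs0, hs.2.2, hs0, hs.1⟩

open MeasureTheory in
set_option maxHeartbeats 1000000 in
theorem dicho {n : ℕ} (hn : 0 < n) {Ω : Set (Eu n)} {b : Eu n → Eu n} {θ ε C r b₀ Lb : ℝ}
    (h : BD Ω b θ ε C r b₀ Lb) {A : Eu n → ℝ → Matrix (Fin n) (Fin n) ℝ}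
    {u : Eu n → ℝ → ℝ} (hu : LS Ω b θ ε C A u) {l δ ρ η η3 t0 M1 N1 : ℝ} (hl : 0 < l)
    (hl2 : l ^ 2 = ε) (hlr : 2 * l ≤ r) (hδ : 0 < δ) (hpar : Par n θ Lb ρ η η3)
    (hθ1 : θ ≤ 1) (ht0 : 0 < t0) {d0 : ℝ} (hδd : 2 * δ ≤ d0) (hld : 2 * l ≤ d0)
    {a0 : ℝ → Matrix (Fin n) (Fin n) ℝ} (ha0 : ∀ c, memS θ (a0 c))
    (hmod : ∀ x : Eu n, ‖x‖ ≤ d0 → x ∈ Ω → ∀ t > 0, ∀ c, |u x t - c| ≤ d0 → ∀ p : Eu n,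
      |mquad (A x t) p - mquad (a0 c) p| ≤ η * θ * ‖p‖ ^ 2)
    (hup : ∀ t ∈ Icc t0 (t0 + 1), ∀ x ∈ closedBall (0 : Eu n) (2 * l), u x t ≤ M1)
    (hdn : ∀ t ∈ Icc t0 (t0 + 1), ∀ x ∈ closedBall (0 : Eu n) (2 * l), -u x t ≤ N1)
    (hMN : 4 * δ < M1 + N1) :
    ∃ t ∈ Icc t0 (t0 + 1), ∃ p : Eu n, ‖p‖ ≤ l ∧
      ((∀ x, ‖x - p‖ ≤ ρ * l → u x t ≤ M1 - δ) ∨ (∀ x, ‖x - p‖ ≤ ρ * l → -u x t ≤ N1 - δ)) := by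
  have hθ := h.hθ
  have hε := h.hε
  have hBΩ : closedBall (0 : Eu n) (2 * l) ⊆ Ω := (closedBall_subset_closedBall hlr).trans h.sub
  by_contra hcon
  push Not at hcon
  have hsand : ∀ t ∈ Icc t0 (t0 + 1), ∀ x ∈ closedBall (0 : Eu n) (2 * l), ∀ c, |u x t - c| ≤ d0 →
      (∀ p : Eu n, (1 - η) * mquad (a0 c) p ≤ mquad (A x t) p) ∧
      (∀ p : Eu n, mquad (A x t) p ≤ (1 + η) * mquad (a0 c) p) := by
    intro t ht x hx c hc
    have hx' : ‖x‖ ≤ d0 := by rw [mem_closedBall_zero_iff] at hx; linarith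
    have h1 := hmod x hx' (hBΩ hx) t (by linarith [ht.1]) c hc
    have h2 : ∀ p : Eu n, η * θ * ‖p‖ ^ 2 ≤ η * mquad (a0 c) p := fun p => by
      have := mul_le_mul_of_nonneg_left ((ha0 c).2 p).1 hpar.hη.le
      linarith
    constructor <;> intro p <;> have h3 := abs_le.1 (h1 p) <;> have h4 := h2 p
    · linarith [h3.1]
    · linarith [h3.2]
  obtain ⟨N0, hN0⟩ := slide_main hn h (hu.neg.addconst M1) hl hl2 hlr hδ hpar.hρ hpar.hρ1 hpar.hη.le
    hpar.hη1 rfl hpar.hη3 hθ1 ht0 (ha0 M1)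
    (fun t ht x hx hw => hsand t ht x hx M1 (by
      have := hup t ht x hx
      rw [abs_le]; constructor <;> linarith))
    (fun t ht x hx => by have := hup t ht x hx; linarith)
    (fun t ht y hy => by
      obtain ⟨x, hx, hx2⟩ := (hcon t ht y (by rwa [mem_closedBall_zero_iff] at hy)).1
      exact ⟨x, hx, by linarith⟩)
  obtain ⟨N0', hN0'⟩ := slide_main hn h (hu.addconst N1) hl hl2 hlr hδ hpar.hρ hpar.hρ1 hpar.hη.le
    hpar.hη1 rfl hpar.hη3 hθ1 ht0 (ha0 (-N1))
    (fun t ht x hx hw => hsand t ht x hx (-N1) (by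
      have := hdn t ht x hx
      rw [abs_le]; constructor <;> linarith))
    (fun t ht x hx => by have := hdn t ht x hx; linarith)
    (fun t ht y hy => by
      obtain ⟨x, hx, hx2⟩ := (hcon t ht y (by rwa [mem_closedBall_zero_iff] at hy)).2
      exact ⟨x, hx, by linarith⟩)
  set N := max (max N0 N0') 1 with hN
  have hNp : 0 < N := by rw [hN]; exact lt_of_lt_of_le one_pos (le_max_right _ _)
  have hNp' : (0:ℝ) < N := by exact_mod_cast hNp
  have i1 := hN0 N ((le_max_left N0 N0').trans (le_max_left _ _)) hNp
  have i2 := hN0' N ((le_max_right N0 N0').trans (le_max_left _ _)) hNp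
  have hVpos : 0 < volume.real (closedBall (0 : Eu n) l) := by
    rw [measureReal_def]
    exact ENNReal.toReal_pos (measure_closedBall_pos volume _ hl).ne'
      (isCompact_closedBall (0 : Eu n) l).measure_lt_top.ne
  have hρ' : 0 < 1 + 2 * ρ / θ := by have := hpar.hρ; positivity
  have hball : volume.real (closedBall (0 : Eu n) ((1 + 2 * ρ / θ) * l)) =
      (1 + 2 * ρ / θ) ^ n * volume.real (closedBall (0 : Eu n) l) := by
    rw [Measure.addHaar_real_closedBall (volume : Measure (Eu n)) 0 hl.le,
      Measure.addHaar_real_closedBall (volume : Measure (Eu n)) 0 (by positivity),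
      finrank_euclideanSpace_fin, mul_pow]
    ring
  have hpt : ∀ j ∈ Finset.range N,
      volume.real {x ∈ closedBall (0 : Eu n) ((1 + 2 * ρ / θ) * l) | M1 + -u x (t0 + (j + 1 : ℕ) * (1 / N : ℝ)) ≤ 2 * δ} +
      volume.real {x ∈ closedBall (0 : Eu n) ((1 + 2 * ρ / θ) * l) | N1 + u x (t0 + (j + 1 : ℕ) * (1 / N : ℝ)) ≤ 2 * δ} ≤
      (1 + 2 * ρ / θ) ^ n * volume.real (closedBall (0 : Eu n) l) := by
    intro j hj
    set t := t0 + (j + 1 : ℕ) * (1 / N : ℝ) with ht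
    have htp : 0 < t := by positivity
    have hcl : closedBall (0 : Eu n) ((1 + 2 * ρ / θ) * l) ⊆ Ω := by
      refine (closedBall_subset_closedBall ?_).trans hBΩ
      have := hpar.hρ1
      nlinarith
    have hcu : ContinuousOn (fun x => u x t) (closedBall (0 : Eu n) ((1 + 2 * ρ / θ) * l)) :=
      fun x hx => (hu.c2 x (hcl hx) t htp).continuousAt.continuousWithinAt
    have f1 : volume {x ∈ closedBall (0 : Eu n) ((1 + 2 * ρ / θ) * l) | M1 + -u x t ≤ 2 * δ} ≠ ⊤ :=
      measure_ne_top_of_subset (fun x hx => hx.1) (isCompact_closedBall (0 : Eu n) ((1 + 2 * ρ / θ) * l)).measure_lt_top.ne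
    have f2 : volume {x ∈ closedBall (0 : Eu n) ((1 + 2 * ρ / θ) * l) | N1 + u x t ≤ 2 * δ} ≠ ⊤ :=
      measure_ne_top_of_subset (fun x hx => hx.1) (isCompact_closedBall (0 : Eu n) ((1 + 2 * ρ / θ) * l)).measure_lt_top.ne
    rw [← hball, ← measureReal_union (h₁ := f1) (h₂ := f2)]
    · refine measureReal_mono ?_ (isCompact_closedBall _ _).measure_lt_top.ne
      rintro x (hx | hx) <;> exact hx.1
    · rw [Set.disjoint_left]
      rintro x ⟨_, h1⟩ ⟨_, h2⟩
      linarith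
    · have h1 : ContinuousOn (fun x => N1 + u x t) (closedBall (0 : Eu n) ((1 + 2 * ρ / θ) * l)) :=
        continuousOn_const.add hcu
      have := h1.preimage_isClosed_of_isClosed isClosed_closedBall (isClosed_Iic (a := 2 * δ))
      exact this.measurableSet
  have hs := Finset.sum_le_sum hpt
  rw [Finset.sum_add_distrib, Finset.sum_const, Finset.card_range, nsmul_eq_mul] at hs
  have hkey := hpar.key
  have hk2 := mul_lt_mul_of_pos_left (mul_lt_mul_of_pos_right hkey hVpos) hNp'
  nlinarith

end Part10

section Part11

theorem exp_small {k : ℝ} (hk : 0 < k) (c1 c2 : ℝ) :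
    Tendsto (fun ε : ℝ => Real.exp (-(k / ε)) * (c1 + c2 / ε)) (𝓝[>] 0) (𝓝 0) := by
  have h1 : Tendsto (fun s : ℝ => Real.exp (-(k * s)) * (c1 + c2 * s)) atTop (𝓝 0) := by
    have a1 : Tendsto (fun s : ℝ => Real.exp (-(k * s))) atTop (𝓝 0) := by
      apply Real.tendsto_exp_neg_atTop_nhds_zero.comp
      exact tendsto_id.const_mul_atTop hk
    have a2 : Tendsto (fun s : ℝ => s * Real.exp (-(k * s))) atTop (𝓝 0) := by
      have := Real.tendsto_pow_mul_exp_neg_atTop_nhds_zero 1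
      have h2 := (this.comp (tendsto_id.const_mul_atTop hk)).const_mul k⁻¹
      simp only [mul_zero] at h2
      refine h2.congr fun s => ?_
      simp only [Function.comp, id, pow_one]
      field_simp
    have := (a1.mul_const c1).add (a2.mul_const c2)
    simp only [zero_mul, add_zero] at this
    refine this.congr fun s => by ring
  have := h1.comp tendsto_inv_nhdsGT_zero
  refine this.congr fun ε => ?_
  simp [div_eq_mul_inv]

structure SmallP (n : ℕ) (θ C r b₀ Lb ρ δ ω d0 ε : ℝ) : Prop where
  z : 4 * C * Real.exp (4 * (b₀ * θ / 4)) * Real.exp (-(b₀ * θ / 4 * r ^ 2 / ε)) ≤ δ / 2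
  R1 : Reps (n * θ⁻¹) (b₀ * θ / 4) b₀ C r ε * (5 + 2 / ε) ≤ c3 n θ b₀ Lb ρ * δ / 8
  R2 : Reps (n * θ⁻¹) (b₀ * θ / 4) b₀ C r ε * (5 + 2 / ε) ≤ ω
  e1 : 2 * √ε ≤ r
  e2 : 2 * √ε ≤ d0
  e3 : 2 * (ρ ^ 2 + gam n θ b₀ + 1) * ε ≤ r ^ 2
  e4 : Real.exp (-(2 * b₀ * (1 / ε))) * r ^ 2 ≤ ε
  e5 : 4 * C * Real.exp (-(3 / 4 * (b₀ * θ / 4) * r ^ 2 / ε)) ≤ ω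

theorem small_ev (n : ℕ) {θ C r b₀ Lb ρ δ ω d0 : ℝ} (hθ : 0 < θ) (hC : 0 < C) (hr : 0 < r) (hb₀ : 0 < b₀)
    (hρ : 0 < ρ) (hδ : 0 < δ) (hω : 0 < ω) (hd0 : 0 < d0) :
    ∀ᶠ ε in 𝓝[>] (0:ℝ), SmallP n θ C r b₀ Lb ρ δ ω d0 ε := by
  have hκ : 0 < b₀ * θ / 4 * r ^ 2 := by positivity
  have hc3 := c3_pos n (θ := θ) (b₀ := b₀) (Lb := Lb) hρ
  have t1 := exp_small hκ (4 * C * Real.exp (4 * (b₀ * θ / 4))) 0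
  have t2 := exp_small hκ (8 * C * (b₀ * θ / 4) * (n * θ⁻¹) * Real.exp (2 * (b₀ * θ / 4) * (n * θ⁻¹) / b₀) * 5)
    (8 * C * (b₀ * θ / 4) * (n * θ⁻¹) * Real.exp (2 * (b₀ * θ / 4) * (n * θ⁻¹) / b₀) * 2)
  have t3 := exp_small (by positivity : 0 < 2 * b₀) 0 (r ^ 2)
  have t4 := exp_small (by positivity : 0 < 3 / 4 * (b₀ * θ / 4) * r ^ 2) (4 * C) 0
  have t5 : Tendsto (fun ε : ℝ => 2 * √ε) (𝓝[>] 0) (𝓝 0) := by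
    have : Continuous fun ε : ℝ => 2 * √ε := by fun_prop
    have := this.tendsto 0
    simp at this
    exact this.mono_left nhdsWithin_le_nhds
  have t6 : Tendsto (fun ε : ℝ => 2 * (ρ ^ 2 + gam n θ b₀ + 1) * ε) (𝓝[>] 0) (𝓝 0) := by
    have : Continuous fun ε : ℝ => 2 * (ρ ^ 2 + gam n θ b₀ + 1) * ε := by fun_prop
    have := this.tendsto 0
    simp at this
    exact this.mono_left nhdsWithin_le_nhds
  filter_upwards [t1.eventually_lt_const (by positivity : 0 < δ / 2),
    t2.eventually_lt_const (by positivity : 0 < c3 n θ b₀ Lb ρ * δ / 8),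
    t2.eventually_lt_const hω, t3.eventually_lt_const one_pos, t4.eventually_lt_const hω,
    t5.eventually_lt_const hr, t5.eventually_lt_const hd0, t6.eventually_lt_const (by positivity : 0 < r ^ 2),
    self_mem_nhdsWithin] with ε h1 h2 h3 h4 h5 h6 h7 h8 hε
  have hε : 0 < ε := hε
  have eR : Reps (n * θ⁻¹) (b₀ * θ / 4) b₀ C r ε * (5 + 2 / ε) = Real.exp (-(b₀ * θ / 4 * r ^ 2 / ε)) *
      (8 * C * (b₀ * θ / 4) * (n * θ⁻¹) * Real.exp (2 * (b₀ * θ / 4) * (n * θ⁻¹) / b₀) * 5 +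
    8 * C * (b₀ * θ / 4) * (n * θ⁻¹) * Real.exp (2 * (b₀ * θ / 4) * (n * θ⁻¹) / b₀) * 2 / ε) := by
    unfold Reps; ring
  refine ⟨?_, ?_, ?_, h6.le, h7.le, h8.le, ?_, ?_⟩
  · refine le_trans (le_of_eq ?_) h1.le; ring
  · rw [eR]; exact h2.le
  · rw [eR]; exact h3.le
  · have e : Real.exp (-(2 * b₀ * (1 / ε))) * r ^ 2 = Real.exp (-(2 * b₀ / ε)) * (0 + r ^ 2 / ε) * ε := by
      rw [mul_one_div]; field_simp; ring
    rw [e]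
    nlinarith
  · refine le_trans (le_of_eq ?_) h5.le; ring

section
variable {Ω : Set (Eu n)} {b : Eu n → Eu n} {θ ε C r b₀ Lb : ℝ}

theorem Up_lower (h : BD Ω b θ ε C r b₀ Lb) {A : Eu n → ℝ → Matrix (Fin n) (Fin n) ℝ}
    {u : Eu n → ℝ → ℝ} (hu : LS Ω b θ ε C A u) {M t : ℝ} (ht : 0 < t)
    (hz : zeta (n := n) (b₀ * θ / 4) C r ε 0 ≤ C)
    (hup : Up (b₀ * θ / 4) C r ε u M t) : -(2 * C) ≤ M := by
  have hr := h.hr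
  have h0 : (0 : Eu n) ∈ closedBall (0 : Eu n) r := by simp [hr.le]
  have h1 := hup 0 h0
  have h2 := (abs_le.1 (hu.bd 0 (h.sub h0) t ht)).1
  linarith

theorem zeta_small (h : BD Ω b θ ε C r b₀ Lb) {x : Eu n} {l : ℝ} (hl2 : l ^ 2 = ε)
    (hx : ‖x‖ ≤ 2 * l) :
    zeta (b₀ * θ / 4) C r ε x ≤
      4 * C * Real.exp (4 * (b₀ * θ / 4)) * Real.exp (-(b₀ * θ / 4 * r ^ 2 / ε)) := by
  obtain ⟨hθ, hε, hC, hr, hb, -, -, hco, -⟩ := h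
  unfold zeta
  rw [mul_assoc (4 * C), ← Real.exp_add]
  gcongr
  have h1 : ‖x - 0‖ ^ 2 ≤ 4 * ε := by
    rw [sub_zero, ← hl2]
    have := norm_nonneg x
    nlinarith
  have e : b₀ * θ / 4 / ε * (‖x - 0‖ ^ 2 - r ^ 2) = b₀ * θ / 4 / ε * ‖x - 0‖ ^ 2 + -(b₀ * θ / 4 * r ^ 2 / ε) := by
    ring
  rw [e]
  have : b₀ * θ / 4 / ε * ‖x - 0‖ ^ 2 ≤ b₀ * θ / 4 / ε * (4 * ε) := by gcongr
  have e2 : b₀ * θ / 4 / ε * (4 * ε) = 4 * (b₀ * θ / 4) := by field_simp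
  linarith

end

set_option maxHeartbeats 1000000 in
/-- drop of one side -/
theorem drop_side {n : ℕ} {Ω : Set (Eu n)} {b : Eu n → Eu n} {θ ε C r b₀ Lb : ℝ}
    (h : BD Ω b θ ε C r b₀ Lb) {A : Eu n → ℝ → Matrix (Fin n) (Fin n) ℝ}
    {u v : Eu n → ℝ → ℝ} (hu : LS Ω b θ ε C A u) (hv : LS Ω b θ ε C A v) {l δ ρ ω d0 t0 t M N : ℝ}
    (hl2 : l ^ 2 = ε) (hl : 0 < l) (hδ : 0 < δ) (hδC : δ ≤ C) (hρ : 0 < ρ) (hs : SmallP n θ C r b₀ Lb ρ δ ω d0 ε)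
    (hρl : (1 + ρ) * l ≤ 2 * l)
    (ht0 : 0 < t0) (ht : t ∈ Icc t0 (t0 + 1)) (hM : -(2 * C) ≤ M) (hN : -(2 * C) ≤ N)
    (hup : Up (b₀ * θ / 4) C r ε u M t0) (hvp : Up (b₀ * θ / 4) C r ε v N t0)
    {p : Eu n} (hp : ‖p‖ ≤ l)
    (hlow : ∀ x, ‖x - p‖ ≤ ρ * l → u x t ≤ M + Reps (n * θ⁻¹) (b₀ * θ / 4) b₀ C r ε +
      4 * C * Real.exp (4 * (b₀ * θ / 4)) * Real.exp (-(b₀ * θ / 4 * r ^ 2 / ε)) - δ) :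
    ∃ M' N', Up (b₀ * θ / 4) C r ε u M' (t0 + (2 + 1 / ε)) ∧ Up (b₀ * θ / 4) C r ε v N' (t0 + (2 + 1 / ε)) ∧
      M' + N' ≤ M + N - c3 n θ b₀ Lb ρ * δ / 8 := by
  have hε := h.hε
  have hC := h.hC
  set R := Reps (n * θ⁻¹) (b₀ * θ / 4) b₀ C r ε with hR
  have hR0 : 0 ≤ R := Reps_nonneg h
  have hz := hs.z
  have hlz : zeta (n := n) (b₀ * θ / 4) C r ε 0 ≤ C := by
    refine (zeta_small h hl2 (by simp; positivity)).trans ?_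
    linarith
  have u1 := Up_prop h hu hM ht0 hup ht.1
  have u2 : Up (b₀ * θ / 4) C r ε u (M + R) t := u1.mono (by
    have : R * (t - t0) ≤ R * 1 := mul_le_mul_of_nonneg_left (by linarith [ht.2]) hR0
    linarith)
  have htp : 0 < t := by linarith [ht.1]
  have hMR := Up_lower h hu htp hlz u2
  have hR1 := hs.R1
  rw [← hR] at hR1
  have hTp : 0 ≤ 1 / ε := by positivity
  have d := drop h hu (T := 1 / ε) hMR htp hTp u2 (p := p) (δ := δ / 2)
    (by rw [← hl2]; gcongr) hρ (by positivity) (by linarith)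
    (fun x hx hxp => by
      have h1 : ‖x - p‖ ≤ ρ * l := by
        rw [← hl2, ← mul_pow] at hxp
        exact abs_le_of_sq_le_sq' hxp (by positivity) |>.2
      have := hlow x h1
      linarith) hs.e3 hs.e4
  rw [← hR] at d
  have d1 := Up_lower h hu (by positivity) hlz d
  have d2 := Up_prop h hu d1 (by positivity) d (t := t0 + (2 + 1 / ε)) (by linarith [ht.2])
  have v1 := Up_prop h hv hN ht0 hvp (t := t0 + (2 + 1 / ε)) (by linarith)
  rw [← hR] at d2 v1
  refine ⟨_, _, d2, v1, ?_⟩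
  have e1 : R * (t0 + (2 + 1 / ε) - (t + 1 + 1 / ε)) ≤ R * 1 :=
    mul_le_mul_of_nonneg_left (by linarith [ht.1]) hR0
  have e2 : R * (5 + 2 / ε) = 5 * R + 2 * (R * (1 / ε)) := by ring
  linarith

set_option maxHeartbeats 1000000 in
theorem osc_step {n : ℕ} (hn : 0 < n) {Ω : Set (Eu n)} {b : Eu n → Eu n} {θ ε C r b₀ Lb : ℝ}
    (h : BD Ω b θ ε C r b₀ Lb) {A : Eu n → ℝ → Matrix (Fin n) (Fin n) ℝ}
    {u : Eu n → ℝ → ℝ} (hu : LS Ω b θ ε C A u) {δ ρ η η3 ω d0 t0 M N : ℝ}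
    (hδ : 0 < δ) (hδC : δ ≤ C) (hδω : 4 * δ ≤ ω) (hpar : Par n θ Lb ρ η η3)
    (hs : SmallP n θ C r b₀ Lb ρ δ ω d0 ε)
    (hθ1 : θ ≤ 1) (hδd : 2 * δ ≤ d0)
    {a0 : ℝ → Matrix (Fin n) (Fin n) ℝ} (ha0 : ∀ c, memS θ (a0 c))
    (hmod : ∀ x : Eu n, ‖x‖ ≤ d0 → x ∈ Ω → ∀ t > 0, ∀ c, |u x t - c| ≤ d0 → ∀ p : Eu n,
      |mquad (A x t) p - mquad (a0 c) p| ≤ η * θ * ‖p‖ ^ 2)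
    (ht0 : 0 < t0) 
    (hup : Up (b₀ * θ / 4) C r ε u M t0) (hdn : Up (b₀ * θ / 4) C r ε (fun x t => -u x t) N t0) :
    ∃ M' N', Up (b₀ * θ / 4) C r ε u M' (t0 + (2 + 1 / ε)) ∧
      Up (b₀ * θ / 4) C r ε (fun x t => -u x t) N' (t0 + (2 + 1 / ε)) ∧
      (M' + N' ≤ M + N - c3 n θ b₀ Lb ρ * δ / 8 ∨ M' + N' ≤ 2 * ω) := by
  have hε := h.hε
  have hC := h.hC
  have hθ := h.hθ
  set R := Reps (n * θ⁻¹) (b₀ * θ / 4) b₀ C r ε with hR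
  have hR0 : 0 ≤ R := Reps_nonneg h
  have hz := hs.z
  set z := 4 * C * Real.exp (4 * (b₀ * θ / 4)) * Real.exp (-(b₀ * θ / 4 * r ^ 2 / ε)) with hzd
  have hz0 : 0 ≤ z := by rw [hzd]; positivity
  have hl : 0 < √ε := Real.sqrt_pos.2 hε
  have hl2 : √ε ^ 2 = ε := Real.sq_sqrt hε.le
  have hlz : zeta (n := n) (b₀ * θ / 4) C r ε 0 ≤ C := by
    refine (zeta_small h hl2 (by simp)).trans ?_
    linarith
  have hM := Up_lower h hu ht0 hlz hup
  have hN := Up_lower h hu.neg ht0 hlz hdn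
  have hTp : 0 ≤ 1 / ε := by positivity
  by_cases hMN : M + N ≤ ω
  · have v1 := Up_prop h hu hM ht0 hup (t := t0 + (2 + 1 / ε)) (by linarith)
    have v2 := Up_prop h hu.neg hN ht0 hdn (t := t0 + (2 + 1 / ε)) (by linarith)
    refine ⟨_, _, v1, v2, Or.inr ?_⟩
    have := hs.R2
    rw [← hR] at this ⊢
    have e2 : R * (5 + 2 / ε) = 5 * R + 2 * (R * (1 / ε)) := by ring
    have e3 : R * (t0 + (2 + 1 / ε) - t0) = 2 * R + R * (1 / ε) := by ring
    linarith
  push Not at hMN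
  have hρθ : ρ ≤ 1 := by
    have := hpar.hρ1
    rw [div_lt_one hθ] at this; linarith [hpar.hρ]
  have hb : ∀ (v : Eu n → ℝ → ℝ) (K : ℝ), LS Ω b θ ε C A v → -(2 * C) ≤ K → Up (b₀ * θ / 4) C r ε v K t0 →
      ∀ t ∈ Icc t0 (t0 + 1), ∀ x ∈ closedBall (0 : Eu n) (2 * √ε), v x t ≤ K + R + z := by
    intro v K hv hK hvp t ht x hx
    have u1 := Up_prop h hv hK ht0 hvp ht.1 x (closedBall_subset_closedBall hs.e1 hx)
    rw [mem_closedBall_zero_iff] at hx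
    have u2 := zeta_small h hl2 hx
    rw [← hR] at u1
    have : R * (t - t0) ≤ R * 1 := mul_le_mul_of_nonneg_left (by linarith [ht.2]) hR0
    linarith
  obtain ⟨t, ht, p, hp, hcase⟩ := dicho hn h hu hl hl2 hs.e1 hδ hpar hθ1 ht0 hδd hs.e2 ha0 hmod
    (hb u M hu hM hup) (hb _ N hu.neg hN hdn) (by linarith)
  have hρl : (1 + ρ) * √ε ≤ 2 * √ε := by gcongr; linarith
  rcases hcase with hc | hc
  · obtain ⟨M', N', h1, h2, h3⟩ := drop_side h hu hu.neg hl2 hl hδ hδC hpar.hρ hs hρl ht0 ht hM hN hup hdn hp hc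
    exact ⟨M', N', h1, h2, Or.inl h3⟩
  · obtain ⟨M', N', h1, h2, h3⟩ := drop_side h hu.neg hu hl2 hl hδ hδC hpar.hρ hs hρl ht0 ht hN hM hdn hup hp hc
    exact ⟨N', M', h2, h1, Or.inl (by linarith)⟩

theorem osc_iter {n : ℕ} (hn : 0 < n) {Ω : Set (Eu n)} {b : Eu n → Eu n} {θ ε C r b₀ Lb : ℝ}
    (h : BD Ω b θ ε C r b₀ Lb) {A : Eu n → ℝ → Matrix (Fin n) (Fin n) ℝ}
    {u : Eu n → ℝ → ℝ} (hu : LS Ω b θ ε C A u) {δ ρ η η3 ω d0 t0 : ℝ}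
    (hδ : 0 < δ) (hδC : δ ≤ C) (hδω : 4 * δ ≤ ω) (hpar : Par n θ Lb ρ η η3)
    (hs : SmallP n θ C r b₀ Lb ρ δ ω d0 ε)
    (hθ1 : θ ≤ 1) (hδd : 2 * δ ≤ d0)
    {a0 : ℝ → Matrix (Fin n) (Fin n) ℝ} (ha0 : ∀ c, memS θ (a0 c))
    (hmod : ∀ x : Eu n, ‖x‖ ≤ d0 → x ∈ Ω → ∀ t > 0, ∀ c, |u x t - c| ≤ d0 → ∀ p : Eu n,
      |mquad (A x t) p - mquad (a0 c) p| ≤ η * θ * ‖p‖ ^ 2)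
    (ht0 : 0 < t0) (k : ℕ) :
    ∃ M' N', Up (b₀ * θ / 4) C r ε u M' (t0 + k * (2 + 1 / ε)) ∧
      Up (b₀ * θ / 4) C r ε (fun x t => -u x t) N' (t0 + k * (2 + 1 / ε)) ∧
      M' + N' ≤ max (2 * C - k * (c3 n θ b₀ Lb ρ * δ / 8)) (2 * ω) := by
  have hε := h.hε
  have hC := h.hC
  induction k with
  | zero =>
    refine ⟨C, C, ?_, ?_, by simp [two_mul]⟩ <;> intro x hx <;>
      have h1 := abs_le.1 (hu.bd x (h.sub hx) (t0 + (0:ℕ) * (2 + 1 / ε)) (by simpa using ht0)) <;>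
      have h2 := zeta_pos (r := r) (ε := ε) (b₀ * θ / 4) hC x
    · linarith [h1.2]
    · simp only; linarith [h1.1]
  | succ k ih =>
    obtain ⟨M, N, h1, h2, h3⟩ := ih
    obtain ⟨M', N', h1', h2', h3'⟩ := osc_step hn h hu hδ hδC hδω hpar hs hθ1 hδd ha0 hmod
      (by positivity) h1 h2
    have e : t0 + ((k + 1 : ℕ) : ℝ) * (2 + 1 / ε) = t0 + (k : ℝ) * (2 + 1 / ε) + (2 + 1 / ε) := by
      push_cast; ring
    rw [e]
    refine ⟨M', N', h1', h2', ?_⟩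
    have hc := c3_pos n (θ := θ) (b₀ := b₀) (Lb := Lb) hpar.hρ
    have hc' : 0 < c3 n θ b₀ Lb ρ * δ / 8 := by positivity
    rcases h3' with h4 | h4
    · rcases le_max_iff.1 h3 with h5 | h5
      · refine le_max_of_le_left ?_
        push_cast; linarith
      · exact le_max_of_le_right (by linarith)
    · exact le_max_of_le_right h4

/-- decay of the oscillation near the origin -/
theorem osc_decay {n : ℕ} (hn : 0 < n) {θ C r b₀ Lb ρ η η3 d0 ω : ℝ}
    (hθ : 0 < θ) (hθ1 : θ ≤ 1) (hC : 0 < C) (hr : 0 < r) (hb₀ : 0 < b₀)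
    (hpar : Par n θ Lb ρ η η3) (hd0 : 0 < d0) (hω : 0 < ω) :
    ∃ k : ℕ, ∀ᶠ ε in 𝓝[>] (0:ℝ), ∀ (Ω : Set (Eu n)) (b : Eu n → Eu n)
      (A : Eu n → ℝ → Matrix (Fin n) (Fin n) ℝ) (u : Eu n → ℝ → ℝ)
      (a0 : ℝ → Matrix (Fin n) (Fin n) ℝ), BD Ω b θ ε C r b₀ Lb → LS Ω b θ ε C A u →
      (∀ c, memS θ (a0 c)) →
      (∀ x : Eu n, ‖x‖ ≤ d0 → x ∈ Ω → ∀ t > 0, ∀ c, |u x t - c| ≤ d0 → ∀ p : Eu n,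
        |mquad (A x t) p - mquad (a0 c) p| ≤ η * θ * ‖p‖ ^ 2) →
      ∀ t, k * (2 + 1 / ε) < t → ∀ x ∈ closedBall (0 : Eu n) (r / 2), ∀ y ∈ closedBall (0 : Eu n) (r / 2),
        u x t - u y t ≤ 4 * ω := by
  set δ := min C (min (ω / 4) (d0 / 2)) with hδ
  have hδp : 0 < δ := by rw [hδ]; positivity
  have hδC : δ ≤ C := min_le_left _ _
  have hδω : 4 * δ ≤ ω := by
    have : δ ≤ ω / 4 := (min_le_right _ _).trans (min_le_left _ _)
    linarith
  have hδd : 2 * δ ≤ d0 := by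
    have : δ ≤ d0 / 2 := (min_le_right _ _).trans (min_le_right _ _)
    linarith
  have hc := c3_pos n (θ := θ) (b₀ := b₀) (Lb := Lb) hpar.hρ
  have hc' : 0 < c3 n θ b₀ Lb ρ * δ / 8 := by positivity
  obtain ⟨k, hk⟩ := exists_nat_gt (2 * C / (c3 n θ b₀ Lb ρ * δ / 8))
  rw [div_lt_iff₀ hc'] at hk
  refine ⟨k, ?_⟩
  filter_upwards [small_ev n hθ hC hr hb₀ (Lb := Lb) hpar.hρ hδp hω hd0] with ε hs Ω b A u a0 hB hu ha0 hmod t ht x hx y hy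
  have hε := hB.hε
  obtain ⟨M, N, h1, h2, h3⟩ := osc_iter hn hB hu hδp hδC hδω hpar hs hθ1 hδd ha0 hmod
    (t0 := t - k * (2 + 1 / ε)) (by linarith) k
  have e : t - k * (2 + 1 / ε) + k * (2 + 1 / ε) = t := by ring
  rw [e] at h1 h2
  have hrr : closedBall (0 : Eu n) (r / 2) ⊆ closedBall (0 : Eu n) r := closedBall_subset_closedBall (by linarith)
  have h4 := h1 x (hrr hx)
  have h5 := h2 y (hrr hy)
  have hz : ∀ x ∈ closedBall (0 : Eu n) (r / 2), zeta (b₀ * θ / 4) C r ε x ≤ ω := by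
    intro x hx
    refine le_trans ?_ hs.e5
    unfold zeta
    gcongr
    rw [mem_closedBall_zero_iff] at hx
    rw [sub_zero]
    have h6 : ‖x‖ ^ 2 ≤ (r / 2) ^ 2 := by gcongr
    have h7 : b₀ * θ / 4 / ε * (‖x‖ ^ 2 - r ^ 2) ≤ b₀ * θ / 4 / ε * ((r / 2) ^ 2 - r ^ 2) := by gcongr
    refine h7.trans (le_of_eq ?_)
    ring
  have h6 := hz x hx
  have h7 := hz y hy
  have h8 : max (2 * C - k * (c3 n θ b₀ Lb ρ * δ / 8)) (2 * ω) ≤ 2 * ω := max_le (by linarith) le_rfl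
  simp only at h5
  linarith

end Part11

section Part12

open MeasureTheory in
set_option maxHeartbeats 1000000 in
/-- mollification of a Lipschitz function: one-sided derivative bounds are preserved -/
theorem moll_deriv {f : Eu n → ℝ} {K : NNReal} (hf : LipschitzWith K f) {η : ℝ} (hη : 0 < η) :
    ∃ g : Eu n → ℝ, ContDiff ℝ 2 g ∧ (∀ x, |g x - f x| ≤ K * η) ∧
      ∀ x w c, (∀ z ∈ ball x η, DifferentiableAt ℝ f z → fderiv ℝ f z w ≤ c) → fderiv ℝ g x w ≤ c := by
  let φ : ContDiffBump (0 : Eu n) := ⟨η / 2, η, by linarith, by linarith⟩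
  let ψ : Eu n → ℝ := φ.normed volume
  have hψc : Continuous ψ := φ.continuous_normed
  have hψs : HasCompactSupport ψ := φ.hasCompactSupport_normed
  have hψi : Integrable ψ := hψc.integrable_of_hasCompactSupport hψs
  have hψ0 : ∀ y, 0 ≤ ψ y := φ.nonneg_normed
  have hψ1 : ∫ y, ψ y = 1 := φ.integral_normed
  have hfc := hf.continuous
  refine ⟨convolution ψ f (ContinuousLinearMap.lsmul ℝ ℝ) volume, ?_, ?_, ?_⟩
  · exact hψs.contDiff_convolution_left _ φ.contDiff_normed hfc.locallyIntegrable
  · intro x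
    rw [← Real.dist_eq]
    refine φ.dist_normed_convolution_le hfc.aestronglyMeasurable fun z hz => ?_
    refine (hf.dist_le_mul z x).trans ?_
    have : dist z x ≤ η := (mem_ball.1 hz).le
    gcongr
  · intro x w c hc
    have hae : ∀ᵐ y : Eu n, DifferentiableAt ℝ f (x - y) :=
      (Measure.measurePreserving_sub_left (volume : Measure (Eu n)) x).quasiMeasurePreserving.ae
        hf.ae_differentiableAt
    have hmeas : Measurable (fun y => fderiv ℝ f (x - y)) :=
      (measurable_fderiv ℝ f).comp (measurable_const.sub measurable_id)
    obtain ⟨hI, hD⟩ := hasFDerivAt_integral_of_dominated_loc_of_lip (𝕜 := ℝ) (μ := (volume : Measure (Eu n)))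
      (F := fun x y => ψ y * f (x - y)) (F' := fun y => ψ y • fderiv ℝ f (x - y)) (x₀ := x)
      (s := univ) (bound := fun y => ψ y * K) univ_mem
      (Eventually.of_forall fun x => by
        have : Continuous fun y => ψ y * f (x - y) := by fun_prop
        exact this.aestronglyMeasurable)
      (by
        have : Continuous fun y => ψ y * f (x - y) := by fun_prop
        exact this.integrable_of_hasCompactSupport hψs.mul_right)
      (hψc.measurable.smul hmeas).aestronglyMeasurable
      (Eventually.of_forall fun y => by
        refine LipschitzOnWith.of_dist_le_mul fun a _ b _ => ?_
        have hh : 0 ≤ ψ y * K := mul_nonneg (hψ0 y) K.2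
        rw [Real.dist_eq, ← mul_sub, abs_mul, abs_of_nonneg (hψ0 y), ← Real.dist_eq]
        have h2 := hf.dist_le_mul (a - y) (b - y)
        rw [dist_sub_right] at h2
        have h3 := mul_le_mul_of_nonneg_left h2 (hψ0 y)
        simp only [Real.coe_nnabs, abs_of_nonneg hh]
        linarith)
      (hψi.mul_const _)
      (hae.mono fun y hy => by
        have h1 : HasFDerivAt (fun x => f (x - y)) (fderiv ℝ f (x - y)) x := by
          have h2 := hy.hasFDerivAt.comp x ((hasFDerivAt_id x).sub_const y)
          exact h2.congr_fderiv (by simp)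
        exact h1.const_mul (ψ y))
    have hD' : HasFDerivAt (convolution ψ f (ContinuousLinearMap.lsmul ℝ ℝ) volume)
      (∫ y, ψ y • fderiv ℝ f (x - y)) x := hD
    rw [hD'.fderiv, ContinuousLinearMap.integral_apply hI]
    have hI2 : Integrable (fun y => (ψ y • fderiv ℝ f (x - y)) w) := hI.apply_continuousLinearMap w
    calc ∫ y, (ψ y • fderiv ℝ f (x - y)) w ≤ ∫ y, ψ y * c := by
          refine integral_mono_ae hI2 (hψi.mul_const c) ?_
          filter_upwards [hae] with y hy
          simp only [ContinuousLinearMap.smul_apply, smul_eq_mul]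
          by_cases h0 : ψ y = 0
          · simp [h0]
          · have hy2 : y ∈ ball (0 : Eu n) η := by
              have : y ∈ Function.support ψ := h0
              rw [show ψ = φ.normed volume from rfl, φ.support_normed_eq] at this
              exact this
            refine mul_le_mul_of_nonneg_left (hc _ ?_ hy) (hψ0 y)
            simpa [mem_ball, dist_eq_norm] using hy2
      _ = c := by rw [integral_mul_const, hψ1, one_mul]

theorem mquad_tangent {A : Matrix (Fin n) (Fin n) ℝ} (hA : A.IsSymm) (hp : ∀ p : Eu n, 0 ≤ mquad A p)
    (P p : Eu n) : 2 * dotp (mv A P) p - mquad A P ≤ mquad A p := by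
  have := hp (p - P)
  rw [mquad_eq_inner, map_sub, inner_sub_left, inner_sub_right, inner_sub_right] at this
  rw [mquad_eq_inner, mquad_eq_inner, dotp_eq_inner]
  have e1 := inner_mv_symm hA P p
  have e2 := real_inner_comm p (mv A P)
  linarith

theorem gradient_norm_le {f : Eu n → ℝ} {K : NNReal} (hf : LipschitzWith K f) (z : Eu n) :
    ‖gradient f z‖ ≤ K := by
  unfold gradient
  rw [LinearIsometryEquiv.norm_map]
  exact norm_fderiv_le_of_lipschitz ℝ hf

theorem mquad_continuousOn {α : Eu n → Matrix (Fin n) (Fin n) ℝ} {Ω : Set (Eu n)} (hα : ContinuousOn α Ω) :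
    ContinuousOn (fun q : Eu n × Eu n => mquad (α q.1) q.2) (Ω ×ˢ univ) := by
  unfold mquad
  refine continuousOn_finset_sum _ fun i _ => continuousOn_finset_sum _ fun j _ => ?_
  have h1 : ContinuousOn (fun q : Eu n × Eu n => α q.1 i j) (Ω ×ˢ univ) := by
    have : ContinuousOn (fun q : Eu n × Eu n => α q.1) (Ω ×ˢ univ) :=
      hα.comp continuousOn_fst (fun q hq => hq.1)
    exact (((continuous_apply j).comp (continuous_apply i)).comp_continuousOn this : _)
  have h2 : ∀ i, Continuous (fun q : Eu n × Eu n => q.2 i) := fun i => by fun_prop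
  exact (h1.mul (h2 i).continuousOn).mul (h2 j).continuousOn

theorem moll {f : Eu n → ℝ} {K : NNReal} (hf : LipschitzWith K f) {D Ω : Set (Eu n)} (hD : IsCompact D)
    (hΩ : IsOpen Ω) (hDΩ : D ⊆ Ω) {α : Eu n → Matrix (Fin n) (Fin n) ℝ} {b : Eu n → Eu n} {k : Eu n → ℝ}
    (hα : ContinuousOn α Ω) (hb : Continuous b) (hk : ContinuousOn k Ω)
    (hs : ∀ x ∈ Ω, (α x).IsSymm ∧ ∀ p, 0 ≤ mquad (α x) p)
    (hH : ∀ z ∈ Ω, DifferentiableAt ℝ f z → Ham α b z (gradient f z) + k z ≤ 0) {γ : ℝ} (hγ : 0 < γ) :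
    ∃ g : Eu n → ℝ, ContDiff ℝ 2 g ∧ (∀ x, |g x - f x| ≤ γ) ∧
      ∀ x ∈ D, Ham α b x (gradient g x) + k x ≤ γ := by
  obtain ⟨δ, hδ, hDδ⟩ := hD.exists_cthickening_subset_open hΩ hDΩ
  have hcomp : IsCompact (cthickening δ D ×ˢ closedBall (0 : Eu n) K) :=
    hD.cthickening.prod (isCompact_closedBall _ _)
  have hG : ContinuousOn (fun q : Eu n × Eu n => Ham α b q.1 q.2 + k q.1) (Ω ×ˢ univ) := by
    refine ContinuousOn.add ((mquad_continuousOn hα).add ?_) (hk.comp continuousOn_fst fun q hq => hq.1)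
    have : Continuous (fun q : Eu n × Eu n => dotp (b q.1) q.2) := by
      simp only [dotp_eq_inner]; fun_prop
    exact this.continuousOn
  have hu := hcomp.uniformContinuousOn_of_continuous (hG.mono (prod_mono hDδ (subset_univ _)))
  rw [Metric.uniformContinuousOn_iff] at hu
  obtain ⟨δ2, hδ2, hu⟩ := hu γ hγ
  set η := min (min δ δ2) (γ / (K + 1)) with hη
  have hK : (0:ℝ) ≤ K := K.2
  have hηp : 0 < η := by rw [hη]; positivity
  obtain ⟨g, hg, hgf, hgd⟩ := moll_deriv hf hηp
  refine ⟨g, hg, fun x => (hgf x).trans ?_, fun x hx => ?_⟩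
  · have h1 : η ≤ γ / (K + 1) := min_le_right _ _
    rw [le_div_iff₀ (by positivity)] at h1
    nlinarith
  · set P := gradient g x with hP
    have hsx := hs x (hDΩ hx)
    have key := hgd x ((2:ℝ) • mv (α x) P + b x) (γ + mquad (α x) P - k x) ?_
    · rw [← dotp_gradient, ← hP] at key
      have e : dotp ((2:ℝ) • mv (α x) P + b x) P = 2 * mquad (α x) P + dotp (b x) P := by
        rw [dotp_eq_inner, inner_add_left, inner_smul_left, mquad_eq_inner, dotp_eq_inner,
          real_inner_comm]
        simp
      rw [e] at key
      unfold Ham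
      linarith
    · intro z hz hdz
      rw [← dotp_gradient]
      set p := gradient f z with hp
      have hpK : p ∈ closedBall (0 : Eu n) K := by simpa using gradient_norm_le hf z
      have hzd : dist z x < η := mem_ball.1 hz
      have hzD : z ∈ cthickening δ D :=
        mem_cthickening_of_dist_le z x δ D hx (hzd.le.trans ((min_le_left _ _).trans (min_le_left _ _)))
      have hxD : x ∈ cthickening δ D := self_subset_cthickening D hx
      have h1 := hH z (hDδ hzD) hdz
      have h2 := hu (x, p) ⟨hxD, hpK⟩ (z, p) ⟨hzD, hpK⟩ (by
        rw [Prod.dist_eq]; simp only [dist_self]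
        rw [max_lt_iff]
        exact ⟨by rw [dist_comm]; exact hzd.trans_le ((min_le_left _ _).trans (min_le_right _ _)), hδ2⟩)
      rw [Real.dist_eq] at h2
      have h3 := (abs_lt.1 h2).2
      simp only at h3
      have h4 := mquad_tangent hsx.1 hsx.2 P p
      have e : dotp ((2:ℝ) • mv (α x) P + b x) p = 2 * dotp (mv (α x) P) p + dotp (b x) p := by
        simp only [dotp_eq_inner, inner_add_left, inner_smul_left]
        simp
      rw [e]
      have e5 : Ham α b x p = mquad (α x) p + dotp (b x) p := rfl
      linarith

end Part12

section Part13

section Flow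
variable {b : Eu n → Eu n} {X : ℝ → Eu n → Eu n} {L : NNReal}

theorem flow_cont (hX : GAS b X) (x : Eu n) : Continuous fun t => X t x :=
  continuous_iff_continuousAt.2 fun t => (hX.2.1 x t).continuousAt

theorem flow_semi (hb : LipschitzWith L b) (hX : GAS b X) (s t : ℝ) (x : Eu n) :
    X t (X s x) = X (t + s) x := by
  have := ODE_solution_unique_univ (v := fun _ => b) (s := fun _ => univ) (K := L) (t₀ := 0)
    (f := fun t => X t (X s x)) (g := fun t => X (t + s) x) (fun _ => hb.lipschitzOnWith)
    (fun t => ⟨hX.2.1 _ t, mem_univ _⟩)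
    (fun t => ⟨(hX.2.1 x (t + s)).comp_add_const t s, mem_univ _⟩) (by simp [hX.1])
  exact congrFun this t

theorem flow_lip (hb : LipschitzWith L b) (hX : GAS b X) {t : ℝ} (ht : 0 ≤ t) (x y : Eu n) :
    dist (X t x) (X t y) ≤ dist x y * Real.exp (L * t) := by
  have := dist_le_of_trajectories_ODE (v := fun _ => b) (K := L) (a := 0) (b := t) (δ := dist x y)
    (f := fun t => X t x) (g := fun t => X t y) (fun _ => hb)
    (flow_cont hX x).continuousOn (fun t _ => (hX.2.1 x t).hasDerivWithinAt)
    (flow_cont hX y).continuousOn (fun t _ => (hX.2.1 y t).hasDerivWithinAt)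
    (by rw [hX.1, hX.1]) t ⟨ht, le_rfl⟩
  simpa using this

theorem flow_time (hb : LipschitzWith L b) (hX : GAS b X) {K : Set (Eu n)} (hK : IsCompact K) {ρ : ℝ}
    (hρ : 0 < ρ) : ∃ T, 0 ≤ T ∧ ∀ x ∈ K, ‖X T x‖ < ρ := by
  obtain ⟨δ, hδ, hst⟩ := hX.2.2.2 ρ hρ
  have h1 : ∀ x : Eu n, ∃ t : ℝ, 0 ≤ t ∧ ‖X t x‖ < δ := by
    intro x
    have h := (hX.2.2.1 x).norm
    rw [norm_zero] at h
    obtain ⟨t, ht, ht0⟩ := ((h.eventually_lt_const hδ).and (eventually_ge_atTop 0)).exists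
    exact ⟨t, ht0, ht⟩
  choose τ hτ0 hτ using h1
  have hcont : ∀ t : ℝ, 0 ≤ t → Continuous (X t) := fun t ht => by
    have : LipschitzWith (Real.toNNReal (Real.exp (L * t))) (X t) :=
      LipschitzWith.of_dist_le_mul fun x y => by
        rw [Real.coe_toNNReal _ (Real.exp_pos _).le, mul_comm]; exact flow_lip hb hX ht x y
    exact this.continuous
  obtain ⟨F, hF, hFK⟩ := hK.elim_nhds_subcover (fun x => {y | ‖X (τ x) y‖ < δ})
    (fun x _ => (isOpen_lt (hcont _ (hτ0 x)).norm continuous_const).mem_nhds (hτ x))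
  refine ⟨∑ x ∈ F, τ x, Finset.sum_nonneg fun x _ => hτ0 x, fun y hy => ?_⟩
  obtain ⟨x, hx, hxy⟩ := mem_iUnion₂.1 (hFK hy)
  have hle : τ x ≤ ∑ x ∈ F, τ x := Finset.single_le_sum (fun x _ => hτ0 x) hx
  have := hst _ hxy ((∑ x ∈ F, τ x) - τ x) (by linarith)
  rw [flow_semi hb hX] at this
  simpa using this

theorem lyap (hb : LipschitzWith L b) (hX : GAS b X) {K : Set (Eu n)} (hK : IsCompact K) {ρ : ℝ}
    (hρ : 0 < ρ) : ∃ (W : Eu n → ℝ) (Kw : NNReal) (δ : ℝ), 0 < δ ∧ LipschitzWith Kw W ∧ (∀ x, 0 ≤ W x) ∧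
      (∀ x, ‖x‖ < δ → W x = 0) ∧ ∀ z ∈ K, DifferentiableAt ℝ W z →
        dotp (b z) (gradient W z) + max (‖z‖ - ρ) 0 ≤ 0 := by
  obtain ⟨T, hT, hTK⟩ := flow_time hb hX hK hρ
  obtain ⟨δ, hδ, hst⟩ := hX.2.2.2 ρ hρ
  set h : Eu n → ℝ := fun z => max (‖z‖ - ρ) 0 with hh
  have hlip : ∀ x y, |h x - h y| ≤ dist x y := fun x y => by
    have h1 : |h x - h y| ≤ |(‖x‖ - ρ) - (‖y‖ - ρ)| := abs_max_sub_max_le_abs _ _ _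
    refine h1.trans ?_
    rw [sub_sub_sub_cancel_right, dist_eq_norm]
    exact abs_norm_sub_norm_le x y
  have hc : ∀ x, Continuous fun t => h (X t x) := fun x => by
    have := flow_cont hX x
    fun_prop
  set W : Eu n → ℝ := fun x => ∫ t in (0:ℝ)..T, h (X t x) with hW
  refine ⟨W, Real.toNNReal (Real.exp (L * T) * T), δ, hδ, ?_, ?_, ?_, ?_⟩
  · refine LipschitzWith.of_dist_le_mul fun x y => ?_
    rw [Real.coe_toNNReal _ (by positivity), Real.dist_eq]
    have e : W x - W y = ∫ t in (0:ℝ)..T, (h (X t x) - h (X t y)) :=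
      (intervalIntegral.integral_sub ((hc x).intervalIntegrable _ _) ((hc y).intervalIntegrable _ _)).symm
    rw [e]
    have := intervalIntegral.norm_integral_le_of_norm_le_const (a := (0:ℝ)) (b := T)
      (f := fun t => h (X t x) - h (X t y)) (C := dist x y * Real.exp (L * T)) (fun t ht => by
        rw [uIoc_of_le hT] at ht
        rw [Real.norm_eq_abs]
        refine (hlip _ _).trans ((flow_lip hb hX ht.1.le x y).trans ?_)
        have := ht.2
        gcongr)
    rw [Real.norm_eq_abs, sub_zero, abs_of_nonneg hT] at this
    linarith
  · intro x
    exact intervalIntegral.integral_nonneg hT fun t _ => le_max_right _ _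
  · intro x hx
    have : W x = ∫ t in (0:ℝ)..T, (0:ℝ) := by
      refine intervalIntegral.integral_congr fun t ht => ?_
      rw [uIcc_of_le hT] at ht
      have := hst x hx t ht.1
      exact max_eq_right (by linarith)
    rw [this]; simp
  · intro z hz hd
    have e : ∀ s, W (X s z) = (∫ t in (0:ℝ)..(T + s), h (X t z)) - ∫ t in (0:ℝ)..s, h (X t z) := by
      intro s
      rw [intervalIntegral.integral_interval_sub_left ((hc z).intervalIntegrable _ _)
        ((hc z).intervalIntegrable _ _)]
      simp only [hW, flow_semi hb hX]
      rw [intervalIntegral.integral_comp_add_right (fun t => h (X t z)) s]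
      simp
    have d1 : HasDerivAt (fun s => W (X s z)) (h (X T z) - h z) 0 := by
      have a1 := ((hc z).integral_hasStrictDerivAt 0 (T + 0)).hasDerivAt
      have a2 := a1.comp_const_add T 0
      have a3 := ((hc z).integral_hasStrictDerivAt 0 0).hasDerivAt
      have a4 := a2.sub a3
      simp only [add_zero, hX.1] at a4
      refine a4.congr_of_eventuallyEq (Eventually.of_forall fun s => ?_)
      exact e s
    have d2 : HasDerivAt (fun s => W (X s z)) (fderiv ℝ W z (b z)) 0 := by
      have a1 : HasFDerivAt W (fderiv ℝ W z) (X 0 z) := by rw [hX.1]; exact hd.hasFDerivAt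
      have a2 := a1.comp_hasDerivAt 0 (hX.2.1 z 0)
      rw [hX.1] at a2
      exact a2
    have h0 : h (X T z) = 0 := max_eq_right (by linarith [hTK z hz])
    rw [dotp_gradient, d2.unique d1, h0]
    simp [hh]
end Flow

end Part13

section Part14

theorem const_ball {n : ℕ} {θ C r b₀ Lb T ω : ℝ} (hθ : 0 < θ) (hr : 0 < r) (hb₀ : 0 < b₀) (hT : 0 ≤ T)
    (hω : 0 < ω) :
    ∀ᶠ ε in 𝓝[>] (0:ℝ), ∀ (Ω : Set (Eu n)) (b : Eu n → Eu n)
      (A : Eu n → ℝ → Matrix (Fin n) (Fin n) ℝ) (u : Eu n → ℝ → ℝ),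
      BD Ω b θ ε C r b₀ Lb → LS Ω b θ ε C A u → ∀ s > 0, ∀ M, -(2 * C) ≤ M →
      (∀ x ∈ closedBall (0 : Eu n) r, u x s ≤ M) → ∀ t, s ≤ t → t ≤ s + T → u 0 t ≤ M + ω := by
  have hκ : 0 < b₀ * θ / 4 * r ^ 2 := by positivity
  have t1 := exp_small hκ (4 * C + (8 * C * (b₀ * θ / 4) * (n * θ⁻¹) *
    Real.exp (2 * (b₀ * θ / 4) * (n * θ⁻¹) / b₀)) * T) 0
  filter_upwards [t1.eventually_lt_const hω] with ε h1 Ω b A u hB hu s hs M hM hup t hst hts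
  have hUp : Up (b₀ * θ / 4) C r ε u M s := fun x hx =>
    (hup x hx).trans (by linarith [zeta_pos (r := r) (ε := ε) (b₀ * θ / 4) hB.hC x])
  have h2 := Up_prop hB hu hM hs hUp hst 0 (by simp [hr.le])
  have hR := Reps_nonneg hB
  have h3 : Reps (n * θ⁻¹) (b₀ * θ / 4) b₀ C r ε * (t - s) ≤ Reps (n * θ⁻¹) (b₀ * θ / 4) b₀ C r ε * T := by
    gcongr; linarith
  have h4 : zeta (n := n) (b₀ * θ / 4) C r ε 0 + Reps (n * θ⁻¹) (b₀ * θ / 4) b₀ C r ε * T ≤ ω := by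
    refine le_trans (le_of_eq ?_) h1.le
    unfold zeta Reps
    have : b₀ * θ / 4 / ε * (‖(0 : Eu n) - 0‖ ^ 2 - r ^ 2) = -(b₀ * θ / 4 * r ^ 2 / ε) := by simp; ring
    rw [this]; ring
  linarith

theorem C2_bounds {g : Eu n → ℝ} (hg : ContDiff ℝ 2 g) {D : Set (Eu n)} (hD : IsCompact D) {θ : ℝ} (hθ : 0 < θ) :
    ∃ G, 0 < G ∧ ∀ x ∈ D, ‖gradient g x‖ ≤ G ∧ (∀ A, memS θ A → trMul A (hessS g x) ≤ G) := by
  have c1 : Continuous (fderiv ℝ g) := hg.continuous_fderiv (by norm_num)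
  have c2 : Continuous (fderiv ℝ (fderiv ℝ g)) :=
    (hg.fderiv_right (m := 1) (by norm_num)).continuous_fderiv (by norm_num)
  obtain ⟨G1, h1⟩ := hD.exists_bound_of_continuousOn c1.continuousOn
  obtain ⟨G2, h2⟩ := hD.exists_bound_of_continuousOn (E := Eu n →L[ℝ] Eu n →L[ℝ] ℝ) (f := fderiv ℝ (fderiv ℝ g)) c2.continuousOn
  refine ⟨max 1 (max G1 (|G2| * (n * θ⁻¹))), by positivity, fun x hx => ⟨?_, fun A hA => ?_⟩⟩
  · refine le_trans ?_ ((le_max_left _ _).trans (le_max_right _ _))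
    unfold gradient
    rw [LinearIsometryEquiv.norm_map]; exact h1 x hx
  · refine le_trans ?_ ((le_max_right _ _).trans (le_max_right _ _))
    have h3 : trMul A (hessS g x) ≤ trMul A (|G2| • (1 : Matrix (Fin n) (Fin n) ℝ)) := by
      refine trMul_mono hθ hA fun p => ?_
      rw [mquad_hess hg.contDiffAt, mquad_smul, mquad_one]
      have a1 := (fderiv ℝ (fderiv ℝ g) x).le_opNorm₂ p p
      have a2 := (Real.le_norm_self _).trans a1
      have a3 : ‖fderiv ℝ (fderiv ℝ g) x‖ ≤ |G2| := by
        have := h2 x hx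
        exact this.trans (le_abs_self G2)
      calc _ ≤ _ := a2
        _ ≤ |G2| * ‖p‖ * ‖p‖ := by gcongr
        _ = _ := by ring
    rw [trMul_smul] at h3
    have h4 := trMul_one_le hA
    exact h3.trans (by gcongr)

theorem abs_dotp_le (x y : Eu n) : |dotp x y| ≤ ‖x‖ * ‖y‖ := by
  rw [dotp_eq_inner]; exact abs_real_inner_le_norm x y

set_option maxHeartbeats 1000000 in
theorem LC_barrier {Ω : Set (Eu n)} {b : Eu n → Eu n} {θ ε C : ℝ} (hθ : 0 < θ) (hε : 0 < ε) (hC : 0 < C)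
    {A : Eu n → ℝ → Matrix (Fin n) (Fin n) ℝ} {u : Eu n → ℝ → ℝ} (hu : LS Ω b θ ε C A u)
    {D U D1 : Set (Eu n)} (hD : IsCompact D) (hDΩ : D ⊆ Ω) (hU : IsOpen U) (hUD : U ⊆ D) (hD1 : D1 ⊆ D)
    {g : Eu n → ℝ} (hg : ContDiff ℝ 2 g) {G σ κ w0 r : ℝ} (hσ : 0 < σ) (hκ : 0 < κ) (hw0 : 0 ≤ w0)
    (hG : ∀ x ∈ D, ‖gradient g x‖ ≤ G ∧ (∀ A, memS θ A → trMul A (hessS g x) ≤ G))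
    (hdr : ∀ x ∈ D, r ≤ ‖x‖ → dotp (b x) (gradient g x) ≤ -(2 * σ))
    (hκ1 : κ * (θ⁻¹ * G ^ 2) ≤ σ / 2) (hε1 : ε * G ≤ σ / 2)
    (hg1 : ∀ x ∈ D1, g x ≤ w0) (hg2 : ∀ x ∈ D \ U, w0 + 1 ≤ g x) (hg3 : ∀ x ∈ D, -1 ≤ g x)
    {M t0 : ℝ} (ht0 : 0 < t0) (hM : -(2 * C) ≤ M)
    (hball : ∀ x ∈ closedBall (0 : Eu n) r, ∀ s, t0 ≤ s → s ≤ t0 + (w0 + 2) / σ → u x s ≤ M) :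
    ∀ x ∈ D1, u x (t0 + (w0 + 2) / σ) ≤ M + 8 * C * Real.exp (-(κ / 2 / ε)) := by
  intro x hx
  set T := (w0 + 2) / σ with hT
  have hTp : 0 < T := by positivity
  have hσT : σ * T = w0 + 2 := by rw [hT]; field_simp
  set k := κ / ε with hk
  have hkp : 0 < k := by positivity
  have hk2 : κ / 2 / ε = k / 2 := by rw [hk]; ring
  rw [hk2]
  by_cases hxr : ‖x‖ ≤ r
  · have := hball x (by simpa using hxr) (t0 + T) (by linarith) le_rfl
    have : 0 ≤ 8 * C * Real.exp (-(k / 2)) := by positivity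
    linarith
  push Not at hxr
  refine le_of_forall_pos_le_add fun η' hη' => ?_
  set η := η' / (1 + T) with hη
  have hηp : 0 < η := by positivity
  have hηe : η + η * T = η' := by rw [hη]; field_simp
  have key := CMP hu hθ hε (K := D ∩ {y | r ≤ ‖y‖}) (U := U ∩ {y | r < ‖y‖})
    (hD.inter_right (isClosed_le continuous_const continuous_norm)) (inter_subset_left.trans hDΩ)
    (hU.inter (isOpen_lt continuous_const continuous_norm))
    (fun y hy => ⟨hUD hy.1, show r ≤ ‖y‖ from le_of_lt hy.2⟩) ht0 (t1 := t0 + T)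
    (fun y s => 4 * C * Real.exp (k * (g y - (w0 + 1 / 2))) + 4 * C * Real.exp (k * (g y - (σ * (s - t0) - 1)))
      + (M + η + η * (s - t0))) ?_ ?_ ?_ ?_ x ⟨hD1 hx, hxr.le⟩ (t0 + T) ⟨by linarith, le_rfl⟩
  · refine key.le.trans ?_
    have g1 := hg1 x hx
    have e1 : Real.exp (k * (g x - (w0 + 1 / 2))) ≤ Real.exp (-(k / 2)) := by
      apply Real.exp_le_exp.2; nlinarith
    have e2 : Real.exp (k * (g x - (σ * (t0 + T - t0) - 1))) ≤ Real.exp (-(k / 2)) := by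
      apply Real.exp_le_exp.2
      have : g x - (σ * (t0 + T - t0) - 1) ≤ -1 := by rw [add_sub_cancel_left, hσT]; linarith
      nlinarith
    have e3 : η * (t0 + T - t0) = η * T := by ring
    rw [e3]
    nlinarith
  · have := hg.continuous
    exact Continuous.continuousOn (by fun_prop)
  · intro y hy s hs
    right
    have hyD := hUD hy.1
    have hyr : r ≤ ‖y‖ := le_of_lt hy.2
    have hA := hu.mem y (hDΩ hyD) s (ht0.trans hs.1)
    obtain ⟨hG1, hG2⟩ := hG y hyD
    have hG0 : 0 ≤ G := (norm_nonneg _).trans hG1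
    have hq : mquad (A y s) (gradient g y) ≤ θ⁻¹ * G ^ 2 :=
      ((hA.2 _).2).trans (by gcongr)
    have hL : Lop ε (A y s) (b y) g y ≤ ε * G - 2 * σ := by
      unfold Lop
      have := mul_le_mul_of_nonneg_left (hG2 _ hA) hε.le
      linarith [hdr y hyD hyr]
    have hbr : k * Lop ε (A y s) (b y) g y + ε * k ^ 2 * mquad (A y s) (gradient g y) ≤ -(k * σ) := by
      have a1 : ε * k ^ 2 * mquad (A y s) (gradient g y) = k * (κ * mquad (A y s) (gradient g y)) := by
        rw [hk]; field_simp
      rw [a1, ← mul_add, ← mul_neg]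
      refine mul_le_mul_of_nonneg_left ?_ hkp.le
      have := mul_le_mul_of_nonneg_left hq hκ.le
      linarith
    obtain ⟨c1, l1⟩ := Lop_exp (ε := ε) (A := A y s) (q := b y) (4 * C) k (w0 + 1 / 2) (hg.contDiffAt (x := y))
    obtain ⟨c2, l2⟩ := Lop_exp (ε := ε) (A := A y s) (q := b y) (4 * C) k (σ * (s - t0) - 1) (hg.contDiffAt (x := y))
    refine ⟨(c1.add c2).add contDiffAt_const, 4 * C * (Real.exp (k * (g y - (σ * (s - t0) - 1))) * -(k * σ)) + η * 1, ?_, ?_⟩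
    · have d1 : HasDerivAt (fun s => k * (g y - (σ * (s - t0) - 1))) (-(k * σ)) s := by
        have := (((((hasDerivAt_id s).sub_const t0).const_mul σ).sub_const 1).const_sub (g y)).const_mul k
        exact this.congr_deriv (by ring)
      have d2 := ((d1.exp.const_mul (4 * C)).const_add (4 * C * Real.exp (k * (g y - (w0 + 1 / 2))))).add
        ((((hasDerivAt_id s).sub_const t0).const_mul η).const_add (M + η))
      exact d2
    · rw [Lop_add (c1.add c2) contDiffAt_const, Lop_add c1 c2, Lop_const, l1, l2]
      have p1 : 0 ≤ 4 * C * Real.exp (k * (g y - (w0 + 1 / 2))) := by positivity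
      have p2 : 0 ≤ 4 * C * Real.exp (k * (g y - (σ * (s - t0) - 1))) := by positivity
      have q1 := mul_le_mul_of_nonneg_left hbr p1
      have q2 := mul_le_mul_of_nonneg_left hbr p2
      have q3 := mul_nonneg p1 (mul_pos hkp hσ).le
      have : (4 * C * Real.exp (k * (g y - (w0 + 1 / 2)))) * -(k * σ) =
        -((4 * C * Real.exp (k * (g y - (w0 + 1 / 2)))) * (k * σ)) := by ring
      have e5 : 4 * C * (Real.exp (k * (g y - (σ * (s - t0) - 1))) * -(k * σ)) =
        4 * C * Real.exp (k * (g y - (σ * (s - t0) - 1))) * -(k * σ) := by ring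
      rw [e5, mul_one]
      linarith
  · intro y hy
    have b1 := (abs_le.1 (hu.bd y (hDΩ hy.1) t0 ht0)).2
    have p1 : 0 ≤ 4 * C * Real.exp (k * (g y - (w0 + 1 / 2))) := by positivity
    have p2 : 1 ≤ Real.exp (k * (g y - (σ * (t0 - t0) - 1))) := by
      apply Real.one_le_exp
      have := hg3 y hy.1
      refine mul_nonneg hkp.le ?_
      rw [sub_self, mul_zero]; linarith
    have p3 : 4 * C ≤ 4 * C * Real.exp (k * (g y - (σ * (t0 - t0) - 1))) := le_mul_of_one_le_right (by positivity) p2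
    have p4 : η * (t0 - t0) = 0 := by ring
    rw [p4]
    linarith
  · intro y hy s hs
    have p1 : 0 ≤ 4 * C * Real.exp (k * (g y - (w0 + 1 / 2))) := by positivity
    have p2 : 0 ≤ 4 * C * Real.exp (k * (g y - (σ * (s - t0) - 1))) := by positivity
    have p3 : 0 ≤ η * (s - t0) := mul_nonneg hηp.le (by linarith [hs.1])
    by_cases hyU : y ∈ U
    · have : ‖y‖ ≤ r := by
        by_contra hc
        push Not at hc
        exact hy.2 ⟨hyU, hc⟩
      have := hball y (by simpa using this) s hs.1 hs.2
      linarith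
    · have b1 := (abs_le.1 (hu.bd y (hDΩ hy.1.1) s (ht0.trans_le hs.1))).2
      have p5 : 1 ≤ Real.exp (k * (g y - (w0 + 1 / 2))) := by
        apply Real.one_le_exp
        have := hg2 y ⟨hy.1.1, hyU⟩
        exact mul_nonneg hkp.le (by linarith)
      have p6 : 4 * C ≤ 4 * C * Real.exp (k * (g y - (w0 + 1 / 2))) := le_mul_of_one_le_right (by positivity) p5
      linarith

end Part14

section Part15

set_option maxHeartbeats 1000000 in
theorem FB {Ω : Set (Eu n)} {b : Eu n → Eu n} {θ ε C : ℝ} (hθ : 0 < θ) (hε : 0 < ε) (hC : 0 < C)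
    {A : Eu n → ℝ → Matrix (Fin n) (Fin n) ℝ} {u : Eu n → ℝ → ℝ} (hu : LS Ω b θ ε C A u)
    {D U : Set (Eu n)} (hD : IsCompact D) (hDΩ : D ⊆ Ω) (hU : IsOpen U) (hUD : U ⊆ D)
    {f : Eu n → ℝ} (hf : ContDiff ℝ 2 f) {G B σ m' s0 r : ℝ} (hB : 0 ≤ B)
    (hG : ∀ x ∈ D, ‖gradient f x‖ ≤ G ∧ (∀ A, memS θ A → trMul A (hessS f x) ≤ G))
    (hbB : ∀ x ∈ D, ‖b x‖ ≤ B) (hεG : ε * G ≤ σ)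
    (hf1 : ∀ x ∈ D, ‖x‖ ≤ r → f x ≤ s0) (hf2 : ∀ x ∈ D \ U, m' ≤ f x)
    {M t0 t1 : ℝ} (ht0 : 0 < t0) (ht01 : t0 ≤ t1) (hM : -C ≤ M)
    (hdr : ∀ x ∈ D, r < ‖x‖ → ∀ t, t0 ≤ t → t ≤ t1 →
      mquad (A x t) (gradient f x) + dotp (b x) (gradient f x) ≤ -σ)
    (h0 : ∀ x ∈ D, u x t0 ≤ M) :
    ∀ x ∈ D, u x t1 ≤ M + 2 * C * Real.exp ((f x - m') / ε) +
      2 * C * Real.exp ((s0 - m') / ε) * (G + (B * G + θ⁻¹ * G ^ 2) / ε) * (t1 - t0) := by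
  intro x hx
  set k := 1 / ε with hk
  have hkp : 0 < k := by positivity
  have hke : ∀ a : ℝ, a / ε = k * a := fun a => by rw [hk]; ring
  have hεk : ε * k = 1 := by rw [hk]; field_simp
  simp only [hke]
  have hG0 : 0 ≤ G := (norm_nonneg _).trans (hG x hx).1
  set R := 2 * C * Real.exp (k * (s0 - m')) * (G + k * (B * G + θ⁻¹ * G ^ 2)) with hR
  have hR0 : 0 ≤ R := by rw [hR]; positivity
  refine le_of_forall_pos_le_add fun η' hη' => ?_
  set η := η' / (1 + (t1 - t0)) with hη
  have hηp : 0 < η := div_pos hη' (by linarith)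
  have hηe : η + η * (t1 - t0) = η' := by
    have : (1 + (t1 - t0)) ≠ 0 := by linarith
    rw [hη]; field_simp
  have key := CMP hu hθ hε (K := D) (U := U) hD hDΩ hU hUD ht0 (t1 := t1)
    (fun y s => 2 * C * Real.exp (k * (f y - m')) + (M + η + (R + η) * (s - t0))) ?_ ?_ ?_ ?_ x hx t1 ⟨ht01, le_rfl⟩
  · linarith
  · have := hf.continuous
    exact Continuous.continuousOn (by fun_prop)
  · intro y hy s hs
    right
    have hyD := hUD hy
    have hA := hu.mem y (hDΩ hyD) s (ht0.trans hs.1)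
    obtain ⟨hG1, hG2⟩ := hG y hyD
    obtain ⟨c1, l1⟩ := Lop_exp (ε := ε) (A := A y s) (q := b y) (2 * C) k m' (hf.contDiffAt (x := y))
    refine ⟨c1.add contDiffAt_const, R + η, ?_, ?_⟩
    · have := (((((hasDerivAt_id s).sub_const t0).const_mul (R + η)).const_add (M + η))).const_add
        (2 * C * Real.exp (k * (f y - m')))
      exact this.congr_deriv (by ring)
    · rw [Lop_add c1 contDiffAt_const, Lop_const, l1]
      have p1 : 0 ≤ 2 * C * Real.exp (k * (f y - m')) := by positivity
      have e1 : ε * k ^ 2 * mquad (A y s) (gradient f y) = k * mquad (A y s) (gradient f y) := by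
        rw [pow_two, ← mul_assoc, hεk, one_mul]
      have hL : Lop ε (A y s) (b y) f y ≤ ε * G + dotp (b y) (gradient f y) := by
        unfold Lop
        have := mul_le_mul_of_nonneg_left (hG2 _ hA) hε.le
        linarith
      rw [e1, ← mul_add]
      by_cases hyr : ‖y‖ ≤ r
      · have a1 : Lop ε (A y s) (b y) f y + mquad (A y s) (gradient f y) ≤ ε * G + (B * G + θ⁻¹ * G ^ 2) := by
          have q1 : mquad (A y s) (gradient f y) ≤ θ⁻¹ * G ^ 2 := ((hA.2 _).2).trans (by gcongr)
          have q2 : dotp (b y) (gradient f y) ≤ B * G :=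
            (le_abs_self _).trans ((abs_dotp_le _ _).trans (mul_le_mul (hbB y hyD) hG1 (norm_nonneg _) hB))
          linarith
        have a2 := mul_le_mul_of_nonneg_left a1 hkp.le
        have a3 : k * (ε * G + (B * G + θ⁻¹ * G ^ 2)) = G + k * (B * G + θ⁻¹ * G ^ 2) := by
          rw [mul_add, ← mul_assoc, mul_comm k ε, hεk, one_mul]
        rw [a3] at a2
        have a4 : Real.exp (k * (f y - m')) ≤ Real.exp (k * (s0 - m')) := by
          apply Real.exp_le_exp.2
          have := hf1 y hyD hyr
          gcongr
        have a5 : 2 * C * Real.exp (k * (f y - m')) * (k * (Lop ε (A y s) (b y) f y + mquad (A y s) (gradient f y))) ≤ R := by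
          refine (mul_le_mul_of_nonneg_left a2 p1).trans ?_
          rw [hR]; gcongr
        linarith
      · push Not at hyr
        have a1 := hdr y hyD hyr s hs.1.le hs.2
        have a2 : k * (Lop ε (A y s) (b y) f y + mquad (A y s) (gradient f y)) ≤ 0 :=
          mul_nonpos_of_nonneg_of_nonpos hkp.le (by linarith)
        have a3 := mul_nonpos_of_nonneg_of_nonpos p1 a2
        linarith
  · intro y hy
    have p1 : 0 ≤ 2 * C * Real.exp (k * (f y - m')) := by positivity
    have := h0 y hy
    simp only [sub_self, mul_zero]
    linarith
  · intro y hy s hs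
    have b1 := (abs_le.1 (hu.bd y (hDΩ hy.1) s (ht0.trans_le hs.1))).2
    have p3 : 0 ≤ (R + η) * (s - t0) := mul_nonneg (by linarith) (by linarith [hs.1])
    have p5 : 1 ≤ Real.exp (k * (f y - m')) := by
      apply Real.one_le_exp
      have := hf2 y hy
      exact mul_nonneg hkp.le (by linarith)
    have p6 : 2 * C ≤ 2 * C * Real.exp (k * (f y - m')) := le_mul_of_one_le_right (by positivity) p5
    linarith

end Part15

section Part16

/-! ### Geometry near the boundary and a global Lyapunov function -/

theorem near_bdry {Ω : Set (Eu n)} {ρ : Eu n → ℝ} (hb : Bornology.IsBounded Ω) (hρ : Continuous ρ)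
    (hΩ : Ω = {x | ρ x < 0}) {q : Eu n → ℝ} (hq : ContinuousOn q (closure Ω))
    (hqf : ∀ x ∈ frontier Ω, 0 < q x) : ∃ d > 0, ∀ x ∈ Ω, -d ≤ ρ x → 0 < q x := by
  have hΩo : IsOpen Ω := by rw [hΩ]; exact isOpen_lt hρ continuous_const
  have hc : IsCompact (closure Ω) := hb.isCompact_closure
  set Z := closure Ω ∩ q ⁻¹' Iic 0 with hZ
  have hZc : IsCompact Z := hc.of_isClosed_subset
    (hq.preimage_isClosed_of_isClosed isClosed_closure isClosed_Iic) inter_subset_left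
  have hZΩ : ∀ x ∈ Z, ρ x < 0 := by
    intro x hx
    by_contra hcon
    have hxΩ : x ∉ Ω := by rw [hΩ]; exact hcon
    have : x ∈ frontier Ω := by rw [hΩo.frontier_eq]; exact ⟨hx.1, hxΩ⟩
    exact absurd hx.2 (not_le.2 (hqf x this))
  rcases Z.eq_empty_or_nonempty with he | hne
  · refine ⟨1, one_pos, fun x hx _ => ?_⟩
    by_contra hcon
    have : x ∈ Z := ⟨subset_closure hx, not_lt.1 hcon⟩
    rw [he] at this; exact this
  · obtain ⟨z, hz, hmax⟩ := hZc.exists_isMaxOn hne hρ.continuousOn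
    have hz0 := hZΩ z hz
    refine ⟨-ρ z / 2, by linarith, fun x hx hxd => ?_⟩
    by_contra hcon
    have : x ∈ Z := ⟨subset_closure hx, not_lt.1 hcon⟩
    have := hmax this
    simp only [mem_setOf_eq] at this
    linarith

theorem Dd_compact {Ω : Set (Eu n)} {ρ : Eu n → ℝ} (hb : Bornology.IsBounded Ω) (hρ : Continuous ρ)
    (hΩ : Ω = {x | ρ x < 0}) {d : ℝ} (hd : 0 < d) : IsCompact {x | ρ x ≤ -d} ∧ {x | ρ x ≤ -d} ⊆ Ω := by
  have h1 : {x | ρ x ≤ -d} ⊆ Ω := by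
    intro x hx; rw [hΩ]
    have : ρ x ≤ -d := hx
    show ρ x < 0
    linarith
  exact ⟨Metric.isCompact_of_isClosed_isBounded (isClosed_le hρ continuous_const) (hb.subset h1), h1⟩

theorem dotp_add_right (x y z : Eu n) : dotp x (y + z) = dotp x y + dotp x z := by
  simp only [dotp_eq_inner, inner_add_right]

theorem dotp_smul_right (x y : Eu n) (c : ℝ) : dotp x (c • y) = c * dotp x y := by
  simp only [dotp_eq_inner, inner_smul_right]

theorem gradient_add' {φ ψ : Eu n → ℝ} {x : Eu n} (hφ : DifferentiableAt ℝ φ x)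
    (hψ : DifferentiableAt ℝ ψ x) : gradient (fun y => φ y + ψ y) x = gradient φ x + gradient ψ x := by
  unfold gradient
  rw [fderiv_fun_add hφ hψ, map_add]

theorem gradient_cmul {φ : Eu n → ℝ} {x : Eu n} (c : ℝ) (hφ : DifferentiableAt ℝ φ x) :
    gradient (fun y => c * φ y) x = c • gradient φ x := by
  unfold gradient
  rw [fderiv_const_mul hφ, map_smul]

/-- mollification with zero second order part -/
theorem moll0 {f : Eu n → ℝ} {K : NNReal} (hf : LipschitzWith K f) {D Ω : Set (Eu n)} (hD : IsCompact D)
    (hΩ : IsOpen Ω) (hDΩ : D ⊆ Ω) {b : Eu n → Eu n} {k : Eu n → ℝ} (hb : Continuous b)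
    (hk : ContinuousOn k Ω)
    (hH : ∀ z ∈ Ω, DifferentiableAt ℝ f z → dotp (b z) (gradient f z) + k z ≤ 0) {γ : ℝ} (hγ : 0 < γ) :
    ∃ g : Eu n → ℝ, ContDiff ℝ 2 g ∧ (∀ x, |g x - f x| ≤ γ) ∧
      ∀ x ∈ D, dotp (b x) (gradient g x) + k x ≤ γ := by
  have h0 : ∀ p : Eu n, mquad (0 : Matrix (Fin n) (Fin n) ℝ) p = 0 := by intro p; simp [mquad]
  have := moll hf hD hΩ hDΩ (α := fun _ => 0) (b := b) (k := k) continuousOn_const hb hk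
    (fun x _ => ⟨Matrix.isSymm_zero, fun p => (h0 p).ge⟩)
    (fun z hz hd => by unfold Ham; rw [h0, zero_add]; exact hH z hz hd) hγ
  obtain ⟨g, h1, h2, h3⟩ := this
  refine ⟨g, h1, h2, fun x hx => ?_⟩
  have := h3 x hx
  unfold Ham at this; rw [h0, zero_add] at this; exact this

theorem ext_C1 {Ω : Set (Eu n)} (hb : Bornology.IsBounded Ω) (hΩo : IsOpen Ω) {q : Eu n → ℝ}
    (hq : ContDiff ℝ 1 q) : ∃ (f : Eu n → ℝ) (K : NNReal), LipschitzWith K f ∧ (∀ x ∈ Ω, f x = q x) ∧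
      ∀ x ∈ Ω, gradient f x = gradient q x := by
  obtain ⟨R, hR⟩ := hb.subset_closedBall (0 : Eu n)
  have hcd : Continuous (fderiv ℝ q) := hq.continuous_fderiv one_ne_zero
  obtain ⟨Cq, hCq⟩ := (isCompact_closedBall (0 : Eu n) R).exists_bound_of_continuousOn hcd.continuousOn
  have hL : LipschitzOnWith (Real.toNNReal Cq) q (closedBall (0 : Eu n) R) := by
    refine (convex_closedBall _ _).lipschitzOnWith_of_nnnorm_fderiv_le
      (fun x _ => hq.differentiable one_ne_zero x) fun x hx => ?_
    rw [← NNReal.coe_le_coe, coe_nnnorm]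
    exact (hCq x hx).trans (Real.le_coe_toNNReal _)
  obtain ⟨f, hf, hfe⟩ := hL.extend_real
  refine ⟨f, _, hf, fun x hx => (hfe (hR hx)).symm, fun x hx => ?_⟩
  have : f =ᶠ[𝓝 x] q := by
    filter_upwards [hΩo.mem_nhds hx] with y hy using (hfe (hR hy)).symm
  unfold gradient; rw [this.fderiv_eq]

theorem gradient_exp_comp {ρ : Eu n → ℝ} (hρ : ContDiff ℝ 1 ρ) (K c : ℝ) (x : Eu n) :
    gradient (fun y => Real.exp (K * (ρ y + c))) x = (K * Real.exp (K * (ρ x + c))) • gradient ρ x := by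
  have h1 : HasFDerivAt (fun y => K * (ρ y + c)) (K • fderiv ℝ ρ x) x :=
    ((hρ.differentiable one_ne_zero x).hasFDerivAt.add_const c).const_mul K
  have h2 := h1.exp
  unfold gradient
  rw [h2.fderiv, smul_smul, map_smul, mul_comm]

set_option maxHeartbeats 1000000 in
theorem lyap_g {Ω : Set (Eu n)} {ρ : Eu n → ℝ} (hbd : Bornology.IsBounded Ω) (hρ : ContDiff ℝ 1 ρ)
    (hΩ : Ω = {x | ρ x < 0}) {b : Eu n → Eu n} {L : NNReal} (hb : LipschitzWith L b)
    {X : ℝ → Eu n → Eu n} (hX : GAS b X) {d r : ℝ} (hd : 0 < d) (hr : 0 < r)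
    (hdb : ∀ x ∈ Ω, -(3 * d) ≤ ρ x → dotp (b x) (gradient ρ x) ≤ 0) :
    ∃ (g : Eu n → ℝ) (w0 σ : ℝ), ContDiff ℝ 2 g ∧ 0 < σ ∧ 0 ≤ w0 ∧
      (∀ x, ρ x ≤ -d → r ≤ ‖x‖ → dotp (b x) (gradient g x) ≤ -(2 * σ)) ∧
      (∀ x, ρ x ≤ -(3 * d) → g x ≤ w0) ∧ (∀ x, ρ x = -d → w0 + 1 ≤ g x) ∧
      (∀ x, ρ x ≤ -d → -1 ≤ g x) := by
  have hΩo : IsOpen Ω := by rw [hΩ]; exact isOpen_lt hρ.continuous continuous_const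
  obtain ⟨hDc, hDΩ⟩ := Dd_compact hbd hρ.continuous hΩ hd
  obtain ⟨W, Kw, δ, hδ, hWL, hW0, -, hWd⟩ := lyap hb hX hbd.isCompact_closure (half_pos hr)
  set γ := min (r / 8) (1 / 4) with hγ
  have hγp : 0 < γ := by rw [hγ]; positivity
  have hγ1 : γ ≤ r / 8 := min_le_left _ _
  have hγ2 : γ ≤ 1 / 4 := min_le_right _ _
  obtain ⟨gW, hgW, hgWf, hgWd⟩ := moll0 hWL hDc hΩo hDΩ hb.continuous
    (k := fun z => max (‖z‖ - r / 2) 0) (by fun_prop) (fun z hz hdz => hWd z (subset_closure hz) hdz) hγp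
  obtain ⟨Wm, hWm⟩ := hDc.exists_bound_of_continuousOn hWL.continuous.continuousOn
  have hgc : Continuous (fun x => dotp (b x) (gradient ρ x)) := by
    simp only [dotp_eq_inner]
    have : Continuous (gradient ρ) := by
      unfold gradient
      exact (LinearIsometryEquiv.continuous _).comp (hρ.continuous_fderiv one_ne_zero)
    exact hb.continuous.inner this
  obtain ⟨B, hB⟩ := hDc.exists_bound_of_continuousOn hgc.continuousOn
  have t1 : Tendsto (fun K : ℝ => K * Real.exp (-(K * d)) * |B|) atTop (𝓝 0) := by
    have h := Real.tendsto_pow_mul_exp_neg_atTop_nhds_zero 1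
    have h2 : Tendsto (fun K : ℝ => K * d) atTop atTop := tendsto_id.atTop_mul_const hd
    have h3 := (h.comp h2).mul_const (|B| / d)
    rw [zero_mul] at h3
    refine h3.congr fun K => ?_
    simp only [Function.comp, pow_one]
    field_simp
  have t2 : Tendsto (fun K : ℝ => Real.exp (K * d)) atTop atTop :=
    Real.tendsto_exp_atTop.comp (tendsto_id.atTop_mul_const hd)
  obtain ⟨K, hK1, hK2, hK0⟩ := ((t1.eventually_lt_const (show (0:ℝ) < r / 8 by positivity)).and
    ((t2.eventually_ge_atTop (|Wm| + 5)).and (eventually_ge_atTop (0:ℝ)))).exists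
  have hqC : ContDiff ℝ 1 (fun y => Real.exp (K * (ρ y + 2 * d))) := by fun_prop
  obtain ⟨q, Kq, hqL, hqe, hqg⟩ := ext_C1 hbd hΩo hqC
  have hbq : ∀ x ∈ Ω, dotp (b x) (gradient q x) = K * Real.exp (K * (ρ x + 2 * d)) * dotp (b x) (gradient ρ x) := by
    intro x hx; rw [hqg x hx, gradient_exp_comp hρ, dotp_smul_right]
  have hkc : Continuous (fun x => -(K * Real.exp (K * (ρ x + 2 * d)) * dotp (b x) (gradient ρ x))) := by
    have := hρ.continuous
    fun_prop
  obtain ⟨gq, hgq, hgqf, hgqd⟩ := moll0 hqL hDc hΩo hDΩ hb.continuous hkc.continuousOn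
    (fun z hz _ => by rw [hbq z hz]; linarith) hγp
  have hbq2 : ∀ x, ρ x ≤ -d → K * Real.exp (K * (ρ x + 2 * d)) * dotp (b x) (gradient ρ x) ≤ r / 8 := by
    intro x hx
    by_cases h3 : -(3 * d) ≤ ρ x
    · have := hdb x (hDΩ hx) h3
      have h4 : 0 ≤ K * Real.exp (K * (ρ x + 2 * d)) := by positivity
      nlinarith [mul_nonpos_of_nonneg_of_nonpos h4 this]
    · push Not at h3
      have e1 : Real.exp (K * (ρ x + 2 * d)) ≤ Real.exp (-(K * d)) := by
        apply Real.exp_le_exp.2; nlinarith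
      have e2 : dotp (b x) (gradient ρ x) ≤ |B| :=
        (le_abs_self _).trans ((hB x hx).trans (le_abs_self _))
      calc _ ≤ K * Real.exp (K * (ρ x + 2 * d)) * |B| := by gcongr
        _ ≤ K * Real.exp (-(K * d)) * |B| := by gcongr
        _ ≤ _ := hK1.le
  have hWb : ∀ x, ρ x ≤ -d → W x ≤ |Wm| := fun x hx =>
    (le_abs_self _).trans ((hWm x hx).trans (le_abs_self _))
  refine ⟨fun x => gW x + gq x, |Wm| + 3, r / 16, hgW.add hgq, by positivity, by positivity, ?_, ?_, ?_, ?_⟩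
  · intro x hx hrx
    rw [gradient_add' (hgW.differentiable two_ne_zero x) (hgq.differentiable two_ne_zero x), dotp_add_right]
    have e1 := hgWd x hx
    have e2 := hgqd x hx
    have e3 := hbq2 x hx
    have e4 := le_max_left (‖x‖ - r / 2) 0
    linarith
  · intro x hx
    have hx' : ρ x ≤ -d := by linarith
    have e1 := (abs_le.1 (hgWf x)).2
    have e2 := (abs_le.1 (hgqf x)).2
    have e3 := hWb x hx'
    have e4 : q x ≤ 1 := by
      rw [hqe x (hDΩ hx')]; apply Real.exp_le_one_iff.2
      apply mul_nonpos_of_nonneg_of_nonpos hK0; linarith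
    show gW x + gq x ≤ _
    linarith
  · intro x hx
    have e1 := (abs_le.1 (hgWf x)).1
    have e2 := (abs_le.1 (hgqf x)).1
    have e3 := hW0 x
    have e4 : |Wm| + 5 ≤ q x := by
      rw [hqe x (hDΩ hx.le), hx]
      have : K * (-d + 2 * d) = K * d := by ring
      rw [this]; exact hK2
    show _ ≤ gW x + gq x
    linarith
  · intro x hx
    have e1 := (abs_le.1 (hgWf x)).1
    have e2 := (abs_le.1 (hgqf x)).1
    have e3 := hW0 x
    have e4 : 0 ≤ q x := by
      rw [hqe x (hDΩ hx)]; positivity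
    show _ ≤ gW x + gq x
    linarith

end Part16

section Part17

/-! ### Quasi-potential: approximating subsolutions -/

theorem hasG_lin (p z y : Eu n) : HasGradientAt (fun y : Eu n => dotp p (y - z)) p y := by
  have h1 : (fun y : Eu n => dotp p (y - z)) = fun y => (innerSL ℝ p) y - (innerSL ℝ p) z := by
    funext y; rw [dotp_eq_inner, inner_sub_right]; rfl
  rw [h1, hasGradientAt_iff_hasFDerivAt]
  refine ((innerSL ℝ p).hasFDerivAt.sub_const _).congr_fderiv ?_
  ext w; simp

theorem contDiff_lin (p z : Eu n) : ContDiff ℝ 1 (fun y : Eu n => dotp p (y - z)) := by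
  have h1 : (fun y : Eu n => dotp p (y - z)) = fun y => (innerSL ℝ p) y - (innerSL ℝ p) z := by
    funext y; rw [dotp_eq_inner, inner_sub_right]; rfl
  rw [h1]
  exact (innerSL ℝ p).contDiff.sub contDiff_const

theorem gradient_lin_sq (p z y : Eu n) (k : ℝ) :
    gradient (fun y : Eu n => dotp p (y - z) + k * ‖y - z‖ ^ 2) y = p + (2 * k) • (y - z) := by
  have hd2 : DifferentiableAt ℝ (fun y : Eu n => ‖y - z‖ ^ 2) y :=
    (contDiff_sqd z).differentiable two_ne_zero y
  rw [gradient_add' (hasG_lin p z y).differentiableAt (hd2.const_mul k), gradient_cmul k hd2,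
    gradient_sqd, smul_smul, (hasG_lin p z y).gradient, mul_comm]

theorem visc_diff {Ω : Set (Eu n)} (hΩ : IsOpen Ω) {α : Eu n → Matrix (Fin n) (Fin n) ℝ}
    {b : Eu n → Eu n} (hα : ContinuousOn α Ω) (hb : Continuous b) {v : Eu n → ℝ} (hv : Continuous v)
    (hs : ViscSub (Ham α b) Ω v) {z : Eu n} (hz : z ∈ Ω) (hd : DifferentiableAt ℝ v z) :
    Ham α b z (gradient v z) ≤ 0 := by
  set p := gradient v z with hp
  by_contra hcon
  push Not at hcon
  have hG : ContinuousOn (fun q : Eu n × Eu n => Ham α b q.1 q.2) (Ω ×ˢ univ) := by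
    refine (mquad_continuousOn hα).add ?_
    have : Continuous (fun q : Eu n × Eu n => dotp (b q.1) q.2) := by
      simp only [dotp_eq_inner]; fun_prop
    exact this.continuousOn
  have hGa : ContinuousAt (fun q : Eu n × Eu n => Ham α b q.1 q.2) (z, p) :=
    hG.continuousAt ((hΩ.prod isOpen_univ).mem_nhds ⟨hz, mem_univ _⟩)
  have hpos := hGa.eventually (lt_mem_nhds hcon)
  rw [nhds_prod_eq] at hpos
  obtain ⟨pa, hpa, pb, hpb, hab⟩ := eventually_prod_iff.1 hpos
  obtain ⟨η, hη, hηb⟩ := Metric.eventually_nhds_iff_ball.1 hpb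
  have hlo := hd.hasFDerivAt.isLittleO.def (show 0 < η / 4 by positivity)
  obtain ⟨δ, hδ, hδb⟩ := Metric.nhds_basis_closedBall.eventually_iff.1
    (hlo.and (hpa.and (hΩ.mem_nhds hz)))
  set k := η / (2 * δ) with hk
  have hkp : 0 < k := by positivity
  have hkd : k * δ = η / 2 := by rw [hk]; field_simp
  set φ : Eu n → ℝ := fun y => dotp p (y - z) + k * ‖y - z‖ ^ 2 with hφ
  have hφC : ContDiff ℝ 1 φ := by
    have h1 : ContDiff ℝ 1 (fun y : Eu n => k * ‖y - z‖ ^ 2) :=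
      ((contDiff_sqd z).of_le one_le_two).const_smul k
    exact (contDiff_lin p z).add h1
  obtain ⟨y, hy, hmax⟩ := (isCompact_closedBall z δ).exists_isMaxOn ⟨z, by simp [hδ.le]⟩
    (hv.sub hφC.continuous).continuousOn
  have h1 := hmax (show z ∈ closedBall z δ by simp [hδ.le])
  simp only [mem_setOf_eq, hφ, Pi.sub_apply, sub_self, norm_zero] at h1
  have hp0 : dotp p (0 : Eu n) = 0 := by rw [dotp_eq_inner]; simp
  rw [hp0] at h1
  obtain ⟨h2, h3, h4⟩ := hδb hy
  have h5 : fderiv ℝ v z (y - z) = dotp p (y - z) := by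
    rw [← dotp_gradient, hp, dotp_eq_inner, dotp_eq_inner, real_inner_comm]
  rw [h5, Real.norm_eq_abs] at h2
  have h6 := (abs_le.1 h2).2
  have h7 : k * ‖y - z‖ ^ 2 ≤ η / 4 * ‖y - z‖ := by
    have : k * (0:ℝ) ^ 2 = 0 := by ring
    linarith
  have h8 : k * ‖y - z‖ ≤ η / 4 := by
    rcases (norm_nonneg (y - z)).eq_or_lt with h0 | h0
    · rw [← h0]; simp; positivity
    · have : k * ‖y - z‖ * ‖y - z‖ ≤ η / 4 * ‖y - z‖ := by linarith [sq (‖y - z‖)]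
      exact le_of_mul_le_mul_right this h0
  have h9 : ‖y - z‖ < δ := by
    by_contra hc
    push Not at hc
    have : k * δ ≤ k * ‖y - z‖ := by gcongr
    linarith
  have h10 : Ham α b y (gradient φ y) ≤ 0 := by
    refine hs φ hφC y h4 ?_
    have hnb : closedBall z δ ∈ 𝓝 y :=
      Filter.mem_of_superset (isOpen_ball.mem_nhds (by rw [mem_ball, dist_eq_norm]; exact h9)) ball_subset_closedBall
    have : IsLocalMax (fun y => v y - φ y) y := by
      filter_upwards [hnb] with w hw using hmax hw
    exact this.on Ω
  rw [hφ, gradient_lin_sq] at h10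
  have h11 := hab h3 (hηb (p + (2 * k) • (y - z)) (by
    rw [mem_ball, dist_eq_norm, add_sub_cancel_left, norm_smul, Real.norm_eq_abs, abs_of_pos (by positivity)]
    linarith))
  exact absurd h10 (not_le.2 h11)

theorem qp_sub {Ω : Set (Eu n)} (hΩ : IsOpen Ω) (hbd : Bornology.IsBounded Ω) (h0 : (0 : Eu n) ∈ Ω)
    {α : Eu n → Matrix (Fin n) (Fin n) ℝ} {b : Eu n → Eu n} (hα : ContinuousOn α Ω) (hb : Continuous b)
    {m : ℝ} (hm : 0 ≤ m) (hM : m < Mq α b Ω) :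
    ∃ (v : Eu n → ℝ) (K : NNReal), LipschitzWith K v ∧ v 0 = 0 ∧ (∀ x ∈ frontier Ω, m < v x) ∧
      ∀ z ∈ Ω, DifferentiableAt ℝ v z → Ham α b z (gradient v z) ≤ 0 := by
  have hfc : IsCompact (frontier Ω) := hbd.isCompact_closure.of_isClosed_subset isClosed_frontier
    frontier_subset_closure
  have hH0 : ∀ x, Ham α b x 0 = 0 := by intro x; simp [Ham, mquad, dotp]
  have hbb : BddBelow (Vq α b Ω '' frontier Ω) := by
    by_contra hc
    rw [Mq, Real.sInf_of_not_bddBelow hc] at hM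
    linarith
  have key : ∃ (v : Eu n → ℝ), (∃ K : NNReal, LipschitzWith K v) ∧ v 0 = 0 ∧ ViscSub (Ham α b) Ω v ∧
      (∀ x ∈ frontier Ω, m < v x) := by
    refine hfc.induction_on (p := fun s => ∃ (v : Eu n → ℝ), (∃ K : NNReal, LipschitzWith K v) ∧ v 0 = 0 ∧
      ViscSub (Ham α b) Ω v ∧ (∀ x ∈ s, m < v x)) ?_ ?_ ?_ ?_
    · refine ⟨fun _ => 0, ⟨0, LipschitzWith.const 0⟩, rfl, ?_, by simp⟩
      intro φ hφ x hx hmax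
      have h1 : IsLocalMax (fun y => (0:ℝ) - φ y) x := by
        have := hmax.isLocalMax (hΩ.mem_nhds hx)
        exact this
      have h2 := h1.fderiv_eq_zero
      have h3 : gradient φ x = 0 := by
        unfold gradient
        have : fderiv ℝ (fun y => (0:ℝ) - φ y) x = - fderiv ℝ φ x := by
          rw [fderiv_const_sub]
        rw [this, neg_eq_zero] at h2
        rw [h2, map_zero]
      rw [h3, hH0]
    · rintro s t hst ⟨v, h1, h2, h3, h4⟩
      exact ⟨v, h1, h2, h3, fun x hx => h4 x (hst hx)⟩
    · rintro s t ⟨v, ⟨K, h1⟩, h2, h3, h4⟩ ⟨v', ⟨K', h1'⟩, h2', h3', h4'⟩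
      refine ⟨fun x => max (v x) (v' x), ⟨_, h1.max h1'⟩, by simp [h2, h2'], ?_, ?_⟩
      · intro φ hφ x hx hmax
        rcases le_total (v x) (v' x) with h | h
        · refine h3' φ hφ x hx ?_
          filter_upwards [hmax] with y hy
          simp only [max_eq_right h] at hy
          linarith [le_max_right (v y) (v' y)]
        · refine h3 φ hφ x hx ?_
          filter_upwards [hmax] with y hy
          simp only [max_eq_left h] at hy
          linarith [le_max_left (v y) (v' y)]
      · rintro x (hx | hx)
        · exact lt_max_of_lt_left (h4 x hx)
        · exact lt_max_of_lt_right (h4' x hx)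
    · intro x hx
      have h1 : m < Vq α b Ω x := lt_of_lt_of_le hM (csInf_le hbb ⟨x, hx, rfl⟩)
      unfold Vq at h1
      have hne : {r | ∃ u : Eu n → ℝ, (∃ K : NNReal, LipschitzOnWith K u (closure Ω)) ∧
          u 0 = 0 ∧ ViscSub (Ham α b) Ω u ∧ r = u x}.Nonempty := by
        by_contra hc
        rw [not_nonempty_iff_eq_empty] at hc
        rw [hc, Real.sSup_empty] at h1
        linarith
      obtain ⟨r, ⟨u, ⟨K, hK⟩, hu0, huv, rfl⟩, hr⟩ := exists_lt_of_lt_csSup hne h1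
      obtain ⟨w, hw, hwe⟩ := hK.extend_real
      refine ⟨{y | m < w y}, ?_, w, ⟨K, hw⟩, ?_, ?_, fun y hy => hy⟩
      · apply mem_nhdsWithin_of_mem_nhds
        refine (isOpen_lt continuous_const hw.continuous).mem_nhds ?_
        show m < w x
        rw [← hwe (frontier_subset_closure hx)]; exact hr
      · rw [← hwe (subset_closure h0), hu0]
      · intro φ hφ y hy hmax
        refine huv φ hφ y hy ?_
        filter_upwards [hmax, self_mem_nhdsWithin] with z hz hzΩ
        simp only [← hwe (subset_closure hy), ← hwe (subset_closure hzΩ)] at hz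
        exact hz
  obtain ⟨v, ⟨K, h1⟩, h2, h3, h4⟩ := key
  exact ⟨v, K, h1, h2, h4, fun z hz hd => visc_diff hΩ hα hb h1.continuous h3 hz hd⟩

end Part17

section Part18

/-! ### The barrier for the final comparison -/

theorem mquad_convex {A : Matrix (Fin n) (Fin n) ℝ} (hA : A.IsSymm) (hp : ∀ p : Eu n, 0 ≤ mquad A p)
    (p q : Eu n) {s : ℝ} (hs : 0 ≤ s) (hs1 : s ≤ 1) :
    mquad A ((1 - s) • p + s • q) ≤ (1 - s) * mquad A p + s * mquad A q := by
  set P := (1 - s) • p + s • q with hP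
  have h1 := mquad_tangent hA hp P p
  have h2 := mquad_tangent hA hp P q
  have h3 : mquad A P = (1 - s) * dotp (mv A P) p + s * dotp (mv A P) q := by
    rw [mquad_eq_inner, real_inner_comm, ← dotp_eq_inner, ← dotp_smul_right, ← dotp_smul_right,
      ← dotp_add_right]
  have h4 := mul_le_mul_of_nonneg_left h1 (by linarith : 0 ≤ 1 - s)
  have h5 := mul_le_mul_of_nonneg_left h2 hs
  linarith

set_option maxHeartbeats 1000000 in
theorem bar_f {Ω D : Set (Eu n)} (hΩ : IsOpen Ω) (hD : IsCompact D) (hDΩ : D ⊆ Ω) {θ : ℝ} (hθ : 0 < θ)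
    {α : Eu n → Matrix (Fin n) (Fin n) ℝ} (hα : ContinuousOn α Ω) (hm : ∀ x ∈ Ω, memS θ (α x))
    {b : Eu n → Eu n} (hb : Continuous b) {v : Eu n → ℝ} {K : NNReal} (hv : LipschitzWith K v)
    (hv0 : v 0 = 0) (hvH : ∀ z ∈ Ω, DifferentiableAt ℝ v z → Ham α b z (gradient v z) ≤ 0)
    {g : Eu n → ℝ} (hg : ContDiff ℝ 2 g) {σ r gap m1 : ℝ} (hσ : 0 < σ) (hgap : 0 < gap)
    (hgd : ∀ x ∈ D, r ≤ ‖x‖ → dotp (b x) (gradient g x) ≤ -(2 * σ)) (hKr : K * r ≤ gap / 8) :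
    ∃ (f : Eu n → ℝ) (σ2 : ℝ), ContDiff ℝ 2 f ∧ 0 < σ2 ∧
      (∀ x ∈ D, r ≤ ‖x‖ → Ham α b x (gradient f x) ≤ -(2 * σ2)) ∧
      (∀ x ∈ D, ‖x‖ ≤ r → f x ≤ gap / 4) ∧ (∀ x ∈ D, m1 ≤ v x → m1 - gap / 4 ≤ f x) := by
  obtain ⟨G, hG, hGb⟩ := C2_bounds hg hD hθ
  obtain ⟨V1, hV1⟩ := hD.exists_bound_of_continuousOn hv.continuous.continuousOn
  obtain ⟨G1, hG1⟩ := hD.exists_bound_of_continuousOn hg.continuous.continuousOn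
  set κ := σ / (θ⁻¹ * G ^ 2) with hκ
  have hκp : 0 < κ := by positivity
  have hκe : κ * (θ⁻¹ * G ^ 2) = σ := by rw [hκ]; field_simp
  set Y := κ * |G1| + |V1| + 1 with hY
  have hYp : 0 < Y := by positivity
  set s := min (1 / 2) (gap / 16 / Y) with hs
  have hsp : 0 < s := by rw [hs]; positivity
  have hs1 : s ≤ 1 := (min_le_left _ _).trans (by norm_num)
  have hsY : s * Y ≤ gap / 16 := by
    have := min_le_right (1 / 2) (gap / 16 / Y)
    rw [← hs] at this
    rwa [le_div_iff₀ hYp] at this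
  set γ := min 1 (min (gap / 16) (s * κ * σ / 2)) with hγ
  have hγp : 0 < γ := by rw [hγ]; positivity
  have hγ1 : γ ≤ 1 := min_le_left _ _
  have hγ2 : γ ≤ gap / 16 := (min_le_right _ _).trans (min_le_left _ _)
  have hγ3 : γ ≤ s * κ * σ / 2 := (min_le_right _ _).trans (min_le_right _ _)
  have hpos : ∀ x ∈ Ω, ∀ p, 0 ≤ mquad (α x) p := fun x hx p =>
    le_trans (by positivity) ((hm x hx).2 p).1
  obtain ⟨w, hw, hwv, hwH⟩ := moll hv hD hΩ hDΩ hα hb (k := fun _ => 0) continuousOn_const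
    (fun x hx => ⟨(hm x hx).1, hpos x hx⟩) (fun z hz hd => by simpa using hvH z hz hd) hγp
  have hdiff : ∀ x ∈ D, |s * (κ * g x - w x)| ≤ gap / 16 := by
    intro x hx
    have e1 : |g x| ≤ |G1| := (hG1 x hx).trans (le_abs_self _)
    have e2 : |w x| ≤ |V1| + 1 := by
      have h1 := hwv x
      have h2 : |v x| ≤ |V1| := (hV1 x hx).trans (le_abs_self _)
      have h3 : |w x| ≤ |w x - v x| + |v x| := by
        have := abs_add_le (w x - v x) (v x); simpa using this
      linarith
    have e3 : |κ * g x - w x| ≤ Y := by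
      calc |κ * g x - w x| ≤ |κ * g x| + |w x| := abs_sub _ _
        _ = κ * |g x| + |w x| := by rw [abs_mul, abs_of_pos hκp]
        _ ≤ κ * |G1| + (|V1| + 1) := by gcongr
        _ = Y := by rw [hY]; ring
    rw [abs_mul, abs_of_pos hsp]
    exact (mul_le_mul_of_nonneg_left e3 hsp.le).trans hsY
  refine ⟨fun x => (1 - s) * w x + s * (κ * g x), s * κ * σ / 4, ?_, by positivity, ?_, ?_, ?_⟩
  · exact (contDiff_const.mul hw).add (contDiff_const.mul (contDiff_const.mul hg))
  · intro x hx hrx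
    have dw := hw.differentiable two_ne_zero x
    have dg := hg.differentiable two_ne_zero x
    have eg : gradient (fun x => (1 - s) * w x + s * (κ * g x)) x =
        (1 - s) • gradient w x + s • (κ • gradient g x) := by
      rw [gradient_add' (dw.const_mul _) ((dg.const_mul _).const_mul _), gradient_cmul _ dw,
        gradient_cmul _ (dg.const_mul _), gradient_cmul _ dg]
    rw [eg]
    unfold Ham
    have c1 := mquad_convex (hm x (hDΩ hx)).1 (hpos x (hDΩ hx)) (gradient w x) (κ • gradient g x) hsp.le hs1
    rw [dotp_add_right, dotp_smul_right, dotp_smul_right, dotp_smul_right]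
    have c2 := hwH x hx
    unfold Ham at c2
    rw [mquad_smul_vec] at c1
    have c3 := ((hm x (hDΩ hx)).2 (gradient g x)).2
    have c4 : θ⁻¹ * ‖gradient g x‖ ^ 2 ≤ θ⁻¹ * G ^ 2 := by gcongr; exact (hGb x hx).1
    have c5 : κ ^ 2 * mquad (α x) (gradient g x) ≤ κ * σ := by
      calc κ ^ 2 * mquad (α x) (gradient g x) ≤ κ ^ 2 * (θ⁻¹ * G ^ 2) := by gcongr; linarith
        _ = κ * (κ * (θ⁻¹ * G ^ 2)) := by ring
        _ = κ * σ := by rw [hκe]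
    have c6 := mul_le_mul_of_nonneg_left (hgd x hx hrx) hκp.le
    have c7 : s * (κ ^ 2 * mquad (α x) (gradient g x) + κ * dotp (b x) (gradient g x)) ≤ s * (-(κ * σ)) := by
      apply mul_le_mul_of_nonneg_left _ hsp.le; linarith
    have c8 : (1 - s) * (mquad (α x) (gradient w x) + dotp (b x) (gradient w x)) ≤ (1 - s) * γ := by
      apply mul_le_mul_of_nonneg_left _ (by linarith); linarith
    have c9 : 0 ≤ s * γ := by positivity
    linarith
  · intro x hx hrx
    have e1 := (abs_le.1 (hdiff x hx)).2
    have e2 := (abs_le.1 (hwv x)).2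
    have e3 : v x ≤ gap / 8 := by
      have := hv.dist_le_mul x 0
      rw [hv0, Real.dist_eq, sub_zero, dist_zero_right] at this
      have h2 : (K : ℝ) * ‖x‖ ≤ K * r := by gcongr
      linarith [le_abs_self (v x)]
    show (1 - s) * w x + s * (κ * g x) ≤ _
    linarith
  · intro x hx hvx
    have e1 := (abs_le.1 (hdiff x hx)).1
    have e2 := (abs_le.1 (hwv x)).1
    show _ ≤ (1 - s) * w x + s * (κ * g x)
    linarith

end Part18

section Part19

/-! ### From the setting to linear solutions -/

theorem LS_of (S : SettingB n) {ε C : ℝ} {u : Eu n → ℝ → ℝ} (hu : S.SolvesQL ε u)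
    (hbd : ∀ x ∈ S.Ω, ∀ t > (0:ℝ), |u x t| ≤ C) :
    LS S.Ω S.b S.θ₀ ε C (fun x t => S.a x (u x t)) u := by
  obtain ⟨⟨h1, h2, h3, h4⟩, h5⟩ := hu
  have hsub : S.Ω ×ˢ Ioi 0 ⊆ cylC S.Ω ⊤ := fun p hp => ⟨subset_closure hp.1, le_of_lt hp.2, le_top⟩
  have hsub2 : S.Ω ×ˢ Ioi 0 ⊆ cylO S.Ω ⊤ := fun p hp => ⟨hp.1, hp.2, ENNReal.ofReal_lt_top⟩
  refine ⟨h1.mono hsub, fun x hx t ht => (h2 x hx t ht ENNReal.ofReal_lt_top).1, fun x hx t ht =>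
    (h2 x hx t ht ENNReal.ofReal_lt_top).2.hasDerivAt, h3.mono hsub2, fun x hx t ht => ?_,
    fun x hx t ht => S.a_mem x (subset_closure hx) _, hbd⟩
  exact h5 x hx t ht ENNReal.ofReal_lt_top

theorem mquad_small {A B : Matrix (Fin n) (Fin n) ℝ} {δ : ℝ} (h : ∀ i j, |A i j - B i j| ≤ δ) (p : Eu n) :
    |mquad A p - mquad B p| ≤ (n * n * δ) * ‖p‖ ^ 2 := by
  rw [← mquad_sub]
  unfold mquad
  have hp : ∀ i, |p i| ≤ ‖p‖ := fun i => by
    have := PiLp.norm_apply_le p i; simpa using this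
  calc |∑ i, ∑ j, (A - B) i j * p i * p j| ≤ ∑ i, |∑ j, (A - B) i j * p i * p j| :=
        Finset.abs_sum_le_sum_abs _ _
    _ ≤ ∑ i : Fin n, ∑ j : Fin n, δ * ‖p‖ * ‖p‖ := by
        refine Finset.sum_le_sum fun i _ => (Finset.abs_sum_le_sum_abs _ _).trans
          (Finset.sum_le_sum fun j _ => ?_)
        rw [abs_mul, abs_mul]
        have h1 := h i j
        have h0 : 0 ≤ δ := (abs_nonneg _).trans h1
        have h2 : |(A - B) i j| ≤ δ := h1
        have := hp i
        have := hp j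
        gcongr
    _ = _ := by simp; ring

theorem a_mod (S : SettingB n) (R : ℝ) {η : ℝ} (hη : 0 < η) : ∃ d > 0, ∀ x ∈ closure S.Ω, ∀ y ∈ closure S.Ω,
    ∀ c c' : ℝ, |c| ≤ R → |c'| ≤ R → ‖x - y‖ ≤ d → |c - c'| ≤ d → ∀ p : Eu n,
      |mquad (S.a x c) p - mquad (S.a y c') p| ≤ η * ‖p‖ ^ 2 := by
  have hK : IsCompact (closure S.Ω ×ˢ Icc (-R) R) :=
    S.domain.2.1.isCompact_closure.prod isCompact_Icc
  set F : Eu n × ℝ → (Fin n → Fin n → ℝ) := fun p => S.a p.1 p.2 with hF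
  have hFc : ContinuousOn F (closure S.Ω ×ˢ Icc (-R) R) :=
    S.a_cont.mono (prod_mono le_rfl (subset_univ _))
  have hu := hK.uniformContinuousOn_of_continuous hFc
  rw [Metric.uniformContinuousOn_iff_le] at hu
  obtain ⟨d, hd, hdu⟩ := hu (η / (n * n + 1)) (by positivity)
  refine ⟨d, hd, fun x hx y hy c c' hc hc' hxy hcc p => ?_⟩
  have h1 := hdu (x, c) ⟨hx, abs_le.1 hc⟩ (y, c') ⟨hy, abs_le.1 hc'⟩ (by
    rw [Prod.dist_eq]
    exact max_le (by rw [dist_eq_norm]; exact hxy) (by rw [Real.dist_eq]; exact hcc))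
  have h2 : ∀ i j, |S.a x c i j - S.a y c' i j| ≤ η / (n * n + 1) := by
    intro i j
    have e1 := (dist_le_pi_dist (F (x, c)) (F (y, c')) i).trans h1
    have e2 := (dist_le_pi_dist (F (x, c) i) (F (y, c') i) j).trans e1
    rwa [Real.dist_eq] at e2
  refine (mquad_small h2 p).trans ?_
  gcongr
  rw [mul_div_assoc', div_le_iff₀ (by positivity)]
  nlinarith

end Part19

section Part20

/-! ### Local constancy on compact subsets -/

theorem BD_of (S : SettingB n) {L : NNReal} (hL : LipschitzWith L S.b) {ε C r : ℝ} (hε : 0 < ε) (hC : 0 < C)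
    (hr : 0 < r) (hr0 : r < S.r₀) : BD S.Ω S.b S.θ₀ ε C r S.b₀ L := by
  refine ⟨S.θ₀_mem.1, hε, hC, hr, S.b₀_pos, L.2, (closedBall_subset_closedBall hr0.le).trans S.ball_sub, ?_, ?_⟩
  · intro x hx
    exact S.b_coerc x (closedBall_subset_ball hr0 hx)
  · intro x
    have := hL.dist_le_mul x 0
    rwa [S.b_zero, dist_zero_right, dist_zero_right] at this

set_option maxHeartbeats 1000000 in
theorem loc_const (S : SettingB n) (hn : 0 < n) {C a₁ r σ w0 ω : ℝ} (hC : 0 < C) (ha : 0 < a₁) (hr : 0 < r)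
    (hr4 : r ≤ S.r₀ / 4) {D U D1 : Set (Eu n)} (hD : IsCompact D) (hDΩ : D ⊆ S.Ω) (hU : IsOpen U) (hUD : U ⊆ D)
    (hD1 : D1 ⊆ D) {g : Eu n → ℝ} (hg : ContDiff ℝ 2 g) (hσ : 0 < σ) (hw0 : 0 ≤ w0)
    (hdr : ∀ x ∈ D, r ≤ ‖x‖ → dotp (S.b x) (gradient g x) ≤ -(2 * σ))
    (hg1 : ∀ x ∈ D1, g x ≤ w0) (hg2 : ∀ x ∈ D \ U, w0 + 1 ≤ g x) (hg3 : ∀ x ∈ D, -1 ≤ g x) (hω : 0 < ω) :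
    ∀ᶠ ε in 𝓝[>] (0:ℝ), ∀ u : Eu n → ℝ → ℝ, S.SolvesQL ε u → (∀ x ∈ S.Ω, ∀ t > (0:ℝ), |u x t| ≤ C) →
      ∀ t, Real.exp (a₁ / ε) ≤ t → ∀ x ∈ D1, |u x t - u 0 t| ≤ ω := by
  have hθ := S.θ₀_mem.1
  have hr0 := S.r₀_pos
  obtain ⟨L, hL⟩ := S.b_lip
  obtain ⟨ρ, η, η3, hpar⟩ := par_exists n hθ (L : ℝ)
  obtain ⟨d', hd', hmod⟩ := a_mod S (C + 1) (η := η * S.θ₀) (mul_pos hpar.hη hθ)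
  set d0 := min d' 1 with hd0
  have hd0p : 0 < d0 := by rw [hd0]; positivity
  obtain ⟨k, hk⟩ := osc_decay hn hθ S.θ₀_mem.2 hC (r := S.r₀ / 2) (by positivity) S.b₀_pos hpar hd0p
    (show 0 < ω / 64 by positivity)
  set T := (w0 + 2) / σ with hT
  have hTp : 0 < T := by positivity
  obtain ⟨G, hG, hGb⟩ := C2_bounds hg hD hθ
  set κ := σ / 2 / (S.θ₀⁻¹ * G ^ 2) with hκ
  have hκp : 0 < κ := by positivity
  have hκe : κ * (S.θ₀⁻¹ * G ^ 2) = σ / 2 := by rw [hκ]; field_simp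
  have hcb := const_ball (n := n) (θ := S.θ₀) (C := C) (r := r) (b₀ := S.b₀) (Lb := L) (T := T) (ω := ω / 64)
    hθ hr S.b₀_pos hTp.le (by positivity)
  have t1 := (exp_small ha (2 * k + T + 1) k).eventually_lt_const one_pos
  have t2 := (exp_small (half_pos hκp) (8 * C) 0).eventually_lt_const (half_pos hω)
  have t3 : ∀ᶠ ε in 𝓝[>] (0:ℝ), ε < σ / 2 / G :=
    (eventually_lt_nhds (by positivity : 0 < σ / 2 / G)).filter_mono nhdsWithin_le_nhds
  filter_upwards [hk, hcb, t1, t2, t3, self_mem_nhdsWithin] with ε hk hcb t1 t2 t3 hε u hu hbd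
  have hε : 0 < ε := hε
  have hLS := LS_of S hu hbd
  have hosc := hk S.Ω S.b _ u (fun c => S.a 0 c) (BD_of S hL hε hC (by positivity) (by linarith)) hLS
    (fun c => S.a_mem 0 (subset_closure S.zero_mem) c) (by
      intro x hx hxΩ t ht c hc p
      have e1 := hbd x hxΩ t ht
      have hd1 : d0 ≤ d' := min_le_left _ _
      have hd2 : d0 ≤ 1 := min_le_right _ _
      refine hmod x (subset_closure hxΩ) 0 (subset_closure S.zero_mem) _ _ (by linarith) ?_
        (by rw [sub_zero]; linarith) (by linarith) p
      rw [abs_le] at *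
      constructor <;> linarith)
  have hBr := BD_of S hL hε hC hr (by linarith)
  have key : ∀ w : Eu n → ℝ → ℝ, LS S.Ω S.b S.θ₀ ε C (fun x t => S.a x (u x t)) w →
      (∀ t, k * (2 + 1 / ε) < t → ∀ x ∈ closedBall (0 : Eu n) r, ∀ y ∈ closedBall (0 : Eu n) r,
        w x t - w y t ≤ 4 * (ω / 64)) →
      ∀ t, Real.exp (a₁ / ε) ≤ t → ∀ x ∈ D1, w x t - w 0 t ≤ ω := by
    intro w hw hosc t ht x hx
    have hbig : k * (2 + 1 / ε) + T < t := by
      refine lt_of_lt_of_le ?_ ht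
      rw [Real.exp_neg, inv_mul_lt_iff₀ (Real.exp_pos _)] at t1
      have : (2 * k + T + 1 + k / ε) = k * (2 + 1 / ε) + T + 1 := by ring
      linarith
    have hk0 : 0 ≤ k * (2 + 1 / ε) := by positivity
    have h00 : (0 : Eu n) ∈ closedBall (0 : Eu n) r := by simp [hr.le]
    have ht0 : 0 < t := by linarith
    have hw0t := abs_le.1 (hw.bd 0 S.zero_mem t ht0)
    have hz : ∀ s, t - T ≤ s → s ≤ t → w 0 s ≤ w 0 t + 5 * (ω / 64) := by
      intro s hs1 hs2
      have hs0 : 0 < s := by linarith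
      have hw0s := abs_le.1 (hw.bd 0 S.zero_mem s hs0)
      have := hcb S.Ω S.b _ _ hBr hw.neg s hs0 (-w 0 s + 4 * (ω / 64)) (by linarith)
        (fun y hy => by
          have := hosc s (by linarith) 0 h00 y hy
          show -w y s ≤ _
          linarith) t hs2 (by linarith)
      linarith
    have := LC_barrier hθ hε hC hw hD hDΩ hU hUD hD1 hg hσ hκp hw0 hGb hdr hκe.le
      (by rw [lt_div_iff₀ hG] at t3; exact t3.le) hg1 hg2 hg3 (M := w 0 t + 9 * (ω / 64)) (t0 := t - T)
      (by linarith) (by linarith) (by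
        intro y hy s hs1 hs2
        rw [← hT, sub_add_cancel] at hs2
        have e1 := hosc s (by linarith) y hy 0 h00
        have e2 := hz s hs1 hs2
        linarith) x hx
    rw [← hT, sub_add_cancel] at this
    have e3 : 8 * C * Real.exp (-(κ / 2 / ε)) < ω / 2 := by
      have : Real.exp (-(κ / 2 / ε)) * (8 * C + 0 / ε) = 8 * C * Real.exp (-(κ / 2 / ε)) := by ring
      linarith
    linarith
  have hsub : closedBall (0 : Eu n) r ⊆ closedBall (0 : Eu n) (S.r₀ / 2 / 2) :=
    closedBall_subset_closedBall (by linarith)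
  intro t ht x hx
  have k1 := key u hLS (fun t ht x hx y hy => hosc t ht x (hsub hx) y (hsub hy)) t ht x hx
  have k2 := key _ hLS.neg (fun t ht x hx y hy => by
    have := hosc t ht y (hsub hy) x (hsub hx)
    linarith) t ht x hx
  rw [abs_le]
  constructor <;> linarith

end Part20

section Part21

/-! ### The final comparison -/

theorem last_time {h : ℝ → ℝ} {T1 T2 δ : ℝ} (hT : T1 ≤ T2) (hc : ContinuousOn h (Icc T1 T2))
    (h1 : δ ≤ h T1) (h2 : h T2 ≤ δ) :
    ∃ t ∈ Icc T1 T2, h t = δ ∧ ∀ s ∈ Icc t T2, h s ≤ δ := by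
  set Z := Icc T1 T2 ∩ h ⁻¹' {δ} with hZ
  have hZc : IsCompact Z := isCompact_Icc.of_isClosed_subset
    (hc.preimage_isClosed_of_isClosed isClosed_Icc isClosed_singleton) inter_subset_left
  have hZn : Z.Nonempty := by
    obtain ⟨t, ht, hte⟩ := intermediate_value_Icc' hT hc ⟨h2, h1⟩
    exact ⟨t, ht, hte⟩
  obtain ⟨t, ht, hmax⟩ := hZc.exists_isMaxOn hZn continuousOn_id
  refine ⟨t, ht.1, ht.2, fun s hs => ?_⟩
  by_contra hcon
  push Not at hcon
  have hsub : Icc s T2 ⊆ Icc T1 T2 := Icc_subset_Icc_left (ht.1.1.trans hs.1)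
  obtain ⟨t', ht', hte'⟩ := intermediate_value_Icc' hs.2 (hc.mono hsub) ⟨h2, hcon.le⟩
  have h3 : t' ≤ t := hmax (show t' ∈ Z from ⟨hsub ht', hte'⟩)
  have h4 : s = t' := le_antisymm ht'.1 (h3.trans hs.1)
  rw [h4, hte'] at hcon
  exact lt_irrefl _ hcon

set_option maxHeartbeats 2000000 in
theorem final_ev (S : SettingB n) (hn : 0 < n) {C a₁ m m1 β Δ : ℝ} (hC : 0 < C) (ha : 0 < a₁)
    (hm : 0 < m) (hmm : m < m1) (hM : m1 < S.M β) (hβ : |β| ≤ C) (hΔ : 0 < Δ) :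
    ∀ᶠ ε in 𝓝[>] (0:ℝ), ∀ u : Eu n → ℝ → ℝ, S.SolvesQL ε u → (∀ x ∈ S.Ω, ∀ t > (0:ℝ), |u x t| ≤ C) →
      ∀ T1 T2, Real.exp (a₁ / ε) ≤ T1 → T1 ≤ T2 → T2 ≤ Real.exp (m / ε) → u 0 T2 = β →
      |u 0 T1 - β| < Δ := by
  have hθ := S.θ₀_mem.1
  have hr0 := S.r₀_pos
  obtain ⟨L, hL⟩ := S.b_lip
  obtain ⟨X, hX⟩ := S.b_gas
  obtain ⟨hΩo, hΩb, ρ, hρ, hΩ, hν⟩ := S.domain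
  set gap := m1 - m with hgap
  have hgp : 0 < gap := by rw [hgap]; linarith
  have hα : ContinuousOn (fun x => S.a x β) S.Ω := by
    have : ContinuousOn ((fun p : Eu n × ℝ => S.a p.1 p.2) ∘ fun x => (x, β)) S.Ω :=
      S.a_cont.comp (by fun_prop) fun x hx => ⟨subset_closure hx, mem_univ _⟩
    exact this
  obtain ⟨v, K, hvL, hv0, hvf, hvH⟩ := qp_sub hΩo hΩb S.zero_mem hα hL.continuous
    (m := m1) (by linarith) hM
  obtain ⟨d1, hd1, hdb1⟩ := near_bdry hΩb hρ.continuous hΩ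
    (q := fun x => - dotp (S.b x) (gradient ρ x)) (by
      have : Continuous (gradient ρ) := by
        unfold gradient
        exact (LinearIsometryEquiv.continuous _).comp (hρ.continuous_fderiv one_ne_zero)
      simp only [dotp_eq_inner]
      exact (hL.continuous.inner this).neg.continuousOn) (by
      intro x hx
      have h1 := S.b_inward x hx
      rw [(hν x hx).2, dotp_smul_right] at h1
      have h2 : 0 < ‖gradient ρ x‖⁻¹ := inv_pos.2 (norm_pos_iff.2 (hν x hx).1)
      have h3 : dotp (S.b x) (gradient ρ x) < 0 := by
        by_contra hc
        push Not at hc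
        linarith [mul_nonneg h2.le hc]
      linarith)
  obtain ⟨d2, hd2, hdb2⟩ := near_bdry hΩb hρ.continuous hΩ (q := fun x => v x - m1)
    (hvL.continuous.sub continuous_const).continuousOn (fun x hx => by linarith [hvf x hx])
  set d := min d1 d2 / 3 with hd
  have hdp : 0 < d := by rw [hd]; positivity
  have h3d1 : 3 * d ≤ d1 := by have := min_le_left d1 d2; rw [hd]; linarith
  have h3d2 : 3 * d ≤ d2 := by have := min_le_right d1 d2; rw [hd]; linarith
  set r := min (S.r₀ / 4) (gap / 8 / (K + 1)) with hr
  have hrp : 0 < r := by rw [hr]; positivity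
  have hr4 : r ≤ S.r₀ / 4 := min_le_left _ _
  have hKr : K * r ≤ gap / 8 := by
    have h1 : r ≤ gap / 8 / (K + 1) := min_le_right _ _
    rw [le_div_iff₀ (by positivity)] at h1
    nlinarith
  obtain ⟨g, w0, σ, hg, hσ, hw0, hgd, hg1, hg2, hg3⟩ := lyap_g hΩb hρ hΩ hL hX hdp hrp
    (fun x hx h => by linarith [hdb1 x hx (by linarith)])
  obtain ⟨hDc, hDΩ⟩ := Dd_compact hΩb hρ.continuous hΩ hdp
  obtain ⟨hDc1, hDΩ1⟩ := Dd_compact hΩb hρ.continuous hΩ (show 0 < 3 * d by positivity)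
  have hD1D : {x | ρ x ≤ -(3 * d)} ⊆ {x | ρ x ≤ -d} := fun x hx => by
    have : ρ x ≤ -(3 * d) := hx
    show ρ x ≤ -d
    linarith
  have h0D : (0 : Eu n) ∈ {x | ρ x ≤ -(3 * d)} := by
    show ρ 0 ≤ -(3 * d)
    by_contra hc
    push Not at hc
    have := hdb2 0 S.zero_mem (by linarith)
    rw [hv0] at this
    linarith
  obtain ⟨f, σ2, hf, hσ2, hfH, hf1, hf2⟩ := bar_f (m1 := m1) hΩo hDc1 hDΩ1 hθ hα
    (fun x hx => S.a_mem x (subset_closure hx) β) hL.continuous hvL hv0 hvH hg hσ hgp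
    (fun x hx hrx => hgd x (hD1D hx) hrx) hKr
  obtain ⟨G, hG, hGb⟩ := C2_bounds hf hDc1 hθ
  obtain ⟨B, hB⟩ := hDc1.exists_bound_of_continuousOn hL.continuous.continuousOn
  have hB0 : 0 ≤ B := (norm_nonneg _).trans (hB 0 h0D)
  obtain ⟨d', hd', hmod⟩ := a_mod S C (η := σ2 / G ^ 2) (by positivity)
  set δ := min Δ (d' / 2) with hδ
  have hδp : 0 < δ := by rw [hδ]; positivity
  have hδ1 : δ ≤ Δ := min_le_left _ _
  have hδ2 : 2 * δ ≤ d' := by have := min_le_right Δ (d' / 2); rw [hδ]; linarith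
  have hlc := loc_const S hn hC ha hrp hr4 hDc hDΩ (U := {x | ρ x < -d})
    (isOpen_lt hρ.continuous continuous_const) (fun x hx => show ρ x ≤ -d from le_of_lt hx) hD1D hg hσ hw0
    (fun x hx => hgd x hx) (fun x hx => hg1 x hx)
    (fun x hx => hg2 x (le_antisymm hx.1 (not_lt.1 hx.2))) (fun x hx => hg3 x hx)
    (show 0 < δ / 10 by positivity)
  have t1 := (exp_small (half_pos hgp) (2 * C + 2 * C * G)
    (2 * C * (B * G + S.θ₀⁻¹ * G ^ 2))).eventually_lt_const (half_pos hδp)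
  have t2 : ∀ᶠ ε in 𝓝[>] (0:ℝ), ε < σ2 / G :=
    (eventually_lt_nhds (by positivity : 0 < σ2 / G)).filter_mono nhdsWithin_le_nhds
  filter_upwards [hlc, t1, t2, self_mem_nhdsWithin] with ε hlc t1 t2 hε u hu hbd T1 T2 hT1 hT12 hT2 huT
  have hε : 0 < ε := hε
  have hLS := LS_of S hu hbd
  have hlc := hlc u hu hbd
  have hT1p : 0 < T1 := (Real.exp_pos _).trans_le hT1
  by_contra hcon
  push Not at hcon
  have hcont : ContinuousOn (fun t => |u 0 t - β|) (Icc T1 T2) := by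
    have : ContinuousOn (fun t => u 0 t) (Icc T1 T2) := fun t ht =>
      (hLS.dt 0 S.zero_mem t (hT1p.trans_le ht.1)).continuousAt.continuousWithinAt
    exact (this.sub continuousOn_const).abs
  obtain ⟨ts, hts, hte, htl⟩ := last_time (δ := δ) hT12 hcont (hδ1.trans hcon)
    (by simp only [huT, sub_self, abs_zero]; exact hδp.le)
  have htsp : 0 < ts := hT1p.trans_le hts.1
  have key : ∀ w : Eu n → ℝ → ℝ, LS S.Ω S.b S.θ₀ ε C (fun x t => S.a x (u x t)) w →
      (∀ x ∈ {x | ρ x ≤ -(3 * d)}, w x ts ≤ w 0 ts + δ / 10) → w 0 T2 < w 0 ts + δ / 10 + δ / 2 := by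
    intro w hw hw1
    have hw0t := abs_le.1 (hw.bd 0 S.zero_mem ts htsp)
    have := FB hθ hε hC hw hDc1 hDΩ1 (U := {x | ρ x < -(3 * d)})
      (isOpen_lt hρ.continuous continuous_const) (fun x hx => show ρ x ≤ -(3 * d) from le_of_lt hx) hf (σ := σ2)
      (m' := m1 - gap / 4) (s0 := gap / 4) (r := r) hB0 hGb hB
      (by rw [lt_div_iff₀ hG] at t2; exact t2.le) hf1
      (fun x hx => hf2 x hx.1 (by
        have h1 : ρ x = -(3 * d) := le_antisymm hx.1 (not_lt.1 hx.2)
        have := hdb2 x (hDΩ1 hx.1) (by linarith)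
        linarith)) htsp hts.2 (M := w 0 ts + δ / 10) (by linarith) (by
        intro x hx hrx t ht1 ht2
        have htp : 0 < t := htsp.trans_le ht1
        have e1 := hfH x hx hrx.le
        unfold Ham at e1
        have e2 := hlc t (hT1.trans (hts.1.trans ht1)) x hx
        have e3 := htl t ⟨ht1, ht2⟩
        have e4 : |u x t - β| ≤ d' := by
          have := abs_sub_le (u x t) (u 0 t) β
          linarith
        have hxc := subset_closure (hDΩ1 hx)
        have e5 := hmod x hxc x hxc (u x t) β (hbd x (hDΩ1 hx) t htp) hβ (by simp [hd'.le]) e4 (gradient f x)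
        have e6 : σ2 / G ^ 2 * ‖gradient f x‖ ^ 2 ≤ σ2 := by
          calc σ2 / G ^ 2 * ‖gradient f x‖ ^ 2 ≤ σ2 / G ^ 2 * G ^ 2 := by gcongr; exact (hGb x hx).1
            _ = σ2 := by field_simp
        have e7 := (abs_le.1 e5).2
        linarith) hw1 0 h0D
    have f0 : f 0 ≤ gap / 4 := hf1 0 h0D (by simp [hrp.le])
    have q1 : Real.exp ((f 0 - (m1 - gap / 4)) / ε) ≤ Real.exp (-(gap / 2 / ε)) := by
      apply Real.exp_le_exp.2
      rw [← neg_div]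
      gcongr
      linarith
    have q2 : Real.exp ((gap / 4 - (m1 - gap / 4)) / ε) * (T2 - ts) ≤ Real.exp (-(gap / 2 / ε)) := by
      calc _ ≤ Real.exp ((gap / 4 - (m1 - gap / 4)) / ε) * Real.exp (m / ε) := by gcongr; linarith
        _ = Real.exp (-(gap / 2 / ε)) := by
          rw [← Real.exp_add]; congr 1; rw [hgap]; ring
    have q3 : 2 * C * Real.exp ((gap / 4 - (m1 - gap / 4)) / ε) * (G + (B * G + S.θ₀⁻¹ * G ^ 2) / ε) * (T2 - ts)
        ≤ 2 * C * (G + (B * G + S.θ₀⁻¹ * G ^ 2) / ε) * Real.exp (-(gap / 2 / ε)) := by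
      have := mul_le_mul_of_nonneg_left q2
        (show 0 ≤ 2 * C * (G + (B * G + S.θ₀⁻¹ * G ^ 2) / ε) by positivity)
      linarith
    have q4 : 2 * C * Real.exp ((f 0 - (m1 - gap / 4)) / ε) ≤ 2 * C * Real.exp (-(gap / 2 / ε)) := by gcongr
    have q5 : Real.exp (-(gap / 2 / ε)) * (2 * C + 2 * C * G + 2 * C * (B * G + S.θ₀⁻¹ * G ^ 2) / ε) =
      2 * C * Real.exp (-(gap / 2 / ε)) +
        2 * C * (G + (B * G + S.θ₀⁻¹ * G ^ 2) / ε) * Real.exp (-(gap / 2 / ε)) := by ring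
    linarith
  have hl := fun x hx => abs_le.1 (hlc ts (hT1.trans hts.1) x hx)
  rcases eq_or_eq_neg_of_abs_eq hte with h | h
  · have := key _ hLS.neg (fun x hx => by linarith [(hl x hx).1])
    simp only [huT] at this
    linarith
  · have := key u hLS (fun x hx => by linarith [(hl x hx).2])
    rw [huT] at this
    linarith

theorem main_stmt {n : ℕ} (S : SettingB n) (u : ℝ → Eu n → ℝ → ℝ)
    (hu : ∀ ε ∈ Set.Ioo (0:ℝ) 1, S.SolvesQL ε (u ε))
    (C : ℝ)
    (hbd : ∀ ε ∈ Set.Ioo (0:ℝ) 1, ∀ x ∈ S.Ω, ∀ t > (0:ℝ), |u ε x t| ≤ C)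
    (μ lam εk : ℕ → ℝ) (a₁ a₂ β₁ β₂ : ℝ)
    (ha₁ : 0 < a₁) (ha₁₂ : a₁ < a₂)
    (hεk : ∀ k, εk k ∈ Set.Ioo (0:ℝ) 1)
    (hεk0 : Filter.Tendsto εk Filter.atTop (nhds 0))
    (hk : ∀ k, a₁ ≤ μ k ∧ μ k < lam k ∧ lam k ≤ a₂)
    (hβ₁ : ∀ k, u (εk k) 0 (Real.exp (μ k / εk k)) = β₁)
    (hβ₂ : ∀ k, u (εk k) 0 (Real.exp (lam k / εk k)) = β₂)
    (hne : β₁ ≠ β₂) :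
    S.M β₂ ≤ Filter.limsup lam Filter.atTop := by
  by_contra hcon
  push Not at hcon
  obtain ⟨m, hm1, hm2⟩ := exists_between hcon
  obtain ⟨m1, hmm, hmM⟩ := exists_between hm2
  have hbdd : IsBoundedUnder (· ≤ ·) atTop lam := isBoundedUnder_of ⟨a₂, fun k => (hk k).2.2⟩
  have hev := eventually_lt_of_limsup_lt hm1 hbdd
  have hm0 : 0 < m := by
    obtain ⟨k, hk1⟩ := hev.exists
    have := hk k
    linarith
  have hn : 0 < n := by
    by_contra hc
    have h0 : n = 0 := by omega
    subst h0
    have hun : S.Ω = univ := by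
      apply eq_univ_of_forall
      intro x
      rw [Subsingleton.elim x 0]; exact S.zero_mem
    have : S.M β₂ = 0 := by
      unfold SettingB.M
      rw [hun, frontier_univ, image_empty, Real.sInf_empty]
    linarith
  set C' := max C 1 with hC'
  have hC'p : 0 < C' := lt_of_lt_of_le one_pos (le_max_right _ _)
  have hbd' : ∀ ε ∈ Set.Ioo (0:ℝ) 1, ∀ x ∈ S.Ω, ∀ t > (0:ℝ), |u ε x t| ≤ C' :=
    fun ε hε x hx t ht => (hbd ε hε x hx t ht).trans (le_max_left _ _)
  have hβC : |β₂| ≤ C' := by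
    rw [← hβ₂ 0]; exact hbd' _ (hεk 0) 0 S.zero_mem _ (Real.exp_pos _)
  have hΔ : 0 < |β₁ - β₂| := abs_pos.2 (sub_ne_zero.2 hne)
  have hE := final_ev S hn hC'p ha₁ hm0 hmm hmM hβC hΔ
  have htend : Tendsto εk atTop (𝓝[>] 0) :=
    tendsto_nhdsWithin_iff.2 ⟨hεk0, Eventually.of_forall fun k => (hεk k).1⟩
  obtain ⟨k, h1, h2⟩ := ((htend.eventually hE).and hev).exists
  have hp := (hεk k).1
  obtain ⟨k1, k2, k3⟩ := hk k
  have := h1 (u (εk k)) (hu _ (hεk k)) (hbd' _ (hεk k)) (Real.exp (μ k / εk k)) (Real.exp (lam k / εk k))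
    (Real.exp_le_exp.2 (by gcongr)) (Real.exp_le_exp.2 (by gcongr)) (Real.exp_le_exp.2 (by gcongr)) (hβ₂ k)
  rw [hβ₁ k] at this
  exact lt_irrefl _ this

end Part21

/-- Proposition 1.2: if the value at the origin changes between two exponential times,
the later time scale must exceed `M(β₂)`. -/
theorem stmt1 {n : ℕ} (S : SettingB n) (u : ℝ → Eu n → ℝ → ℝ)
    (hu : ∀ ε ∈ Set.Ioo (0:ℝ) 1, S.SolvesQL ε (u ε))
    (C : ℝ)
    (hbd : ∀ ε ∈ Set.Ioo (0:ℝ) 1, ∀ x ∈ S.Ω, ∀ t > (0:ℝ), |u ε x t| ≤ C)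
    (μ lam εk : ℕ → ℝ) (a₁ a₂ β₁ β₂ : ℝ)
    (ha₁ : 0 < a₁) (ha₁₂ : a₁ < a₂)
    (hεk : ∀ k, εk k ∈ Set.Ioo (0:ℝ) 1)
    (hεk0 : Filter.Tendsto εk Filter.atTop (nhds 0))
    (hk : ∀ k, a₁ ≤ μ k ∧ μ k < lam k ∧ lam k ≤ a₂)
    (hβ₁ : ∀ k, u (εk k) 0 (Real.exp (μ k / εk k)) = β₁)
    (hβ₂ : ∀ k, u (εk k) 0 (Real.exp (lam k / εk k)) = β₂)
    (hne : β₁ ≠ β₂) :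
    S.M β₂ ≤ Filter.limsup lam Filter.atTop := by
  exact main_stmt S u hu C hbd μ lam εk a₁ a₂ β₁ β₂ ha₁ ha₁₂ hεk hεk0 hk hβ₁ hβ₂ hne
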